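/- Let ω : ℝ² → ℝ be a homogeneous polynomial of degree d ≥ 2, and let K_ω(ξ,μ) := det Hess ω(ξ,μ) = ∂²_ξω(ξ,μ)·∂²_μω(ξ,μ) − (∂_ξ∂_μω(ξ,μ))². Then there exists a constant C > 0 (depending only on ω) such that for every Schwartz function f on ℝ², the function F(t,x,y) := (2π)^{−2} ∫_{ℝ²} e^{i(xξ + yμ + tω(ξ,μ))} |K_ω(ξ,μ)|^{1/8} f̂(ξ,μ) dξ dμ satisfies ‖F‖_{L⁴(ℝ³)} ≤ C ‖f‖_{L²(ℝ²)}. -/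

import Mathlib

open MeasureTheory

noncomputable section

/-- Partial derivative in the first variable. -/
def pdx (f : ℝ × ℝ → ℝ) (p : ℝ × ℝ) : ℝ := deriv (fun x => f (x, p.2)) p.1

/-- Partial derivative in the second variable. -/
def pdy (f : ℝ × ℝ → ℝ) (p : ℝ × ℝ) : ℝ := deriv (fun y => f (p.1, y)) p.2

/-- Determinant of the Hessian: `K_ω = ∂²_ξω · ∂²_μω − (∂_ξ∂_μω)²`. -/
def hessDet (ω : ℝ × ℝ → ℝ) (p : ℝ × ℝ) : ℝ :=
  pdx (pdx ω) p * pdy (pdy ω) p - (pdx (pdy ω) p) ^ 2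

/-- The Fourier transform on ℝ². -/
def ftn2 (u : ℝ × ℝ → ℂ) (p : ℝ × ℝ) : ℂ :=
  ∫ q : ℝ × ℝ, Complex.exp (-(Complex.I * (q.1 * p.1 + q.2 * p.2))) * u q

open scoped ENNReal NNReal

theorem lintegral_comp_polynomial_mul_deriv_le (Q : Polynomial ℝ) {χ : ℝ → ℝ≥0∞} :
    ∫⁻ x, ENNReal.ofReal |Q.derivative.eval x| * χ (Q.eval x) ≤
      Q.natDegree * ∫⁻ y, χ y := by
  classical
  by_cases hQ : Q.derivative = 0
  · simp [hQ]
  set R := Q.derivative.roots.toFinset with hR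
  have hmem : ∀ x, x ∈ R ↔ Q.derivative.eval x = 0 := by
    intro x; simp [hR, hQ]
  have hdeg : Q.natDegree ≠ 0 := by
    intro h
    exact hQ (Polynomial.derivative_of_natDegree_zero h)
  have hcard : R.card < Q.natDegree := by
    calc R.card ≤ Q.derivative.roots.card := Multiset.toFinset_card_le _
      _ ≤ Q.derivative.natDegree := Polynomial.card_roots' _
      _ < Q.natDegree := Polynomial.natDegree_derivative_lt hdeg
  set N : ℝ → ℕ := fun x => ∑ r ∈ R, if r < x then 1 else 0 with hN
  have hNm : Measurable N := by
    refine Finset.measurable_sum _ fun r _ => ?_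
    exact Measurable.ite measurableSet_Ioi measurable_const measurable_const
  have hNlt : ∀ x, N x < Q.natDegree := by
    intro x
    refine lt_of_le_of_lt ?_ hcard
    simp only [hN, Finset.sum_boole]
    exact_mod_cast Finset.card_filter_le _ _
  set E : ℕ → Set ℝ := fun i => {x | Q.derivative.eval x ≠ 0} ∩ N ⁻¹' {i} with hE
  have hEm : ∀ i, MeasurableSet (E i) := by
    intro i
    refine MeasurableSet.inter ?_ (hNm (measurableSet_singleton i))
    exact (isOpen_ne_fun Q.derivative.continuous continuous_const).measurableSet
  have hinj : ∀ i, Set.InjOn (fun x => Q.eval x) (E i) := by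
    intro i
    have key : ∀ x ∈ E i, ∀ y ∈ E i, x < y → Q.eval x ≠ Q.eval y := by
      intro x hx y hy hxy h
      obtain ⟨c, hc, hc0⟩ := exists_deriv_eq_zero hxy Q.continuous.continuousOn h
      rw [Polynomial.deriv] at hc0
      have hcR : c ∈ R := (hmem c).2 hc0
      have h1 : N x < N y := by
        refine Finset.sum_lt_sum (fun r _ => ?_) ⟨c, hcR, ?_⟩
        · by_cases a : r < x
          · simp [a, a.trans hxy]
          · simp [a]
        · rw [if_neg (not_lt.2 hc.1.le), if_pos hc.2]; exact zero_lt_one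
      have hx2 : N x = i := hx.2
      have hy2 : N y = i := hy.2
      omega
    intro x hx y hy h
    by_contra hne
    rcases lt_or_gt_of_ne hne with h' | h'
    · exact key x hx y hy h' h
    · exact key y hy x hx h' h.symm
  calc ∫⁻ x, ENNReal.ofReal |Q.derivative.eval x| * χ (Q.eval x)
      = ∫⁻ x in {x | Q.derivative.eval x ≠ 0},
          ENNReal.ofReal |Q.derivative.eval x| * χ (Q.eval x) := by
        rw [← lintegral_indicator
          (isOpen_ne_fun Q.derivative.continuous continuous_const).measurableSet]
        refine lintegral_congr fun x => ?_
        by_cases hx : Q.derivative.eval x = 0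
        · simp [hx]
        · rw [Set.indicator_of_mem]; exact hx
    _ ≤ ∫⁻ x in ⋃ i ∈ Finset.range Q.natDegree, E i,
          ENNReal.ofReal |Q.derivative.eval x| * χ (Q.eval x) := by
        refine lintegral_mono_set fun x hx => ?_
        simp only [Set.mem_iUnion, Finset.mem_range]
        exact ⟨N x, hNlt x, hx, rfl⟩
    _ ≤ ∑ i ∈ Finset.range Q.natDegree, ∫⁻ x in E i,
          ENNReal.ofReal |Q.derivative.eval x| * χ (Q.eval x) := by
        rw [lintegral_biUnion_finset ?_ (fun i _ => hEm i)]
        intro i _ j _ hij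
        refine Set.disjoint_left.2 fun x hx hy => hij ?_
        exact hx.2.symm.trans hy.2
    _ = ∑ i ∈ Finset.range Q.natDegree, ∫⁻ y in (fun x => Q.eval x) '' E i, χ y := by
        refine Finset.sum_congr rfl fun i _ => ?_
        exact (lintegral_image_eq_lintegral_abs_deriv_mul (hEm i)
          (fun x _ => (Q.hasDerivAt x).hasDerivWithinAt) (hinj i) χ).symm
    _ ≤ ∑ i ∈ Finset.range Q.natDegree, ∫⁻ y, χ y :=
        Finset.sum_le_sum fun i _ => setLIntegral_le_lintegral _ _
    _ = Q.natDegree * ∫⁻ y, χ y := by simp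

/-- `f` is given by a real polynomial of degree at most `n`. -/
def PolyLE (n : ℕ) (f : ℝ → ℝ) : Prop :=
  ∃ Q : Polynomial ℝ, Q.natDegree ≤ n ∧ ∀ x, f x = Q.eval x

namespace PolyLE

variable {n : ℕ} {f g : ℝ → ℝ}

theorem add (hf : PolyLE n f) (hg : PolyLE n g) : PolyLE n (fun x => f x + g x) := by
  obtain ⟨P, hP, hfP⟩ := hf
  obtain ⟨Q, hQ, hgQ⟩ := hg
  exact ⟨P + Q, Polynomial.natDegree_add_le_of_degree_le hP hQ, fun x => by simp [hfP, hgQ]⟩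

theorem const (c : ℝ) : PolyLE n (fun _ => c) :=
  ⟨Polynomial.C c, by simp, fun x => by simp⟩

theorem const_mul (c : ℝ) (hf : PolyLE n f) : PolyLE n (fun x => c * f x) := by
  obtain ⟨P, hP, hfP⟩ := hf
  exact ⟨Polynomial.C c * P, (Polynomial.natDegree_C_mul_le _ _).trans hP,
    fun x => by simp [hfP]⟩

theorem sub (hf : PolyLE n f) (hg : PolyLE n g) : PolyLE n (fun x => f x - g x) := by
  have h := hf.add (hg.const_mul (-1))
  have h2 : (fun x => f x - g x) = fun x => f x + -1 * g x := by
    funext x; ring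
  rw [h2]; exact h

theorem comp_affine (a b : ℝ) (hf : PolyLE n f) : PolyLE n (fun x => f (a * x + b)) := by
  obtain ⟨P, hP, hfP⟩ := hf
  refine ⟨P.comp (Polynomial.C a * Polynomial.X + Polynomial.C b), ?_, fun x => by simp [hfP]⟩
  refine Polynomial.natDegree_comp_le.trans ?_
  calc P.natDegree * _ ≤ n * 1 := Nat.mul_le_mul hP Polynomial.natDegree_linear_le
    _ = n := mul_one n

theorem comp_const_add (b : ℝ) (hf : PolyLE n f) : PolyLE n (fun x => f (b + x)) := by
  have h := hf.comp_affine 1 b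
  have h2 : (fun x => f (b + x)) = fun x => f (1 * x + b) := by
    funext x; congr 1; ring
  rw [h2]; exact h

theorem comp_const_sub (b : ℝ) (hf : PolyLE n f) : PolyLE n (fun x => f (b - x)) := by
  have h := hf.comp_affine (-1) b
  have h2 : (fun x => f (b - x)) = fun x => f (-1 * x + b) := by
    funext x; congr 1; ring
  rw [h2]; exact h

theorem lintegral_le (hf : PolyLE n f) (χ : ℝ → ℝ≥0∞) :
    ∫⁻ x, ENNReal.ofReal |deriv f x| * χ (f x) ≤ n * ∫⁻ y, χ y := by
  obtain ⟨P, hP, hfP⟩ := hf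
  have h : f = fun x => P.eval x := funext hfP
  subst h
  simp only [Polynomial.deriv]
  refine (lintegral_comp_polynomial_mul_deriv_le P).trans ?_
  gcongr

theorem measurable (hf : PolyLE n f) : Measurable f := by
  obtain ⟨P, -, hfP⟩ := hf
  rw [show f = fun x => P.eval x from funext hfP]
  exact P.continuous.measurable

end PolyLE

theorem lintegral_le_of_le_pdx {n : ℕ} {F : ℝ × ℝ → ℝ}
    (hF : ∀ y, PolyLE n (fun x => F (x, y))) {χ : ℝ → ℝ≥0∞} (hχ : Measurable χ)
    {W : ℝ × ℝ → ℝ≥0∞} {g : ℝ → ℝ≥0∞} (hg : Measurable g)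
    (hW : ∀ p, W p ≤ ENNReal.ofReal |pdx F p| * g p.2) :
    ∫⁻ p, χ (F p) * W p ≤ n * (∫⁻ y, g y) * ∫⁻ s, χ s := by
  calc ∫⁻ p, χ (F p) * W p ≤ ∫⁻ y, ∫⁻ x, χ (F (x, y)) * W (x, y) := by
        rw [Measure.volume_eq_prod, ← lintegral_prod_swap]
        exact lintegral_prod_le _
    _ ≤ ∫⁻ y, ∫⁻ x, g y * (ENNReal.ofReal |deriv (fun x => F (x, y)) x| * χ (F (x, y))) := by
        refine lintegral_mono fun y => lintegral_mono fun x => ?_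
        calc χ (F (x, y)) * W (x, y)
            ≤ χ (F (x, y)) * (ENNReal.ofReal |pdx F (x, y)| * g y) := by
              gcongr; exact hW (x, y)
          _ = _ := by simp only [pdx]; ring
    _ ≤ ∫⁻ y, g y * (n * ∫⁻ s, χ s) := by
        refine lintegral_mono fun y => ?_
        rw [lintegral_const_mul]
        · gcongr
          exact (hF y).lintegral_le χ
        · exact ((measurable_deriv _).abs.ennreal_ofReal).mul (hχ.comp (hF y).measurable)
    _ = n * (∫⁻ y, g y) * ∫⁻ s, χ s := by
        rw [lintegral_mul_const _ hg]; ring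

theorem lintegral_le_of_le_pdy {n : ℕ} {F : ℝ × ℝ → ℝ}
    (hF : ∀ x, PolyLE n (fun y => F (x, y))) {χ : ℝ → ℝ≥0∞} (hχ : Measurable χ)
    {W : ℝ × ℝ → ℝ≥0∞} {g : ℝ → ℝ≥0∞} (hg : Measurable g)
    (hW : ∀ p, W p ≤ ENNReal.ofReal |pdy F p| * g p.1) :
    ∫⁻ p, χ (F p) * W p ≤ n * (∫⁻ x, g x) * ∫⁻ s, χ s := by
  have h := lintegral_le_of_le_pdx (F := fun p => F p.swap) (W := fun p => W p.swap)
    (fun y => hF y) hχ hg (fun p => hW p.swap)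
  rw [Measure.volume_eq_prod, ← lintegral_prod_swap]
  exact h

theorem ENNReal.mul_le_sq_add_sq (a b : ℝ≥0∞) : a * b ≤ a ^ 2 + b ^ 2 := by
  rcases le_total a b with h | h
  · calc a * b ≤ b * b := by gcongr
      _ = b ^ 2 := (sq b).symm
      _ ≤ _ := le_add_self
  · calc a * b ≤ a * a := by gcongr
      _ = a ^ 2 := (sq a).symm
      _ ≤ _ := le_self_add

theorem ENNReal.add_sq_le (a b : ℝ≥0∞) : (a + b) ^ 2 ≤ 4 * (a ^ 2 + b ^ 2) := by
  rcases le_total a b with h | h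
  · calc (a + b) ^ 2 ≤ (b + b) ^ 2 := by gcongr
      _ = 4 * b ^ 2 := by ring
      _ ≤ _ := by gcongr; exact le_add_self
  · calc (a + b) ^ 2 ≤ (a + a) ^ 2 := by gcongr
      _ = 4 * a ^ 2 := by ring
      _ ≤ _ := by gcongr; exact le_self_add

theorem sq_lintegral_mul_le {α : Type*} [MeasurableSpace α] {m : Measure α}
    {w a b : α → ℝ≥0∞} (hw : Measurable w) (ha : Measurable a) (hb : Measurable b) :
    (∫⁻ x, w x * (a x * b x) ∂m) ^ 2 ≤
      2 * ((∫⁻ x, w x * a x ^ 2 ∂m) * ∫⁻ x, w x * b x ^ 2 ∂m) := by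
  have h1 : ∀ f g : α → ℝ≥0∞, Measurable f → Measurable g →
      (∫⁻ x, f x ∂m) * ∫⁻ y, g y ∂m = ∫⁻ x, ∫⁻ y, f x * g y ∂m ∂m := by
    intro f g hf hg
    rw [← lintegral_mul_const _ hf]
    exact lintegral_congr fun x => (lintegral_const_mul _ hg).symm
  have hA : Measurable fun x => w x * a x ^ 2 := by fun_prop
  have hB : Measurable fun x => w x * b x ^ 2 := by fun_prop
  calc (∫⁻ x, w x * (a x * b x) ∂m) ^ 2
      = ∫⁻ x, ∫⁻ y, (w x * (a x * b x)) * (w y * (a y * b y)) ∂m ∂m := by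
        rw [sq, h1 _ _ (by fun_prop) (by fun_prop)]
    _ ≤ ∫⁻ x, ∫⁻ y, ((w x * a x ^ 2) * (w y * b y ^ 2) +
          (w x * b x ^ 2) * (w y * a y ^ 2)) ∂m ∂m := by
        refine lintegral_mono fun x => lintegral_mono fun y => ?_
        calc (w x * (a x * b x)) * (w y * (a y * b y))
            = w x * w y * ((a x * b y) * (b x * a y)) := by ring
          _ ≤ w x * w y * ((a x * b y) ^ 2 + (b x * a y) ^ 2) := by
              gcongr; exact ENNReal.mul_le_sq_add_sq _ _
          _ = _ := by ring
    _ = ∫⁻ x, (∫⁻ y, (w x * a x ^ 2) * (w y * b y ^ 2) ∂m +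
          ∫⁻ y, (w x * b x ^ 2) * (w y * a y ^ 2) ∂m) ∂m := by
        refine lintegral_congr fun x => ?_
        rw [lintegral_add_left (by fun_prop)]
    _ = 2 * ((∫⁻ x, w x * a x ^ 2 ∂m) * ∫⁻ x, w x * b x ^ 2 ∂m) := by
        have e1 : ∀ x, ∫⁻ y, (w x * a x ^ 2) * (w y * b y ^ 2) ∂m =
            (w x * a x ^ 2) * ∫⁻ y, w y * b y ^ 2 ∂m := fun x => lintegral_const_mul _ hB
        have e2 : ∀ x, ∫⁻ y, (w x * b x ^ 2) * (w y * a y ^ 2) ∂m =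
            (w x * b x ^ 2) * ∫⁻ y, w y * a y ^ 2 ∂m := fun x => lintegral_const_mul _ hA
        simp only [e1, e2]
        rw [lintegral_add_left (hA.mul_const _), lintegral_mul_const _ hA,
          lintegral_mul_const _ hB]
        ring

/-- The square of the `L²` norm of the pushforward of `G ⊗ G` under
`(p, q) ↦ (p + q, ω p + ω q)`, mollified by `χ` in the last variable. -/
def posForm (ω : ℝ × ℝ → ℝ) (χ : ℝ → ℝ≥0∞) (G : ℝ × ℝ → ℝ≥0∞) : ℝ≥0∞ :=
  ∫⁻ P : ℝ × ℝ, ∫⁻ τ : ℝ, (∫⁻ p, χ (τ - ω p - ω (P - p)) * (G p * G (P - p))) ^ 2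

/-- The positive bilinear restriction estimate, with damping factor `V`, for functions
supported in `S`. -/
def PosBound (ω : ℝ × ℝ → ℝ) (V : ℝ × ℝ → ℝ≥0∞) (S : Set (ℝ × ℝ)) : Prop :=
  ∃ C : ℝ≥0, ∀ χ : ℝ → ℝ≥0∞, Measurable χ → ∫⁻ s, χ s ≤ 1 →
    ∀ g : ℝ × ℝ → ℝ≥0∞, Measurable g → (∀ p ∉ S, g p = 0) →
      posForm ω χ (fun p => V p * g p) ≤ C * (∫⁻ p, g p ^ 2) ^ 2

theorem lintegral_const_sub_mul {f : ℝ × ℝ → ℝ≥0∞} (hf : Measurable f) :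
    ∫⁻ P : ℝ × ℝ, ∫⁻ p : ℝ × ℝ, f p * f (P - p) = (∫⁻ p, f p) ^ 2 := by
  rw [lintegral_lintegral_swap (by fun_prop)]
  have : ∀ p, ∫⁻ P : ℝ × ℝ, f p * f (P - p) = f p * ∫⁻ q, f q := by
    intro p
    rw [lintegral_const_mul _ (by fun_prop), lintegral_sub_right_eq_self f p]
  simp only [this]
  rw [lintegral_mul_const _ hf, sq]

theorem posForm_off_le {ω : ℝ × ℝ → ℝ} (hω : Measurable ω) {V : ℝ × ℝ → ℝ≥0∞}
    (hV : Measurable V) {O : Set ((ℝ × ℝ) × (ℝ × ℝ))} (hO : MeasurableSet O)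
    {χ : ℝ → ℝ≥0∞} (hχ : Measurable χ) (hχ1 : ∫⁻ s, χ s ≤ 1) {C : ℝ≥0∞}
    (hC : ∀ P τ, ∫⁻ p, χ (τ - ω p - ω (P - p)) *
      O.indicator (fun z => V z.1 ^ 2 * V z.2 ^ 2) (p, P - p) ≤ C)
    {g : ℝ × ℝ → ℝ≥0∞} (hg : Measurable g) :
    ∫⁻ P : ℝ × ℝ, ∫⁻ τ : ℝ, (∫⁻ p, χ (τ - ω p - ω (P - p)) *
      O.indicator (fun z => (V z.1 * g z.1) * (V z.2 * g z.2)) (p, P - p)) ^ 2 ≤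
      2 * C * (∫⁻ p, g p ^ 2) ^ 2 := by
  have hVm : ∀ P : ℝ × ℝ, Measurable fun p : ℝ × ℝ =>
      O.indicator (fun z => V z.1 * V z.2) (p, P - p) := by
    intro P
    have : Measurable (O.indicator (fun z => V z.1 * V z.2)) :=
      Measurable.indicator (by fun_prop) hO
    exact this.comp (by fun_prop)
  calc _ ≤ ∫⁻ P : ℝ × ℝ, ∫⁻ τ : ℝ, 2 * C * ∫⁻ p, χ (τ - ω p - ω (P - p)) *
          (g p * g (P - p)) ^ 2 := by
        refine lintegral_mono fun P => lintegral_mono fun τ => ?_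
        have e : ∀ p, O.indicator (fun z => (V z.1 * g z.1) * (V z.2 * g z.2)) (p, P - p)
            = O.indicator (fun z => V z.1 * V z.2) (p, P - p) * (g p * g (P - p)) := by
          intro p
          by_cases h : (p, P - p) ∈ O
          · simp only [Set.indicator_of_mem h]; ring
          · simp only [Set.indicator_of_notMem h, zero_mul]
        simp only [e]
        refine (sq_lintegral_mul_le (by fun_prop) (hVm P) (by fun_prop)).trans ?_
        rw [mul_assoc]
        gcongr
        refine le_trans (le_of_eq (lintegral_congr fun p => ?_)) (hC P τ)
        by_cases h : (p, P - p) ∈ O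
        · simp only [Set.indicator_of_mem h]; ring
        · simp [Set.indicator_of_notMem h]
    _ = 2 * C * ∫⁻ P : ℝ × ℝ, ∫⁻ τ : ℝ, ∫⁻ p, χ (τ - ω p - ω (P - p)) *
          (g p * g (P - p)) ^ 2 := by
        rw [← lintegral_const_mul _ (by fun_prop)]
        refine lintegral_congr fun P => ?_
        rw [← lintegral_const_mul _ (by fun_prop)]
    _ ≤ 2 * C * ∫⁻ P : ℝ × ℝ, ∫⁻ p : ℝ × ℝ, g p ^ 2 * g (P - p) ^ 2 := by
        gcongr with P
        rw [lintegral_lintegral_swap (by fun_prop)]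
        refine lintegral_mono fun p => ?_
        dsimp only
        rw [lintegral_mul_const _ (by fun_prop), mul_pow]
        calc _ ≤ 1 * (g p ^ 2 * g (P - p) ^ 2) := by
              gcongr
              have : ∫⁻ τ : ℝ, χ (τ - ω p - ω (P - p)) = ∫⁻ τ, χ τ := by
                simp only [sub_sub]
                exact lintegral_sub_right_eq_self χ _
              rw [this]; exact hχ1
          _ = _ := one_mul _
    _ = _ := by rw [lintegral_const_sub_mul (hg.pow_const 2)]

/-- The autocorrelation of `χ`. -/
def autocorr (χ : ℝ → ℝ≥0∞) (x : ℝ) : ℝ≥0∞ := ∫⁻ s, χ s * χ (s + x)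

theorem measurable_autocorr {χ : ℝ → ℝ≥0∞} (hχ : Measurable χ) : Measurable (autocorr χ) := by
  unfold autocorr
  fun_prop

theorem autocorr_neg (χ : ℝ → ℝ≥0∞) (x : ℝ) : autocorr χ (-x) = autocorr χ x := by
  unfold autocorr
  rw [← lintegral_add_right_eq_self _ x]
  refine lintegral_congr fun s => ?_
  rw [mul_comm]; congr 2; ring

theorem lintegral_autocorr {χ : ℝ → ℝ≥0∞} (hχ : Measurable χ) :
    ∫⁻ x, autocorr χ x = (∫⁻ s, χ s) ^ 2 := by
  unfold autocorr
  rw [lintegral_lintegral_swap (by fun_prop)]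
  have : ∀ s, ∫⁻ x, χ s * χ (s + x) = χ s * ∫⁻ x, χ x := by
    intro s
    rw [lintegral_const_mul _ (by fun_prop), lintegral_add_left_eq_self χ s]
  simp only [this]
  rw [lintegral_mul_const _ hχ, sq]

theorem lintegral_mul_shift (χ : ℝ → ℝ≥0∞) (a b : ℝ) :
    ∫⁻ τ, χ (τ - a) * χ (τ - b) = autocorr χ (a - b) := by
  unfold autocorr
  rw [← lintegral_sub_right_eq_self (fun s => χ s * χ (s + (a - b))) a]
  refine lintegral_congr fun s => ?_
  congr 2; ring

/-- The second difference of `ω` with base point `p` and steps `h`, `k`. -/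
def secondDiff (ω : ℝ × ℝ → ℝ) (p h k : ℝ × ℝ) : ℝ :=
  ω p + ω (p + h + k) - ω (p + h) - ω (p + k)

theorem lintegral_diag_eq {ω : ℝ × ℝ → ℝ} (hω : Measurable ω)
    {d : (ℝ × ℝ) × (ℝ × ℝ) → ℝ≥0∞} (hd : Measurable d)
    {χ : ℝ → ℝ≥0∞} (hχ : Measurable χ) :
    ∫⁻ P : ℝ × ℝ, ∫⁻ τ : ℝ, (∫⁻ p, χ (τ - ω p - ω (P - p)) * d (p, P - p)) ^ 2 =
      ∫⁻ p : ℝ × ℝ, ∫⁻ h : ℝ × ℝ, ∫⁻ k : ℝ × ℝ, autocorr χ (secondDiff ω p h k) *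
        (d (p, p + h + k) * d (p + h, p + k)) := by
  have hχ2 := measurable_autocorr hχ
  have hslice : ∀ P : ℝ × ℝ, ∫⁻ τ : ℝ, (∫⁻ p, χ (τ - ω p - ω (P - p)) * d (p, P - p)) ^ 2 =
      ∫⁻ p : ℝ × ℝ, ∫⁻ q : ℝ × ℝ, autocorr χ (ω p + ω (P - p) - (ω q + ω (P - q))) *
        (d (p, P - p) * d (q, P - q)) := by
    intro P
    have e1 : ∀ τ : ℝ, (∫⁻ p, χ (τ - ω p - ω (P - p)) * d (p, P - p)) ^ 2 =
        ∫⁻ p : ℝ × ℝ, ∫⁻ q : ℝ × ℝ, (χ (τ - ω p - ω (P - p)) * d (p, P - p)) *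
          (χ (τ - ω q - ω (P - q)) * d (q, P - q)) := by
      intro τ
      rw [sq, ← lintegral_mul_const _ (by fun_prop)]
      exact lintegral_congr fun p => (lintegral_const_mul _ (by fun_prop)).symm
    simp only [e1]
    rw [lintegral_lintegral_swap (by fun_prop)]
    refine lintegral_congr fun p => ?_
    rw [lintegral_lintegral_swap (by fun_prop)]
    refine lintegral_congr fun q => ?_
    rw [← lintegral_mul_shift, ← lintegral_mul_const _ (by fun_prop)]
    refine lintegral_congr fun τ => ?_
    simp only [sub_sub]
    ring
  simp only [hslice]
  rw [lintegral_lintegral_swap (by fun_prop)]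
  refine lintegral_congr fun p => ?_
  rw [lintegral_lintegral_swap (by fun_prop), ← lintegral_add_left_eq_self _ p]
  refine lintegral_congr fun h => ?_
  rw [← lintegral_add_left_eq_self _ (p + (p + h))]
  refine lintegral_congr fun k => ?_
  have e1 : p + (p + h) + k - p = p + h + k := by abel
  have e2 : p + (p + h) + k - (p + h) = p + k := by abel
  rw [e1, e2]
  congr 2
  unfold secondDiff; ring

theorem secondDiff_comm (ω : ℝ × ℝ → ℝ) (p h k : ℝ × ℝ) :
    secondDiff ω p k h = secondDiff ω p h k := by
  unfold secondDiff
  rw [show p + k + h = p + h + k by abel]; ring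

theorem secondDiff_opposite (ω : ℝ × ℝ → ℝ) (p h k : ℝ × ℝ) :
    secondDiff ω (p + k) h (-k) = -secondDiff ω p h k := by
  unfold secondDiff
  rw [show p + k + h + -k = p + h by abel, show p + k + h = p + h + k by abel,
    show p + k + -k = p by abel]; ring

/-- The product of `V` over the vertices of the parallelogram `p, p + h, p + k, p + h + k`. -/
def vertexProd (V : ℝ × ℝ → ℝ≥0∞) (p h k : ℝ × ℝ) : ℝ≥0∞ :=
  V p * V (p + h) * (V (p + k) * V (p + h + k))

theorem vertexProd_comm (V : ℝ × ℝ → ℝ≥0∞) (p h k : ℝ × ℝ) :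
    vertexProd V p k h = vertexProd V p h k := by
  unfold vertexProd
  rw [show p + k + h = p + h + k by abel]; ring

theorem vertexProd_opposite (V : ℝ × ℝ → ℝ≥0∞) (p h k : ℝ × ℝ) :
    vertexProd V (p + k) h (-k) = vertexProd V p h k := by
  unfold vertexProd
  rw [show p + k + h + -k = p + h by abel, show p + k + h = p + h + k by abel,
    show p + k + -k = p by abel]; ring

/-- The Schur kernel. -/
def schurKer (ω : ℝ × ℝ → ℝ) (V : ℝ × ℝ → ℝ≥0∞) (Q : Set ((ℝ × ℝ) × (ℝ × ℝ) × (ℝ × ℝ)))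
    (χ : ℝ → ℝ≥0∞) (p h k : ℝ × ℝ) : ℝ≥0∞ :=
  χ (secondDiff ω p h k) * Q.indicator (fun _ => vertexProd V p h k) (p, h, k)

theorem measurable_schurKer {ω : ℝ × ℝ → ℝ} (hω : Measurable ω) {V : ℝ × ℝ → ℝ≥0∞}
    (hV : Measurable V) {Q : Set ((ℝ × ℝ) × (ℝ × ℝ) × (ℝ × ℝ))} (hQ : MeasurableSet Q)
    {χ : ℝ → ℝ≥0∞} (hχ : Measurable χ) :
    Measurable fun z : (ℝ × ℝ) × (ℝ × ℝ) × (ℝ × ℝ) => schurKer ω V Q χ z.1 z.2.1 z.2.2 := by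
  unfold schurKer secondDiff
  refine Measurable.mul (by fun_prop) ?_
  have : (fun z : (ℝ × ℝ) × (ℝ × ℝ) × (ℝ × ℝ) =>
      Q.indicator (fun _ => vertexProd V z.1 z.2.1 z.2.2) (z.1, z.2.1, z.2.2)) =
      Q.indicator (fun z => vertexProd V z.1 z.2.1 z.2.2) := by
    funext z
    by_cases hz : z ∈ Q
    · rw [Set.indicator_of_mem hz, Set.indicator_of_mem (show (z.1, z.2.1, z.2.2) ∈ Q from hz)]
    · rw [Set.indicator_of_notMem hz,
        Set.indicator_of_notMem (show (z.1, z.2.1, z.2.2) ∉ Q from hz)]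
  rw [this]
  refine Measurable.indicator ?_ hQ
  unfold vertexProd
  fun_prop

theorem lintegral_schurKer_le {ω : ℝ × ℝ → ℝ} (hω : Measurable ω) {V : ℝ × ℝ → ℝ≥0∞}
    (hV : Measurable V) {Q : Set ((ℝ × ℝ) × (ℝ × ℝ) × (ℝ × ℝ))} (hQ : MeasurableSet Q)
    {χ : ℝ → ℝ≥0∞} (hχ : Measurable χ) {C : ℝ≥0∞}
    (hC : ∀ p h, ∫⁻ k, schurKer ω V Q χ p h k ≤ C)
    {g : ℝ × ℝ → ℝ≥0∞} (hg : Measurable g) :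
    ∫⁻ p : ℝ × ℝ, ∫⁻ h : ℝ × ℝ, ∫⁻ k : ℝ × ℝ,
      schurKer ω V Q χ p h k * (g p ^ 2 * g (p + h) ^ 2) ≤ C * (∫⁻ p, g p ^ 2) ^ 2 := by
  have hm := measurable_schurKer hω hV hQ hχ
  calc _ ≤ ∫⁻ p : ℝ × ℝ, ∫⁻ h : ℝ × ℝ, C * (g p ^ 2 * g (p + h) ^ 2) := by
        refine lintegral_mono fun p => lintegral_mono fun h => ?_
        dsimp only
        have hk : Measurable fun k => schurKer ω V Q χ p h k :=
          hm.comp (by fun_prop : Measurable fun k : ℝ × ℝ => (p, h, k))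
        rw [lintegral_mul_const _ hk]
        gcongr
        exact hC p h
    _ = ∫⁻ p : ℝ × ℝ, C * g p ^ 2 * ∫⁻ q : ℝ × ℝ, g q ^ 2 := by
        refine lintegral_congr fun p => ?_
        simp only [← mul_assoc]
        rw [lintegral_const_mul _ (by fun_prop), lintegral_add_left_eq_self (fun q => g q ^ 2) p]
    _ = _ := by
        rw [lintegral_mul_const _ (by fun_prop), lintegral_const_mul _ (by fun_prop)]
        ring

theorem lintegral_opposite {T : ℝ × ℝ → ℝ × ℝ → ℝ × ℝ → ℝ≥0∞}
    (hT : Measurable fun z : (ℝ × ℝ) × (ℝ × ℝ) × (ℝ × ℝ) => T z.1 z.2.1 z.2.2) :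
    ∫⁻ p, ∫⁻ h, ∫⁻ k, T (p + k) h (-k) = ∫⁻ p, ∫⁻ h, ∫⁻ k, T p h k := by
  have e1 : ∀ p : ℝ × ℝ, ∫⁻ h, ∫⁻ k, T (p + k) h (-k) = ∫⁻ k, ∫⁻ h, T (p + k) h (-k) := by
    intro p
    have : Measurable fun w : (ℝ × ℝ) × (ℝ × ℝ) => T (p + w.2) w.1 (-w.2) :=
      hT.comp (by fun_prop : Measurable fun w : (ℝ × ℝ) × (ℝ × ℝ) => (p + w.2, w.1, -w.2))
    exact lintegral_lintegral_swap this.aemeasurable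
  simp only [e1]
  have m1 : Measurable fun w : ((ℝ × ℝ) × (ℝ × ℝ)) × (ℝ × ℝ) =>
      T (w.1.1 + w.1.2) w.2 (-w.1.2) :=
    hT.comp (by fun_prop : Measurable fun w : ((ℝ × ℝ) × (ℝ × ℝ)) × (ℝ × ℝ) =>
      (w.1.1 + w.1.2, w.2, -w.1.2))
  have m1' : Measurable fun w : (ℝ × ℝ) × (ℝ × ℝ) => ∫⁻ h, T (w.1 + w.2) h (-w.2) :=
    m1.lintegral_prod_right
  rw [lintegral_lintegral_swap m1'.aemeasurable]
  have e2 : ∀ k : ℝ × ℝ, ∫⁻ p, ∫⁻ h, T (p + k) h (-k) = ∫⁻ p, ∫⁻ h, T p h (-k) :=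
    fun k => lintegral_add_right_eq_self (fun p => ∫⁻ h, T p h (-k)) k
  simp only [e2]
  have m2 : Measurable fun w : ((ℝ × ℝ) × (ℝ × ℝ)) × (ℝ × ℝ) => T w.1.2 w.2 w.1.1 :=
    hT.comp (by fun_prop : Measurable fun w : ((ℝ × ℝ) × (ℝ × ℝ)) × (ℝ × ℝ) =>
      (w.1.2, w.2, w.1.1))
  have m2' : Measurable fun w : (ℝ × ℝ) × (ℝ × ℝ) => ∫⁻ h, T w.2 h w.1 :=
    m2.lintegral_prod_right
  have e3 : ∫⁻ k : ℝ × ℝ, ∫⁻ p, ∫⁻ h, T p h (-k) = ∫⁻ k : ℝ × ℝ, ∫⁻ p, ∫⁻ h, T p h k :=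
    lintegral_neg_eq_self (fun k : ℝ × ℝ => ∫⁻ p, ∫⁻ h, T p h k)
  rw [e3, lintegral_lintegral_swap m2'.aemeasurable]
  refine lintegral_congr fun p => ?_
  have m3 : Measurable fun w : (ℝ × ℝ) × (ℝ × ℝ) => T p w.2 w.1 :=
    hT.comp (by fun_prop : Measurable fun w : (ℝ × ℝ) × (ℝ × ℝ) => (p, w.2, w.1))
  exact lintegral_lintegral_swap m3.aemeasurable

theorem lintegral_four_terms {T : ℝ × ℝ → ℝ × ℝ → ℝ × ℝ → ℝ≥0∞}
    (hT : Measurable fun z : (ℝ × ℝ) × (ℝ × ℝ) × (ℝ × ℝ) => T z.1 z.2.1 z.2.2) :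
    ∫⁻ p, ∫⁻ h, ∫⁻ k, ((T p h k + T (p + k) h (-k)) + (T p k h + T (p + h) k (-h))) =
      4 * ∫⁻ p, ∫⁻ h, ∫⁻ k, T p h k := by
  have hsum : ∀ p, ∫⁻ h, ∫⁻ k, ((T p h k + T (p + k) h (-k)) + (T p k h + T (p + h) k (-h))) =
      2 * ((∫⁻ h, ∫⁻ k, T p h k) + ∫⁻ h, ∫⁻ k, T (p + k) h (-k)) := by
    intro p
    have m1 : Measurable fun w : (ℝ × ℝ) × (ℝ × ℝ) => T p w.1 w.2 :=
      hT.comp (by fun_prop : Measurable fun w : (ℝ × ℝ) × (ℝ × ℝ) => (p, w.1, w.2))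
    have m2 : Measurable fun w : (ℝ × ℝ) × (ℝ × ℝ) => T (p + w.2) w.1 (-w.2) :=
      hT.comp (by fun_prop : Measurable fun w : (ℝ × ℝ) × (ℝ × ℝ) => (p + w.2, w.1, -w.2))
    have m12 : Measurable fun w : (ℝ × ℝ) × (ℝ × ℝ) => T p w.1 w.2 + T (p + w.2) w.1 (-w.2) :=
      m1.add m2
    have m12' : Measurable fun w : (ℝ × ℝ) × (ℝ × ℝ) => T p w.2 w.1 + T (p + w.1) w.2 (-w.1) :=
      m12.comp measurable_swap
    have e1 : ∀ h, ∫⁻ k, ((T p h k + T (p + k) h (-k)) + (T p k h + T (p + h) k (-h))) =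
        (∫⁻ k, (T p h k + T (p + k) h (-k))) + ∫⁻ k, (T p k h + T (p + h) k (-h)) := by
      intro h
      have : Measurable fun k => T p h k + T (p + k) h (-k) :=
        m12.comp (by fun_prop : Measurable fun k : ℝ × ℝ => (h, k))
      exact lintegral_add_left this _
    simp only [e1]
    rw [lintegral_add_left m12.lintegral_prod_right]
    have e2 : ∫⁻ h, ∫⁻ k, (T p k h + T (p + h) k (-h)) =
        ∫⁻ h, ∫⁻ k, (T p h k + T (p + k) h (-k)) :=
      lintegral_lintegral_swap m12'.aemeasurable
    rw [e2, ← two_mul]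
    congr 1
    have e3 : ∀ h, ∫⁻ k, (T p h k + T (p + k) h (-k)) =
        (∫⁻ k, T p h k) + ∫⁻ k, T (p + k) h (-k) := by
      intro h
      have : Measurable fun k => T p h k :=
        m1.comp (by fun_prop : Measurable fun k : ℝ × ℝ => (h, k))
      exact lintegral_add_left this _
    simp only [e3]
    rw [lintegral_add_left m1.lintegral_prod_right]
  have m : Measurable fun p => ∫⁻ h, ∫⁻ k, T p h k := by
    have h2 : Measurable fun w : ((ℝ × ℝ) × (ℝ × ℝ)) × (ℝ × ℝ) => T w.1.1 w.1.2 w.2 :=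
      hT.comp (by fun_prop : Measurable fun w : ((ℝ × ℝ) × (ℝ × ℝ)) × (ℝ × ℝ) =>
        (w.1.1, w.1.2, w.2))
    exact h2.lintegral_prod_right.lintegral_prod_right
  simp only [hsum]
  rw [lintegral_const_mul' _ _ (by simp), lintegral_add_left m, lintegral_opposite hT, ← two_mul,
    ← mul_assoc]
  norm_num

theorem posForm_diag_le {ω : ℝ × ℝ → ℝ} (hω : Measurable ω) {V : ℝ × ℝ → ℝ≥0∞}
    (hV : Measurable V) {S : Set (ℝ × ℝ)} {D : Set ((ℝ × ℝ) × (ℝ × ℝ))} (hD : MeasurableSet D)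
    {Q : Set ((ℝ × ℝ) × (ℝ × ℝ) × (ℝ × ℝ))} (hQ : MeasurableSet Q)
    (hcov : ∀ p h k, p ∈ S → p + h ∈ S → p + k ∈ S → p + h + k ∈ S →
      (p, p + h + k) ∈ D → (p + h, p + k) ∈ D →
      ((p, h, k) ∈ Q ∧ (p + k, h, -k) ∈ Q) ∨ ((p, k, h) ∈ Q ∧ (p + h, k, -h) ∈ Q))
    {χ : ℝ → ℝ≥0∞} (hχ : Measurable χ) {C : ℝ≥0∞}
    (hC : ∀ p h, ∫⁻ k, schurKer ω V Q (autocorr χ) p h k ≤ C)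
    {g : ℝ × ℝ → ℝ≥0∞} (hg : Measurable g) (hgS : ∀ p ∉ S, g p = 0) :
    ∫⁻ P : ℝ × ℝ, ∫⁻ τ : ℝ, (∫⁻ p, χ (τ - ω p - ω (P - p)) *
      D.indicator (fun z => (V z.1 * g z.1) * (V z.2 * g z.2)) (p, P - p)) ^ 2 ≤
      4 * C * (∫⁻ p, g p ^ 2) ^ 2 := by
  set κ := schurKer ω V Q (autocorr χ) with hκ
  have hχ2 := measurable_autocorr hχ
  have hm := measurable_schurKer hω hV hQ hχ2
  rw [← hκ] at hm
  set T : ℝ × ℝ → ℝ × ℝ → ℝ × ℝ → ℝ≥0∞ :=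
    fun p h k => κ p h k * (g p ^ 2 * g (p + h) ^ 2) with hT
  have hTm : Measurable fun z : (ℝ × ℝ) × (ℝ × ℝ) × (ℝ × ℝ) => T z.1 z.2.1 z.2.2 := by
    simp only [hT]
    exact hm.mul (by fun_prop)
  have hmain : ∫⁻ p, ∫⁻ h, ∫⁻ k, T p h k ≤ C * (∫⁻ p, g p ^ 2) ^ 2 :=
    lintegral_schurKer_le hω hV hQ hχ2 hC hg
  rw [lintegral_diag_eq hω (Measurable.indicator (by fun_prop) hD) hχ]
  have hpt : ∀ p h k, autocorr χ (secondDiff ω p h k) *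
      (D.indicator (fun z => (V z.1 * g z.1) * (V z.2 * g z.2)) (p, p + h + k) *
        D.indicator (fun z => (V z.1 * g z.1) * (V z.2 * g z.2)) (p + h, p + k)) ≤
      (T p h k + T (p + k) h (-k)) + (T p k h + T (p + h) k (-h)) := by
    intro p h k
    by_cases hconf : (p ∈ S ∧ p + h ∈ S ∧ p + k ∈ S ∧ p + h + k ∈ S) ∧
        (p, p + h + k) ∈ D ∧ (p + h, p + k) ∈ D
    · obtain ⟨⟨h1, h2, h3, h4⟩, h5, h6⟩ := hconf
      rw [Set.indicator_of_mem h5, Set.indicator_of_mem h6]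
      have hk : ∀ p h k, (p, h, k) ∈ Q → κ p h k =
          autocorr χ (secondDiff ω p h k) * vertexProd V p h k := by
        intro p h k hq
        simp only [hκ, schurKer]
        rw [Set.indicator_of_mem hq]
      rcases hcov p h k h1 h2 h3 h4 h5 h6 with ⟨q1, q2⟩ | ⟨q1, q2⟩
      · refine le_trans ?_ le_self_add
        simp only [hT]
        rw [hk _ _ _ q1, hk _ _ _ q2, secondDiff_opposite, autocorr_neg, vertexProd_opposite,
          ← mul_add]
        calc _ = autocorr χ (secondDiff ω p h k) * vertexProd V p h k *
              ((g p * g (p + h)) * (g (p + k) * g (p + h + k))) := by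
              unfold vertexProd; ring
          _ ≤ autocorr χ (secondDiff ω p h k) * vertexProd V p h k *
              ((g p * g (p + h)) ^ 2 + (g (p + k) * g (p + h + k)) ^ 2) := by
              gcongr; exact ENNReal.mul_le_sq_add_sq _ _
          _ = _ := by
              rw [show p + k + h = p + h + k by abel]; ring
      · refine le_trans ?_ le_add_self
        simp only [hT]
        rw [hk _ _ _ q1, hk _ _ _ q2, secondDiff_opposite, autocorr_neg, vertexProd_opposite,
          secondDiff_comm ω p h k, vertexProd_comm V p h k, ← mul_add]
        calc _ = autocorr χ (secondDiff ω p h k) * vertexProd V p h k *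
              ((g p * g (p + k)) * (g (p + h) * g (p + h + k))) := by
              unfold vertexProd; ring
          _ ≤ autocorr χ (secondDiff ω p h k) * vertexProd V p h k *
              ((g p * g (p + k)) ^ 2 + (g (p + h) * g (p + h + k)) ^ 2) := by
              gcongr; exact ENNReal.mul_le_sq_add_sq _ _
          _ = _ := by ring
    · refine le_trans (le_of_eq ?_) zero_le
      by_cases hd1 : (p, p + h + k) ∈ D
      swap
      · rw [Set.indicator_of_notMem hd1]; simp
      by_cases hd2 : (p + h, p + k) ∈ D
      swap
      · rw [Set.indicator_of_notMem hd2]; simp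
      rw [Set.indicator_of_mem hd1, Set.indicator_of_mem hd2]
      have : ¬ (p ∈ S ∧ p + h ∈ S ∧ p + k ∈ S ∧ p + h + k ∈ S) := fun hh =>
        hconf ⟨hh, hd1, hd2⟩
      by_cases s1 : p ∈ S
      swap
      · simp [hgS _ s1]
      by_cases s2 : p + h ∈ S
      swap
      · simp [hgS _ s2]
      by_cases s3 : p + k ∈ S
      swap
      · simp [hgS _ s3]
      by_cases s4 : p + h + k ∈ S
      swap
      · simp [hgS _ s4]
      exact absurd ⟨s1, s2, s3, s4⟩ this
  calc _ ≤ ∫⁻ p, ∫⁻ h, ∫⁻ k, ((T p h k + T (p + k) h (-k)) + (T p k h + T (p + h) k (-h))) :=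
        lintegral_mono fun p => lintegral_mono fun h => lintegral_mono fun k => hpt p h k
    _ = 4 * ∫⁻ p, ∫⁻ h, ∫⁻ k, T p h k := lintegral_four_terms hTm
    _ ≤ 4 * (C * (∫⁻ p, g p ^ 2) ^ 2) := by gcongr
    _ = _ := by ring

/-- All slices of `ω` parallel to the coordinate axes are polynomials of degree at most `n`. -/
structure PolySlices (n : ℕ) (ω : ℝ × ℝ → ℝ) : Prop where
  fst : ∀ y, PolyLE n (fun x => ω (x, y))
  snd : ∀ x, PolyLE n (fun y => ω (x, y))

theorem PolySlices.differentiableAt_fst {n : ℕ} {ω : ℝ × ℝ → ℝ} (h : PolySlices n ω) (y x : ℝ) :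
    DifferentiableAt ℝ (fun x => ω (x, y)) x := by
  obtain ⟨Q, -, hQ⟩ := h.fst y
  rw [show (fun x => ω (x, y)) = fun x => Q.eval x from funext hQ]
  exact Q.differentiableAt

theorem PolySlices.differentiableAt_snd {n : ℕ} {ω : ℝ × ℝ → ℝ} (h : PolySlices n ω) (x y : ℝ) :
    DifferentiableAt ℝ (fun y => ω (x, y)) y := by
  obtain ⟨Q, -, hQ⟩ := h.snd x
  rw [show (fun y => ω (x, y)) = fun y => Q.eval y from funext hQ]
  exact Q.differentiableAt

theorem hasDerivAt_slice_fst {n : ℕ} {ω : ℝ × ℝ → ℝ} (h : PolySlices n ω) (p : ℝ × ℝ) :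
    HasDerivAt (fun x => ω (x, p.2)) (pdx ω p) p.1 :=
  (h.differentiableAt_fst p.2 p.1).hasDerivAt

theorem hasDerivAt_slice_snd {n : ℕ} {ω : ℝ × ℝ → ℝ} (h : PolySlices n ω) (p : ℝ × ℝ) :
    HasDerivAt (fun y => ω (p.1, y)) (pdy ω p) p.2 :=
  (h.differentiableAt_snd p.1 p.2).hasDerivAt

theorem pdx_phase {n : ℕ} {ω : ℝ × ℝ → ℝ} (h : PolySlices n ω) (P p : ℝ × ℝ) (τ : ℝ) :
    pdx (fun p => τ - ω p - ω (P - p)) p = -(pdx ω p - pdx ω (P - p)) := by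
  have h1 := hasDerivAt_slice_fst h p
  have h2 := (hasDerivAt_slice_fst h (P - p)).comp_const_sub P.1 p.1
  have h3 := ((h1.const_sub τ).sub h2).deriv
  unfold pdx at h3 ⊢
  refine Eq.trans ?_ (h3.trans (by ring))
  rfl

theorem pdy_phase {n : ℕ} {ω : ℝ × ℝ → ℝ} (h : PolySlices n ω) (P p : ℝ × ℝ) (τ : ℝ) :
    pdy (fun p => τ - ω p - ω (P - p)) p = -(pdy ω p - pdy ω (P - p)) := by
  have h1 := hasDerivAt_slice_snd h p
  have h2 := (hasDerivAt_slice_snd h (P - p)).comp_const_sub P.2 p.2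
  have h3 := ((h1.const_sub τ).sub h2).deriv
  unfold pdy at h3 ⊢
  refine Eq.trans ?_ (h3.trans (by ring))
  rfl

theorem off_bound_fst {n : ℕ} {ω : ℝ × ℝ → ℝ} (h : PolySlices n ω) {V : ℝ × ℝ → ℝ≥0∞}
    {O : Set ((ℝ × ℝ) × (ℝ × ℝ))} {C : ℝ≥0∞}
    (hO : ∀ P : ℝ × ℝ, ∃ g : ℝ → ℝ≥0∞, Measurable g ∧ ∫⁻ y, g y ≤ C ∧
      ∀ p, (p, P - p) ∈ O →
        V p ^ 2 * V (P - p) ^ 2 ≤ ENNReal.ofReal |pdx ω p - pdx ω (P - p)| * g p.2)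
    {χ : ℝ → ℝ≥0∞} (hχ : Measurable χ) (hχ1 : ∫⁻ s, χ s ≤ 1) (P : ℝ × ℝ) (τ : ℝ) :
    ∫⁻ p, χ (τ - ω p - ω (P - p)) *
      O.indicator (fun z => V z.1 ^ 2 * V z.2 ^ 2) (p, P - p) ≤ n * C := by
  obtain ⟨g, hg, hgC, hgO⟩ := hO P
  have := lintegral_le_of_le_pdx (n := n) (F := fun p => τ - ω p - ω (P - p))
    (fun y => ((PolyLE.const τ).sub (h.fst y)).sub ((h.fst (P.2 - y)).comp_const_sub P.1))
    hχ (W := fun p => O.indicator (fun z => V z.1 ^ 2 * V z.2 ^ 2) (p, P - p)) hg ?_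
  · refine this.trans ?_
    calc _ ≤ (n : ℝ≥0∞) * C * 1 := by gcongr
      _ = _ := mul_one _
  · intro p
    by_cases hp : (p, P - p) ∈ O
    · rw [Set.indicator_of_mem hp, pdx_phase h, abs_neg]
      exact hgO p hp
    · rw [Set.indicator_of_notMem hp]; exact zero_le

theorem off_bound_snd {n : ℕ} {ω : ℝ × ℝ → ℝ} (h : PolySlices n ω) {V : ℝ × ℝ → ℝ≥0∞}
    {O : Set ((ℝ × ℝ) × (ℝ × ℝ))} {C : ℝ≥0∞}
    (hO : ∀ P : ℝ × ℝ, ∃ g : ℝ → ℝ≥0∞, Measurable g ∧ ∫⁻ y, g y ≤ C ∧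
      ∀ p, (p, P - p) ∈ O →
        V p ^ 2 * V (P - p) ^ 2 ≤ ENNReal.ofReal |pdy ω p - pdy ω (P - p)| * g p.1)
    {χ : ℝ → ℝ≥0∞} (hχ : Measurable χ) (hχ1 : ∫⁻ s, χ s ≤ 1) (P : ℝ × ℝ) (τ : ℝ) :
    ∫⁻ p, χ (τ - ω p - ω (P - p)) *
      O.indicator (fun z => V z.1 ^ 2 * V z.2 ^ 2) (p, P - p) ≤ n * C := by
  obtain ⟨g, hg, hgC, hgO⟩ := hO P
  have := lintegral_le_of_le_pdy (n := n) (F := fun p => τ - ω p - ω (P - p))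
    (fun y => ((PolyLE.const τ).sub (h.snd y)).sub ((h.snd (P.1 - y)).comp_const_sub P.2))
    hχ (W := fun p => O.indicator (fun z => V z.1 ^ 2 * V z.2 ^ 2) (p, P - p)) hg ?_
  · refine this.trans ?_
    calc _ ≤ (n : ℝ≥0∞) * C * 1 := by gcongr
      _ = _ := mul_one _
  · intro p
    by_cases hp : (p, P - p) ∈ O
    · rw [Set.indicator_of_mem hp, pdy_phase h, abs_neg]
      exact hgO p hp
    · rw [Set.indicator_of_notMem hp]; exact zero_le

theorem lintegral_add_add {α : Type*} [MeasurableSpace α] {m : Measure α} {f g k : α → ℝ≥0∞}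
    (hf : Measurable f) (hg : Measurable g) :
    ∫⁻ x, (f x + g x + k x) ∂m = (∫⁻ x, f x ∂m) + (∫⁻ x, g x ∂m) + ∫⁻ x, k x ∂m := by
  have hfg : Measurable fun x => f x + g x := hf.add hg
  rw [lintegral_add_left hfg, lintegral_add_left hf]

theorem lintegral_four_mul_add {α : Type*} [MeasurableSpace α] {m : Measure α}
    {f g k : α → ℝ≥0∞} (hf : Measurable f) (hg : Measurable g) :
    ∫⁻ x, (4 * (4 * (f x + g x) + k x)) ∂m =
      4 * (4 * ((∫⁻ x, f x ∂m) + (∫⁻ x, g x ∂m)) + ∫⁻ x, k x ∂m) := by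
  have hfg : Measurable fun x => 4 * (f x + g x) := (hf.add hg).const_mul 4
  rw [lintegral_const_mul' _ _ (by simp), lintegral_add_left hfg,
    lintegral_const_mul' _ _ (by simp), lintegral_add_left hf]

theorem posBound_of_cover {n : ℕ} {ω : ℝ × ℝ → ℝ} (h : PolySlices n ω) (hω : Measurable ω)
    {V : ℝ × ℝ → ℝ≥0∞} (hV : Measurable V) {S : Set (ℝ × ℝ)}
    {O₁ O₂ D : Set ((ℝ × ℝ) × (ℝ × ℝ))} (hO₁ : MeasurableSet O₁) (hO₂ : MeasurableSet O₂)
    (hD : MeasurableSet D) (hS : ∀ p ∈ S, ∀ q ∈ S, (p, q) ∈ O₁ ∨ (p, q) ∈ O₂ ∨ (p, q) ∈ D)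
    {C₁ C₂ C₃ : ℝ≥0}
    (h₁ : ∀ P : ℝ × ℝ, ∃ g : ℝ → ℝ≥0∞, Measurable g ∧ ∫⁻ y, g y ≤ C₁ ∧
      ∀ p, (p, P - p) ∈ O₁ →
        V p ^ 2 * V (P - p) ^ 2 ≤ ENNReal.ofReal |pdx ω p - pdx ω (P - p)| * g p.2)
    (h₂ : ∀ P : ℝ × ℝ, ∃ g : ℝ → ℝ≥0∞, Measurable g ∧ ∫⁻ y, g y ≤ C₂ ∧
      ∀ p, (p, P - p) ∈ O₂ →
        V p ^ 2 * V (P - p) ^ 2 ≤ ENNReal.ofReal |pdy ω p - pdy ω (P - p)| * g p.1)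
    {Q : Set ((ℝ × ℝ) × (ℝ × ℝ) × (ℝ × ℝ))} (hQ : MeasurableSet Q)
    (hcov : ∀ p h k, p ∈ S → p + h ∈ S → p + k ∈ S → p + h + k ∈ S →
      (p, p + h + k) ∈ D → (p + h, p + k) ∈ D →
      ((p, h, k) ∈ Q ∧ (p + k, h, -k) ∈ Q) ∨ ((p, k, h) ∈ Q ∧ (p + h, k, -h) ∈ Q))
    (h₃ : ∀ χ : ℝ → ℝ≥0∞, Measurable χ → ∫⁻ s, χ s ≤ 1 →
      ∀ p h, ∫⁻ k, schurKer ω V Q χ p h k ≤ C₃) :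
    PosBound ω V S := by
  refine ⟨4 * (4 * ((2 * (n * C₁) + 2 * (n * C₂))) + 4 * C₃), fun χ hχ hχ1 g hg hgS => ?_⟩
  set N := ∫⁻ p, g p ^ 2 with hN
  have b₁ := posForm_off_le hω hV hO₁ hχ hχ1 (off_bound_fst h h₁ hχ hχ1) hg
  have b₂ := posForm_off_le hω hV hO₂ hχ hχ1 (off_bound_snd h h₂ hχ hχ1) hg
  have hχ2 : ∫⁻ s, autocorr χ s ≤ 1 := by
    rw [lintegral_autocorr hχ]; exact pow_le_one₀ zero_le hχ1
  have b₃ := posForm_diag_le hω hV hD hQ hcov hχ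
    (h₃ _ (measurable_autocorr hχ) hχ2) hg hgS
  rw [← hN] at b₁ b₂ b₃
  set T : Set ((ℝ × ℝ) × (ℝ × ℝ)) → ℝ × ℝ → ℝ → ℝ≥0∞ := fun D P τ =>
    ∫⁻ p, χ (τ - ω p - ω (P - p)) *
      D.indicator (fun z => (V z.1 * g z.1) * (V z.2 * g z.2)) (p, P - p) with hT
  have hm : ∀ D, MeasurableSet D → Measurable (fun z : (ℝ × ℝ) × ℝ × (ℝ × ℝ) =>
      χ (z.2.1 - ω z.2.2 - ω (z.1 - z.2.2)) *
      D.indicator (fun z => (V z.1 * g z.1) * (V z.2 * g z.2)) (z.2.2, z.1 - z.2.2)) := by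
    intro D hD
    refine Measurable.mul (by fun_prop) ?_
    have : Measurable (D.indicator (fun z : (ℝ × ℝ) × (ℝ × ℝ) =>
        (V z.1 * g z.1) * (V z.2 * g z.2))) := Measurable.indicator (by fun_prop) hD
    exact this.comp (by fun_prop)
  have hTm : ∀ D, MeasurableSet D → Measurable (fun z : (ℝ × ℝ) × ℝ => T D z.1 z.2) := by
    intro D hD
    have : Measurable (fun w : ((ℝ × ℝ) × ℝ) × (ℝ × ℝ) =>
      χ (w.1.2 - ω w.2 - ω (w.1.1 - w.2)) *
      D.indicator (fun z => (V z.1 * g z.1) * (V z.2 * g z.2)) (w.2, w.1.1 - w.2)) :=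
      (hm D hD).comp (by fun_prop : Measurable fun w : ((ℝ × ℝ) × ℝ) × (ℝ × ℝ) =>
        (w.1.1, w.1.2, w.2))
    exact this.lintegral_prod_right
  have hpt : ∀ P τ, (∫⁻ p, χ (τ - ω p - ω (P - p)) *
      ((V p * g p) * (V (P - p) * g (P - p)))) ≤ T O₁ P τ + T O₂ P τ + T D P τ := by
    intro P τ
    have mk : ∀ D, MeasurableSet D → Measurable (fun p : ℝ × ℝ => χ (τ - ω p - ω (P - p)) *
      D.indicator (fun z => (V z.1 * g z.1) * (V z.2 * g z.2)) (p, P - p)) := fun D hD =>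
        (hm D hD).comp (by fun_prop : Measurable fun p : ℝ × ℝ => (P, τ, p))
    simp only [hT]
    rw [← lintegral_add_add (mk O₁ hO₁) (mk O₂ hO₂)]
    refine lintegral_mono fun p => ?_
    by_cases hp : p ∈ S
    swap
    · simp [hgS p hp]
    by_cases hq : P - p ∈ S
    swap
    · simp [hgS _ hq]
    dsimp only
    rcases hS p hp _ hq with h | h | h
    · rw [Set.indicator_of_mem h, add_assoc]; exact le_self_add
    · rw [Set.indicator_of_mem h, add_right_comm]; exact le_add_self
    · rw [Set.indicator_of_mem h]; exact le_add_self
  have hm2 : ∀ D, MeasurableSet D → Measurable fun P => ∫⁻ τ, T D P τ ^ 2 := fun D hD =>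
    ((hTm D hD).pow_const 2).lintegral_prod_right
  have hm1 : ∀ D, MeasurableSet D → ∀ P, Measurable fun τ => T D P τ := fun D hD P =>
    (hTm D hD).comp (by fun_prop : Measurable fun τ : ℝ => (P, τ))
  calc posForm ω χ (fun p => V p * g p)
      ≤ ∫⁻ P, ∫⁻ τ, (4 * (4 * (T O₁ P τ ^ 2 + T O₂ P τ ^ 2) + T D P τ ^ 2)) := by
        unfold posForm
        refine lintegral_mono fun P => lintegral_mono fun τ => ?_
        dsimp only
        calc _ ≤ (T O₁ P τ + T O₂ P τ + T D P τ) ^ 2 := by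
              gcongr; exact hpt P τ
          _ ≤ 4 * ((T O₁ P τ + T O₂ P τ) ^ 2 + T D P τ ^ 2) := ENNReal.add_sq_le _ _
          _ ≤ _ := by gcongr; exact ENNReal.add_sq_le _ _
    _ = ∫⁻ P, (4 * (4 * ((∫⁻ τ, T O₁ P τ ^ 2) + (∫⁻ τ, T O₂ P τ ^ 2)) + ∫⁻ τ, T D P τ ^ 2)) := by
        refine lintegral_congr fun P => ?_
        have m1 := (hm1 O₁ hO₁ P).pow_const 2
        have m2 := (hm1 O₂ hO₂ P).pow_const 2
        exact lintegral_four_mul_add m1 m2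
    _ = 4 * (4 * ((∫⁻ P, ∫⁻ τ, T O₁ P τ ^ 2) + (∫⁻ P, ∫⁻ τ, T O₂ P τ ^ 2)) +
          ∫⁻ P, ∫⁻ τ, T D P τ ^ 2) := by
        have m1 := hm2 O₁ hO₁
        have m2 := hm2 O₂ hO₂
        exact lintegral_four_mul_add m1 m2
    _ ≤ 4 * (4 * ((2 * (n * C₁) * N ^ 2) + (2 * (n * C₂) * N ^ 2)) + 4 * C₃ * N ^ 2) := by
        gcongr
    _ = _ := by push_cast; ring

/-- Infinitely differentiable real functions on the plane. -/
abbrev SmoothFun (f : ℝ × ℝ → ℝ) : Prop := ContDiff ℝ ((⊤ : ℕ∞) : WithTop ℕ∞) f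

theorem pdx_eq_fderiv {f : ℝ × ℝ → ℝ} {p : ℝ × ℝ} (hf : DifferentiableAt ℝ f p) :
    pdx f p = fderiv ℝ f p (1, 0) := by
  have h1 : HasDerivAt (fun x : ℝ => (x, p.2)) ((1 : ℝ), (0 : ℝ)) p.1 :=
    (hasDerivAt_id p.1).prodMk (hasDerivAt_const p.1 p.2)
  exact (HasFDerivAt.comp_hasDerivAt p.1 (f := fun x : ℝ => (x, p.2)) hf.hasFDerivAt h1).deriv

theorem pdy_eq_fderiv {f : ℝ × ℝ → ℝ} {p : ℝ × ℝ} (hf : DifferentiableAt ℝ f p) :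
    pdy f p = fderiv ℝ f p (0, 1) := by
  have h1 : HasDerivAt (fun y : ℝ => (p.1, y)) ((0 : ℝ), (1 : ℝ)) p.2 :=
    (hasDerivAt_const p.2 p.1).prodMk (hasDerivAt_id p.2)
  exact (HasFDerivAt.comp_hasDerivAt p.2 (f := fun y : ℝ => (p.1, y)) hf.hasFDerivAt h1).deriv

theorem fderiv_apply_eq {f : ℝ × ℝ → ℝ} {p : ℝ × ℝ} (hf : DifferentiableAt ℝ f p) (v : ℝ × ℝ) :
    fderiv ℝ f p v = pdx f p * v.1 + pdy f p * v.2 := by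
  rw [pdx_eq_fderiv hf, pdy_eq_fderiv hf]
  have : v = v.1 • ((1 : ℝ), (0 : ℝ)) + v.2 • ((0 : ℝ), (1 : ℝ)) := by
    ext <;> simp
  conv_lhs => rw [this]
  rw [map_add, map_smul, map_smul, smul_eq_mul, smul_eq_mul]
  ring

theorem contDiff_pdx {f : ℝ × ℝ → ℝ} (hf : SmoothFun f) : SmoothFun (pdx f) := by
  have : pdx f = fun p => fderiv ℝ f p (1, 0) := by
    funext p; exact pdx_eq_fderiv (hf.differentiable (by simp) p)
  rw [this]
  exact (hf.fderiv_right (m := ((⊤ : ℕ∞) : WithTop ℕ∞)) (by simp)).clm_apply contDiff_const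

theorem contDiff_pdy {f : ℝ × ℝ → ℝ} (hf : SmoothFun f) : SmoothFun (pdy f) := by
  have : pdy f = fun p => fderiv ℝ f p (0, 1) := by
    funext p; exact pdy_eq_fderiv (hf.differentiable (by simp) p)
  rw [this]
  exact (hf.fderiv_right (m := ((⊤ : ℕ∞) : WithTop ℕ∞)) (by simp)).clm_apply contDiff_const

theorem pdy_pdx {f : ℝ × ℝ → ℝ} (hf : SmoothFun f) (p : ℝ × ℝ) :
    pdy (pdx f) p = pdx (pdy f) p := by
  have hd : Differentiable ℝ f := hf.differentiable (by simp)
  have hd2 : Differentiable ℝ (fderiv ℝ f) :=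
    (hf.fderiv_right (m := ((⊤ : ℕ∞) : WithTop ℕ∞)) (by simp)).differentiable (by simp)
  have e1 : pdx f = fun p => fderiv ℝ f p (1, 0) := funext fun p => pdx_eq_fderiv (hd p)
  have e2 : pdy f = fun p => fderiv ℝ f p (0, 1) := funext fun p => pdy_eq_fderiv (hd p)
  rw [pdy_eq_fderiv ((contDiff_pdx hf).differentiable (by simp) p),
    pdx_eq_fderiv ((contDiff_pdy hf).differentiable (by simp) p), e1, e2,
    fderiv_clm_apply (hd2 p) (differentiableAt_const _),
    fderiv_clm_apply (hd2 p) (differentiableAt_const _)]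
  simp
  have hsym : IsSymmSndFDerivAt ℝ f p := hf.contDiffAt.isSymmSndFDerivAt
    (by simp only [minSmoothness_of_isRCLikeNormedField]; exact WithTop.coe_le_coe.2 (le_top : (2 : ℕ∞) ≤ ⊤))
  exact hsym _ _

/-- Mean value theorem in terms of the partial derivatives. -/
theorem exists_segment_sub_eq {f : ℝ × ℝ → ℝ} (hf : Differentiable ℝ f) {B : Set (ℝ × ℝ)}
    (hB : Convex ℝ B) {x h : ℝ × ℝ} (hx : x ∈ B) (hy : x + h ∈ B) :
    ∃ z ∈ B, f (x + h) - f x = pdx f z * h.1 + pdy f z * h.2 := by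
  obtain ⟨z, hz, hz'⟩ := domain_mvt (f := f) (f' := fderiv ℝ f)
    (fun z _ => (hf z).hasFDerivAt.hasFDerivWithinAt) hB hx hy
  refine ⟨z, hB.segment_subset hx hy hz, ?_⟩
  rw [hz', fderiv_apply_eq (hf z)]; simp

theorem pdx_secondDiff {n : ℕ} {ω : ℝ × ℝ → ℝ} (hs : PolySlices n ω) (p h k : ℝ × ℝ) :
    pdx (secondDiff ω p h) k = pdx ω (p + h + k) - pdx ω (p + k) := by
  have h1 := (hasDerivAt_slice_fst hs (p + h + k)).comp_const_add (p + h).1 k.1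
  have h2 := (hasDerivAt_slice_fst hs (p + k)).comp_const_add p.1 k.1
  have h3 := (((h1.const_add (ω p)).sub_const (ω (p + h))).sub h2).deriv
  unfold pdx at h3 ⊢
  exact h3

theorem pdy_secondDiff {n : ℕ} {ω : ℝ × ℝ → ℝ} (hs : PolySlices n ω) (p h k : ℝ × ℝ) :
    pdy (secondDiff ω p h) k = pdy ω (p + h + k) - pdy ω (p + k) := by
  have h1 := (hasDerivAt_slice_snd hs (p + h + k)).comp_const_add (p + h).2 k.2
  have h2 := (hasDerivAt_slice_snd hs (p + k)).comp_const_add p.2 k.2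
  have h3 := (((h1.const_add (ω p)).sub_const (ω (p + h))).sub h2).deriv
  unfold pdy at h3 ⊢
  exact h3

theorem PolySlices.secondDiff {n : ℕ} {ω : ℝ × ℝ → ℝ} (hs : PolySlices n ω) (p h : ℝ × ℝ) :
    PolySlices n (secondDiff ω p h) where
  fst y := (((PolyLE.const (ω p)).add
      ((hs.fst ((p + h).2 + y)).comp_const_add (p + h).1)).sub (PolyLE.const (ω (p + h)))).sub
        ((hs.fst (p.2 + y)).comp_const_add p.1)
  snd x := (((PolyLE.const (ω p)).add
      ((hs.snd ((p + h).1 + x)).comp_const_add (p + h).2)).sub (PolyLE.const (ω (p + h)))).sub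
        ((hs.snd (p.1 + x)).comp_const_add p.2)

theorem exists_nondegeneracy_constant {m₁ m₂ m₃ : ℝ} (hm : m₁ * m₃ - m₂ ^ 2 ≠ 0) :
    ∃ δ > 0, ∀ x y : ℝ, 4 * δ * max |x| |y| ≤ max |m₁ * x + m₂ * y| |m₂ * x + m₃ * y| := by
  set M := |m₁| + |m₂| + |m₃| with hM
  have h0 : 0 < |m₁ * m₃ - m₂ ^ 2| := abs_pos.2 hm
  have hMpos : 0 ≤ M := by positivity
  refine ⟨|m₁ * m₃ - m₂ ^ 2| / (4 * (M + 1)), by positivity, fun x y => ?_⟩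
  set u := m₁ * x + m₂ * y
  set v := m₂ * x + m₃ * y
  set L := max |u| |v| with hL
  have hu : |u| ≤ L := le_max_left _ _
  have hv : |v| ≤ L := le_max_right _ _
  have hL0 : 0 ≤ L := (abs_nonneg u).trans hu
  have hx : |m₁ * m₃ - m₂ ^ 2| * |x| ≤ (M + 1) * L := by
    rw [← abs_mul, show (m₁ * m₃ - m₂ ^ 2) * x = m₃ * u - m₂ * v by simp only [u, v]; ring]
    calc |m₃ * u - m₂ * v| ≤ |m₃| * |u| + |m₂| * |v| := by
          rw [← abs_mul, ← abs_mul]; exact abs_sub _ _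
      _ ≤ |m₃| * L + |m₂| * L := by gcongr
      _ ≤ _ := by nlinarith [abs_nonneg m₁]
  have hy : |m₁ * m₃ - m₂ ^ 2| * |y| ≤ (M + 1) * L := by
    rw [← abs_mul, show (m₁ * m₃ - m₂ ^ 2) * y = m₁ * v - m₂ * u by simp only [u, v]; ring]
    calc |m₁ * v - m₂ * u| ≤ |m₁| * |v| + |m₂| * |u| := by
          rw [← abs_mul, ← abs_mul]; exact abs_sub _ _
      _ ≤ |m₁| * L + |m₂| * L := by gcongr
      _ ≤ _ := by nlinarith [abs_nonneg m₃]
  have : |m₁ * m₃ - m₂ ^ 2| * max |x| |y| ≤ (M + 1) * L := by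
    rcases max_cases |x| |y| with ⟨h, -⟩ | ⟨h, -⟩ <;> rw [h] <;> assumption
  rw [show 4 * (|m₁ * m₃ - m₂ ^ 2| / (4 * (M + 1))) * max |x| |y| =
    (|m₁ * m₃ - m₂ ^ 2| * max |x| |y|) / (M + 1) by field_simp]
  rw [div_le_iff₀ (by positivity)]; linarith

theorem lintegral_indicator_box {N c R : ℝ} (hc : 0 ≤ c) (hR : c * (2 * N) ≤ R) :
    ∫⁻ y, (Set.Icc (-N) N).indicator (fun _ => ENNReal.ofReal c) y ≤ ENNReal.ofReal R := by
  rw [lintegral_indicator measurableSet_Icc, setLIntegral_const, Real.volume_Icc,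
    ← ENNReal.ofReal_mul hc]
  exact ENNReal.ofReal_le_ofReal (by linarith)

theorem lintegral_secondDiff_le {n : ℕ} {ω : ℝ × ℝ → ℝ} (hs : PolySlices n ω)
    (hω : SmoothFun ω) {m₁ m₂ m₃ δ : ℝ} (hδ : 0 < δ)
    (hm : ∀ x y : ℝ, 4 * δ * max |x| |y| ≤ max |m₁ * x + m₂ * y| |m₂ * x + m₃ * y|)
    {B : Set (ℝ × ℝ)} (hB : Convex ℝ B) {a b D R C₀ : ℝ} (ha : 0 < a) (hb : 0 < b) (hD : 0 < D)
    (hR : 0 ≤ R)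
    (h₁ : ∀ z ∈ B, |a ^ 2 * pdx (pdx ω) z - m₁ * D| ≤ δ * D)
    (h₂ : ∀ z ∈ B, |a * b * pdx (pdy ω) z - m₂ * D| ≤ δ * D)
    (h₃ : ∀ z ∈ B, |b ^ 2 * pdy (pdy ω) z - m₃ * D| ≤ δ * D)
    {p h : ℝ × ℝ} {K : Set (ℝ × ℝ)} (hK : ∀ k ∈ K, p + k ∈ B ∧ p + h + k ∈ B ∧
      max (|k.1| / a) (|k.2| / b) ≤ C₀ * max (|h.1| / a) (|h.2| / b))
    {W : ℝ × ℝ → ℝ≥0∞} (hW : ∀ k ∈ K, W k ≤ ENNReal.ofReal (R * (D / (a * b))))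
    (hW0 : ∀ k ∉ K, W k = 0) {χ : ℝ → ℝ≥0∞} (hχ : Measurable χ) (hχ1 : ∫⁻ s, χ s ≤ 1) :
    ∫⁻ k, χ (secondDiff ω p h k) * W k ≤ n * ENNReal.ofReal (C₀ * R / δ) := by
  set N := max (|h.1| / a) (|h.2| / b)
  have hN0 : 0 ≤ N := le_max_of_le_left (by positivity)
  have hfin : ∀ {I : ℝ≥0∞}, I ≤ ENNReal.ofReal (C₀ * R / δ) →
      (n : ℝ≥0∞) * I * ∫⁻ s, χ s ≤ n * ENNReal.ofReal (C₀ * R / δ) := by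
    intro I hI
    calc _ ≤ (n : ℝ≥0∞) * ENNReal.ofReal (C₀ * R / δ) * 1 := by gcongr
      _ = _ := mul_one _
  rcases hN0.eq_or_lt with hN00 | hNpos
  · -- here only the point `k = 0` contributes
    have hk0 : ∀ k ∈ K, k = 0 := by
      intro k hk
      have h1 := (hK k hk).2.2
      rw [← hN00, mul_zero] at h1
      have h2 := (le_max_left _ _).trans h1
      have h3 := (le_max_right _ _).trans h1
      rw [div_le_iff₀ ha, zero_mul] at h2
      rw [div_le_iff₀ hb, zero_mul] at h3
      exact Prod.ext (abs_nonpos_iff.1 h2) (abs_nonpos_iff.1 h3)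
    have : (fun k => χ (secondDiff ω p h k) * W k) =ᵐ[volume] 0 := by
      have h0 : ∀ᵐ k : ℝ × ℝ, k ≠ 0 := by
        simp [ae_iff]
      filter_upwards [h0] with k hk
      rw [hW0 k (fun hh => hk (hk0 k hh)), mul_zero]; rfl
    rw [lintegral_congr_ae this]; simp
  set x := h.1 / a with hx
  set y := h.2 / b with hy
  have hxy : max |x| |y| = N := by rw [hx, hy, abs_div, abs_div, abs_of_pos ha, abs_of_pos hb]
  have hh1 : h.1 = a * x := by rw [hx]; field_simp
  have hh2 : h.2 = b * y := by rw [hy]; field_simp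
  have hxN : |x| ≤ N := hxy ▸ le_max_left _ _
  have hyN : |y| ≤ N := hxy ▸ le_max_right _ _
  have hlin : ∀ {u v m m' : ℝ}, |u - m * D| ≤ δ * D → |v - m' * D| ≤ δ * D →
      4 * δ * N ≤ |m * x + m' * y| → 2 * δ * D * N ≤ |u * x + v * y| := by
    intro u v m m' hu hv hmm
    have e : (m * x + m' * y) * D = (u * x + v * y) - ((u - m * D) * x + (v - m' * D) * y) := by
      ring
    have h1 : |m * x + m' * y| * D ≤ |u * x + v * y| + (δ * D * N + δ * D * N) := by
      rw [← abs_of_pos hD, ← abs_mul, abs_of_pos hD, e]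
      refine (abs_sub _ _).trans ?_
      gcongr
      refine (abs_add_le _ _).trans ?_
      rw [abs_mul, abs_mul]
      gcongr
    nlinarith [mul_le_mul_of_nonneg_right hmm hD.le]
  have hmain := hm x y
  rw [hxy] at hmain
  have hsd := hs.secondDiff p h
  rcases le_max_iff.1 hmain with hc | hc
  · refine (lintegral_le_of_le_pdx (n := n) hsd.fst hχ (g :=
      (Set.Icc (-(C₀ * b * N)) (C₀ * b * N)).indicator
        (fun _ => ENNReal.ofReal (R / (2 * δ * N * b)))) (by
          exact measurable_const.indicator measurableSet_Icc) ?_).trans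
      (hfin (lintegral_indicator_box (by positivity) (le_of_eq ?_)))
    swap
    · field_simp
    intro k
    by_cases hk : k ∈ K
    swap
    · rw [hW0 k hk]; exact zero_le
    obtain ⟨hk1, hk2, hk3⟩ := hK k hk
    have hkb : |k.2| ≤ C₀ * b * N := by
      have := (le_max_right _ _).trans hk3
      rw [div_le_iff₀ hb] at this; linarith
    rw [Set.indicator_of_mem (by rw [Set.mem_Icc]; exact abs_le.1 hkb),
      pdx_secondDiff hs, ← ENNReal.ofReal_mul (abs_nonneg _)]
    refine (hW k hk).trans (ENNReal.ofReal_le_ofReal ?_)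
    obtain ⟨z, hz, hz'⟩ := exists_segment_sub_eq ((contDiff_pdx hω).differentiable (by simp)) hB
      hk1 (show p + k + h ∈ B by rwa [show p + k + h = p + h + k by abel])
    rw [show p + h + k = p + k + h by abel, hz', pdy_pdx hω, hh1, hh2]
    have := hlin (h₁ z hz) (h₂ z hz) hc
    have h5 : 2 * δ * D * N ≤ a * |pdx (pdx ω) z * (a * x) + pdx (pdy ω) z * (b * y)| := by
      refine this.trans (le_of_eq ?_)
      rw [← abs_of_pos ha, ← abs_mul, abs_of_pos ha]
      congr 1; ring
    calc R * (D / (a * b)) = (2 * δ * D * N) * (R / (2 * δ * N * b)) / a := by field_simp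
      _ ≤ (a * |pdx (pdx ω) z * (a * x) + pdx (pdy ω) z * (b * y)|) *
          (R / (2 * δ * N * b)) / a := by gcongr
      _ = _ := by field_simp
  · refine (lintegral_le_of_le_pdy (n := n) hsd.snd hχ (g :=
      (Set.Icc (-(C₀ * a * N)) (C₀ * a * N)).indicator
        (fun _ => ENNReal.ofReal (R / (2 * δ * N * a)))) (by
          exact measurable_const.indicator measurableSet_Icc) ?_).trans
      (hfin (lintegral_indicator_box (by positivity) (le_of_eq ?_)))
    swap
    · field_simp
    intro k
    by_cases hk : k ∈ K
    swap
    · rw [hW0 k hk]; exact zero_le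
    obtain ⟨hk1, hk2, hk3⟩ := hK k hk
    have hkb : |k.1| ≤ C₀ * a * N := by
      have := (le_max_left _ _).trans hk3
      rw [div_le_iff₀ ha] at this; linarith
    rw [Set.indicator_of_mem (by rw [Set.mem_Icc]; exact abs_le.1 hkb),
      pdy_secondDiff hs, ← ENNReal.ofReal_mul (abs_nonneg _)]
    refine (hW k hk).trans (ENNReal.ofReal_le_ofReal ?_)
    obtain ⟨z, hz, hz'⟩ := exists_segment_sub_eq ((contDiff_pdy hω).differentiable (by simp)) hB
      hk1 (show p + k + h ∈ B by rwa [show p + k + h = p + h + k by abel])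
    rw [show p + h + k = p + k + h by abel, hz', hh1, hh2]
    have := hlin (h₂ z hz) (h₃ z hz) hc
    have h5 : 2 * δ * D * N ≤ b * |pdx (pdy ω) z * (a * x) + pdy (pdy ω) z * (b * y)| := by
      refine this.trans (le_of_eq ?_)
      rw [← abs_of_pos hb, ← abs_mul, abs_of_pos hb]
      congr 1; ring
    calc R * (D / (a * b)) = (2 * δ * D * N) * (R / (2 * δ * N * a)) / b := by field_simp
      _ ≤ (b * |pdx (pdy ω) z * (a * x) + pdy (pdy ω) z * (b * y)|) *
          (R / (2 * δ * N * a)) / b := by gcongr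
      _ = _ := by field_simp

/-- The damping factor `|K_ω|^{1/8}`. -/
def damping (ω : ℝ × ℝ → ℝ) (p : ℝ × ℝ) : ℝ≥0∞ := ENNReal.ofReal (|hessDet ω p| ^ ((1 : ℝ) / 8))

theorem continuous_hessDet {ω : ℝ × ℝ → ℝ} (hω : SmoothFun ω) : Continuous (hessDet ω) := by
  have h1 := (contDiff_pdx (contDiff_pdx hω)).continuous
  have h2 := (contDiff_pdy (contDiff_pdy hω)).continuous
  have h3 := (contDiff_pdx (contDiff_pdy hω)).continuous
  unfold hessDet
  fun_prop

theorem continuous_rpow_hessDet {ω : ℝ × ℝ → ℝ} (hω : SmoothFun ω) :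
    Continuous fun p => |hessDet ω p| ^ ((1 : ℝ) / 8) :=
  (continuous_hessDet hω).abs.rpow_const fun _ => Or.inr (by norm_num)

theorem measurable_damping {ω : ℝ × ℝ → ℝ} (hω : SmoothFun ω) : Measurable (damping ω) :=
  (continuous_rpow_hessDet hω).measurable.ennreal_ofReal

/-- Pairs of points whose coordinates have ratios close to one. -/
def nearSet (η : ℝ) : Set ((ℝ × ℝ) × (ℝ × ℝ)) :=
  {z | |z.1.1 - z.2.1| ≤ η * (z.1.1 + z.2.1) ∧ |z.1.2 - z.2.2| ≤ η * (z.1.2 + z.2.2)}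

theorem measurableSet_nearSet (η : ℝ) : MeasurableSet (nearSet η) := by
  have h1 : MeasurableSet {z : (ℝ × ℝ) × (ℝ × ℝ) | |z.1.1 - z.2.1| ≤ η * (z.1.1 + z.2.1)} :=
    measurableSet_le (by fun_prop) (by fun_prop)
  have h2 : MeasurableSet {z : (ℝ × ℝ) × (ℝ × ℝ) | |z.1.2 - z.2.2| ≤ η * (z.1.2 + z.2.2)} :=
    measurableSet_le (by fun_prop) (by fun_prop)
  exact h1.inter h2

/-- The points of `S` in a box around `p` of relative size `θ`. -/
def boxAt (S : Set (ℝ × ℝ)) (θ : ℝ) (p : ℝ × ℝ) : Set (ℝ × ℝ) :=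
  {q | q ∈ S ∧ |q.1 - p.1| ≤ θ * p.1 ∧ |q.2 - p.2| ≤ θ * p.2}

theorem convex_boxAt {S : Set (ℝ × ℝ)} (hS : Convex ℝ S) (θ : ℝ) (p : ℝ × ℝ) :
    Convex ℝ (boxAt S θ p) := by
  have h : boxAt S θ p = S ∩ (Set.Icc (p.1 - θ * p.1) (p.1 + θ * p.1) ×ˢ
      Set.Icc (p.2 - θ * p.2) (p.2 + θ * p.2)) := by
    ext q
    simp only [boxAt, Set.mem_ofPred_eq, Set.mem_inter_iff, Set.mem_prod, Set.mem_Icc, abs_le]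
    constructor
    · rintro ⟨h1, ⟨h2, h3⟩, h4, h5⟩
      refine ⟨h1, ⟨?_, ?_⟩, ?_, ?_⟩ <;> linarith
    · rintro ⟨h1, ⟨h2, h3⟩, h4, h5⟩
      refine ⟨h1, ⟨?_, ?_⟩, ?_, ?_⟩ <;> linarith
  rw [h]
  exact hS.inter ((convex_Icc _ _).prod (convex_Icc _ _))

/-- The parallelograms in `S` of relative size `θ` whose second side is controlled by
the first. -/
def quadSet (S : Set (ℝ × ℝ)) (θ : ℝ) (a b : ℝ × ℝ → ℝ) :
    Set ((ℝ × ℝ) × (ℝ × ℝ) × (ℝ × ℝ)) :=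
  {z | z.1 ∈ S ∧ z.1 + z.2.1 ∈ boxAt S θ z.1 ∧ z.1 + z.2.2 ∈ boxAt S θ z.1 ∧
    z.1 + z.2.1 + z.2.2 ∈ boxAt S θ z.1 ∧
    max (|z.2.2.1| / a z.1) (|z.2.2.2| / b z.1) ≤
      4 * max (|z.2.1.1| / a z.1) (|z.2.1.2| / b z.1)}

theorem measurableSet_quadSet {S : Set (ℝ × ℝ)} (hS : MeasurableSet S) (θ : ℝ) {a b : ℝ × ℝ → ℝ}
    (ha : Measurable a) (hb : Measurable b) : MeasurableSet (quadSet S θ a b) := by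
  have h1 : MeasurableSet {w : (ℝ × ℝ) × (ℝ × ℝ) | |w.2.1 - w.1.1| ≤ θ * w.1.1} :=
    measurableSet_le (by fun_prop) (by fun_prop)
  have h2 : MeasurableSet {w : (ℝ × ℝ) × (ℝ × ℝ) | |w.2.2 - w.1.2| ≤ θ * w.1.2} :=
    measurableSet_le (by fun_prop) (by fun_prop)
  have hbox : MeasurableSet {w : (ℝ × ℝ) × (ℝ × ℝ) | w.2 ∈ boxAt S θ w.1} :=
    (measurable_snd hS).inter (h1.inter h2)
  have h3 : MeasurableSet {z : (ℝ × ℝ) × (ℝ × ℝ) × (ℝ × ℝ) |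
      max (|z.2.2.1| / a z.1) (|z.2.2.2| / b z.1) ≤
        4 * max (|z.2.1.1| / a z.1) (|z.2.1.2| / b z.1)} :=
    measurableSet_le (by fun_prop) (by fun_prop)
  have hc : ∀ f : (ℝ × ℝ) × (ℝ × ℝ) × (ℝ × ℝ) → ℝ × ℝ, Measurable f →
      MeasurableSet {z : (ℝ × ℝ) × (ℝ × ℝ) × (ℝ × ℝ) | f z ∈ boxAt S θ z.1} := fun f hf =>
    (measurable_fst.prodMk hf) hbox
  exact (measurable_fst hS).inter ((hc _ (by fun_prop)).inter ((hc _ (by fun_prop)).inter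
    ((hc _ (by fun_prop)).inter h3)))

theorem abs_sub_le_of_near {η θ s x y : ℝ} (hη : 0 ≤ η) (hη' : η ≤ 1 / 2) (hθ : 4 * η ≤ θ)
    (hs : 0 < s) (hx : |2 * x - s| ≤ η * s) (hy : |2 * y - s| ≤ η * s) : |y - x| ≤ θ * x := by
  rw [abs_le] at hx hy
  have h1 : η * s ≤ 4 * η * x := by nlinarith
  have h2 : 4 * η * x ≤ θ * x := by
    have : 0 ≤ x := by nlinarith
    gcongr
  rw [abs_le]
  constructor <;> linarith

theorem posBound_of_normal_form {n : ℕ} {ω : ℝ × ℝ → ℝ} (hs : PolySlices n ω)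
    (hω : SmoothFun ω) {S : Set (ℝ × ℝ)} (hSm : MeasurableSet S) (hSc : Convex ℝ S)
    (hSpos : ∀ p ∈ S, 0 < p.1 ∧ 0 < p.2)
    {a b D : ℝ × ℝ → ℝ} (ham : Measurable a) (hbm : Measurable b)
    (ha : ∀ p ∈ S, 0 < a p) (hb : ∀ p ∈ S, 0 < b p) (hD : ∀ p ∈ S, 0 < D p)
    {m₁ m₂ m₃ δ : ℝ} (hδ : 0 < δ)
    (hm : ∀ x y : ℝ, 4 * δ * max |x| |y| ≤ max |m₁ * x + m₂ * y| |m₂ * x + m₃ * y|)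
    {η θ : ℝ} (hη : 0 ≤ η) (hη' : η ≤ 1 / 2) (hθ : 4 * η ≤ θ)
    (hcmp : ∀ p ∈ S, ∀ q ∈ boxAt S θ p, a q ≤ 2 * a p ∧ b q ≤ 2 * b p)
    (hess : ∀ p ∈ S, ∀ q ∈ boxAt S θ p, |a p ^ 2 * pdx (pdx ω) q - m₁ * D p| ≤ δ * D p ∧
      |a p * b p * pdx (pdy ω) q - m₂ * D p| ≤ δ * D p ∧
      |b p ^ 2 * pdy (pdy ω) q - m₃ * D p| ≤ δ * D p)
    {O₁ O₂ : Set ((ℝ × ℝ) × (ℝ × ℝ))} (hO₁ : MeasurableSet O₁) (hO₂ : MeasurableSet O₂)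
    (hO : ∀ p ∈ S, ∀ q ∈ S, (p, q) ∈ O₁ ∨ (p, q) ∈ O₂ ∨ (p, q) ∈ nearSet η)
    {C₁ C₂ : ℝ≥0}
    (h₁ : ∀ P : ℝ × ℝ, ∃ g : ℝ → ℝ≥0∞, Measurable g ∧ ∫⁻ y, g y ≤ C₁ ∧
      ∀ p, (p, P - p) ∈ O₁ → damping ω p ^ 2 * damping ω (P - p) ^ 2 ≤
        ENNReal.ofReal |pdx ω p - pdx ω (P - p)| * g p.2)
    (h₂ : ∀ P : ℝ × ℝ, ∃ g : ℝ → ℝ≥0∞, Measurable g ∧ ∫⁻ y, g y ≤ C₂ ∧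
      ∀ p, (p, P - p) ∈ O₂ → damping ω p ^ 2 * damping ω (P - p) ^ 2 ≤
        ENNReal.ofReal |pdy ω p - pdy ω (P - p)| * g p.1) :
    PosBound ω (damping ω) S := by
  set E : ℝ := (|m₁| + δ) * (|m₃| + δ) + (|m₂| + δ) ^ 2 with hE
  have hE0 : 0 ≤ E := by positivity
  have hK : ∀ p ∈ S, ∀ q ∈ boxAt S θ p, |hessDet ω q| ≤ E * (D p / (a p * b p)) ^ 2 := by
    intro p hp q hq
    obtain ⟨e1, e2, e3⟩ := hess p hp q hq
    have hDp := hD p hp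
    have hap := ha p hp
    have hbp := hb p hp
    have bd : ∀ {u m : ℝ}, |u - m * D p| ≤ δ * D p → |u| ≤ (|m| + δ) * D p := by
      intro u m hu
      calc |u| = |(u - m * D p) + m * D p| := by congr 1; ring
        _ ≤ |u - m * D p| + |m * D p| := abs_add_le _ _
        _ ≤ δ * D p + |m| * D p := by rw [abs_mul, abs_of_pos hDp]; gcongr
        _ = _ := by ring
    have e4 : |(a p * b p) ^ 2 * hessDet ω q| ≤ E * D p ^ 2 := by
      have : (a p * b p) ^ 2 * hessDet ω q = (a p ^ 2 * pdx (pdx ω) q) * (b p ^ 2 * pdy (pdy ω) q)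
          - (a p * b p * pdx (pdy ω) q) ^ 2 := by unfold hessDet; ring
      rw [this]
      refine (abs_sub _ _).trans ?_
      rw [abs_mul, abs_pow]
      calc _ ≤ ((|m₁| + δ) * D p) * ((|m₃| + δ) * D p) + ((|m₂| + δ) * D p) ^ 2 := by
            gcongr
            · exact bd e1
            · exact bd e3
            · exact bd e2
        _ = _ := by rw [hE]; ring
    rw [abs_mul, abs_of_pos (by positivity : (0 : ℝ) < (a p * b p) ^ 2)] at e4
    rw [div_pow, ← mul_div_assoc, le_div_iff₀ (by positivity)]
    linarith
  have hself : ∀ p ∈ S, p ∈ boxAt S θ p := by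
    intro p hp
    obtain ⟨h1, h2⟩ := hSpos p hp
    have : 0 ≤ θ := by linarith
    exact ⟨hp, by rw [sub_self, abs_zero]; positivity, by rw [sub_self, abs_zero]; positivity⟩
  refine posBound_of_cover (C₃ := n * Real.toNNReal (4 * Real.sqrt E / δ)) hs
    hω.continuous.measurable (measurable_damping hω) hO₁ hO₂ (measurableSet_nearSet η) hO h₁ h₂
    (measurableSet_quadSet hSm θ ham hbm) ?_ ?_
  · intro p h k hp hph hpk hphk hn₁ hn₂
    have key : ∀ u ∈ ({p, p + h, p + k, p + h + k} : Set (ℝ × ℝ)),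
        ∀ v ∈ ({p, p + h, p + k, p + h + k} : Set (ℝ × ℝ)), v ∈ boxAt S θ u := by
      have hc : ∀ u ∈ ({p, p + h, p + k, p + h + k} : Set (ℝ × ℝ)), u ∈ S ∧
          |2 * u.1 - (2 * p.1 + h.1 + k.1)| ≤ η * (2 * p.1 + h.1 + k.1) ∧
          |2 * u.2 - (2 * p.2 + h.2 + k.2)| ≤ η * (2 * p.2 + h.2 + k.2) := by
        obtain ⟨a1, a2⟩ := hn₁
        obtain ⟨a3, a4⟩ := hn₂
        simp only [Prod.fst_add, Prod.snd_add, abs_le] at a1 a2 a3 a4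
        intro u hu
        simp only [Set.mem_insert_iff, Set.mem_singleton_iff] at hu
        rcases hu with rfl | rfl | rfl | rfl
        all_goals
          refine ⟨by assumption, ?_, ?_⟩
          all_goals
            simp only [Prod.fst_add, Prod.snd_add, abs_le]
            constructor <;> linarith
      have s1 := hSpos _ hp
      have s2 := hSpos _ hphk
      simp only [Prod.fst_add, Prod.snd_add] at s2
      intro u hu v hv
      obtain ⟨u1, u2, u3⟩ := hc u hu
      obtain ⟨v1, v2, v3⟩ := hc v hv
      exact ⟨v1, abs_sub_le_of_near hη hη' hθ (by linarith) u2 v2,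
        abs_sub_le_of_near hη hη' hθ (by linarith) u3 v3⟩
    have mp : p ∈ ({p, p + h, p + k, p + h + k} : Set (ℝ × ℝ)) := by simp
    have mph : p + h ∈ ({p, p + h, p + k, p + h + k} : Set (ℝ × ℝ)) := by simp
    have mpk : p + k ∈ ({p, p + h, p + k, p + h + k} : Set (ℝ × ℝ)) := by simp
    have mphk : p + h + k ∈ ({p, p + h, p + k, p + h + k} : Set (ℝ × ℝ)) := by simp
    -- the anisotropic sizes of a vector at two vertices are comparable
    have hN : ∀ u ∈ ({p, p + h, p + k, p + h + k} : Set (ℝ × ℝ)), u ∈ S →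
        ∀ v ∈ ({p, p + h, p + k, p + h + k} : Set (ℝ × ℝ)), v ∈ S → ∀ w : ℝ × ℝ,
        max (|w.1| / a u) (|w.2| / b u) ≤ 2 * max (|w.1| / a v) (|w.2| / b v) := by
      intro u hu huS v hv hvS w
      obtain ⟨c1, c2⟩ := hcmp u huS v (key u hu v hv)
      have := ha u huS
      have := hb u huS
      have := ha v hvS
      have := hb v hvS
      refine max_le ?_ ?_
      · calc |w.1| / a u ≤ 2 * (|w.1| / a v) := by
              rw [← mul_div_assoc, div_le_div_iff₀ (by assumption) (by assumption)]
              nlinarith [abs_nonneg w.1]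
          _ ≤ _ := by gcongr; exact le_max_left _ _
      · calc |w.2| / b u ≤ 2 * (|w.2| / b v) := by
              rw [← mul_div_assoc, div_le_div_iff₀ (by assumption) (by assumption)]
              nlinarith [abs_nonneg w.2]
          _ ≤ _ := by gcongr; exact le_max_right _ _
    have hnn : ∀ w : ℝ × ℝ, 0 ≤ max (|w.1| / a p) (|w.2| / b p) := fun w =>
      le_max_of_le_left (div_nonneg (abs_nonneg _) (ha p hp).le)
    have e1 : p + k + h = p + h + k := by abel
    have e2 : p + k + -k = p := by abel
    have e3 : p + h + k + -k = p + h := by abel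
    have e4 : p + h + -h = p := by abel
    have e5 : p + h + k + -h = p + k := by abel
    rcases le_total (max (|k.1| / a p) (|k.2| / b p)) (max (|h.1| / a p) (|h.2| / b p)) with hc | hc
    · left
      refine ⟨⟨hp, key _ mp _ mph, key _ mp _ mpk, key _ mp _ mphk, ?_⟩, hpk, ?_, ?_, ?_, ?_⟩
      · dsimp only; linarith [hnn h]
      · dsimp only; rw [e1]; exact key _ mpk _ mphk
      · dsimp only; rw [e2]; exact key _ mpk _ mp
      · dsimp only; rw [e1, e3]; exact key _ mpk _ mph
      · dsimp only; rw [Prod.fst_neg, Prod.snd_neg, abs_neg, abs_neg]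
        linarith [hN _ mpk hpk _ mp hp k, hN _ mp hp _ mpk hpk h]
    · right
      refine ⟨⟨hp, key _ mp _ mpk, key _ mp _ mph, ?_, ?_⟩, hph, ?_, ?_, ?_, ?_⟩
      · dsimp only; rw [e1]; exact key _ mp _ mphk
      · dsimp only; linarith [hnn k]
      · dsimp only; exact key _ mph _ mphk
      · dsimp only; rw [e4]; exact key _ mph _ mp
      · dsimp only; rw [e5]; exact key _ mph _ mpk
      · dsimp only; rw [Prod.fst_neg, Prod.snd_neg, abs_neg, abs_neg]
        linarith [hN _ mph hph _ mp hp h, hN _ mp hp _ mph hph k]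
  · intro χ hχ hχ1 p h
    unfold schurKer
    by_cases hp : p ∈ S
    swap
    · have : ∀ k, (p, h, k) ∉ quadSet S θ a b := fun k hk => hp hk.1
      simp [Set.indicator_of_notMem (this _)]
    have hap := ha p hp
    have hbp := hb p hp
    have hDp := hD p hp
    have := lintegral_secondDiff_le hs hω hδ hm (convex_boxAt hSc θ p) hap hbp hDp
      (Real.sqrt_nonneg E) (C₀ := 4)
      (fun z hz => (hess p hp z hz).1) (fun z hz => (hess p hp z hz).2.1)
      (fun z hz => (hess p hp z hz).2.2) (p := p) (h := h)
      (K := {k | (p, h, k) ∈ quadSet S θ a b})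
      (fun k hk => ⟨hk.2.2.1, hk.2.2.2.1, hk.2.2.2.2⟩)
      (W := fun k => (quadSet S θ a b).indicator
        (fun _ => vertexProd (damping ω) p h k) (p, h, k)) ?_ ?_ hχ hχ1
    · refine this.trans (le_of_eq ?_)
      push_cast
      rfl
    · intro k hk
      have hk' : (p, h, k) ∈ quadSet S θ a b := hk
      rw [Set.indicator_of_mem hk']
      set R := D p / (a p * b p) with hR
      have hR0 : 0 ≤ R := by positivity
      have hV : ∀ q ∈ boxAt S θ p, damping ω q ≤ ENNReal.ofReal ((E * R ^ 2) ^ ((1 : ℝ) / 8)) := by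
        intro q hq
        unfold damping
        gcongr
        exact hK p hp q hq
      unfold vertexProd
      calc _ ≤ ENNReal.ofReal ((E * R ^ 2) ^ ((1 : ℝ) / 8)) *
            ENNReal.ofReal ((E * R ^ 2) ^ ((1 : ℝ) / 8)) *
            (ENNReal.ofReal ((E * R ^ 2) ^ ((1 : ℝ) / 8)) *
            ENNReal.ofReal ((E * R ^ 2) ^ ((1 : ℝ) / 8))) := by
            gcongr
            · exact hV _ (hself p hp)
            · exact hV _ hk.2.1
            · exact hV _ hk.2.2.1
            · exact hV _ hk.2.2.2.1
        _ = ENNReal.ofReal (((E * R ^ 2) ^ ((1 : ℝ) / 8)) ^ 4) := by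
            rw [ENNReal.ofReal_pow (by positivity)]; ring
        _ = _ := by
            congr 1
            rw [← Real.rpow_natCast, ← Real.rpow_mul (by positivity),
              show (1 : ℝ) / 8 * (4 : ℕ) = 1 / 2 by norm_num, ← Real.sqrt_eq_rpow,
              Real.sqrt_mul hE0, Real.sqrt_sq hR0]
    · intro k hk
      exact Set.indicator_of_notMem hk _

/-- The binary form of degree `d` with coefficients `b`. -/
def form (d : ℕ) (b : ℕ → ℝ) (p : ℝ × ℝ) : ℝ :=
  ∑ i ∈ Finset.range (d + 1), b i * p.1 ^ i * p.2 ^ (d - i)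

theorem smoothFun_form (d : ℕ) (b : ℕ → ℝ) : SmoothFun (form d b) := by
  unfold form SmoothFun
  fun_prop

theorem PolyLE.sum {ι : Type*} {n : ℕ} (s : Finset ι) (f : ι → ℝ → ℝ)
    (h : ∀ i ∈ s, PolyLE n (f i)) : PolyLE n fun x => ∑ i ∈ s, f i x := by
  classical
  induction s using Finset.induction_on with
  | empty => simpa using PolyLE.const 0
  | insert i s hi ih =>
    simp only [Finset.sum_insert hi]
    exact (h i (by simp)).add (ih fun k hk => h k (by simp [hk]))

theorem PolyLE.mul_pow {n i : ℕ} (hi : i ≤ n) (c : ℝ) : PolyLE n fun x => c * x ^ i :=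
  ⟨Polynomial.C c * Polynomial.X ^ i, (Polynomial.natDegree_C_mul_X_pow_le _ _).trans hi,
    fun x => by simp⟩

theorem polySlices_form (d : ℕ) (b : ℕ → ℝ) : PolySlices d (form d b) where
  fst y := by
    refine PolyLE.sum _ (fun i x => b i * x ^ i * y ^ (d - i)) fun i hi => ?_
    have := PolyLE.mul_pow (n := d) (i := i) (by simpa [Nat.lt_succ_iff] using hi)
      (b i * y ^ (d - i))
    simpa only [mul_right_comm] using this
  snd x := by
    refine PolyLE.sum _ (fun i y => b i * x ^ i * y ^ (d - i)) fun i _ => ?_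
    exact PolyLE.mul_pow (Nat.sub_le _ _) _

theorem fst_mul_pdx_form (d : ℕ) (b : ℕ → ℝ) (p : ℝ × ℝ) :
    p.1 * pdx (form d b) p = form d (fun i => i * b i) p := by
  have h : HasDerivAt (fun x => form d b (x, p.2))
      (∑ i ∈ Finset.range (d + 1), b i * (i * p.1 ^ (i - 1)) * p.2 ^ (d - i)) p.1 := by
    unfold form
    refine HasDerivAt.fun_sum fun i _ => ?_
    exact ((hasDerivAt_pow i p.1).const_mul (b i)).mul_const (p.2 ^ (d - i))
  unfold pdx
  rw [h.deriv, form, Finset.mul_sum]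
  refine Finset.sum_congr rfl fun i _ => ?_
  rcases i with _ | i
  · simp
  · simp only [Nat.add_sub_cancel]; ring

theorem snd_mul_pdy_form (d : ℕ) (b : ℕ → ℝ) (p : ℝ × ℝ) :
    p.2 * pdy (form d b) p = form d (fun i => ((d - i : ℕ) : ℝ) * b i) p := by
  have h : HasDerivAt (fun y => form d b (p.1, y))
      (∑ i ∈ Finset.range (d + 1), b i * p.1 ^ i * (((d - i : ℕ) : ℝ) * p.2 ^ (d - i - 1)))
      p.2 := by
    unfold form
    refine HasDerivAt.fun_sum fun i _ => ?_
    exact (hasDerivAt_pow (d - i) p.2).const_mul (b i * p.1 ^ i)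
  unfold pdy
  rw [h.deriv, form, Finset.mul_sum]
  refine Finset.sum_congr rfl fun i _ => ?_
  rcases d - i with _ | k
  · simp
  · simp only [Nat.add_sub_cancel]; ring

theorem pdx_fst_mul {f : ℝ × ℝ → ℝ} (hf : SmoothFun f) (p : ℝ × ℝ) :
    pdx (fun q => q.1 * f q) p = f p + p.1 * pdx f p := by
  have h : HasDerivAt (fun x => f (x, p.2)) (pdx f p) p.1 := by
    have : DifferentiableAt ℝ (fun x => f (x, p.2)) p.1 := by
      have := hf.differentiable (by simp)
      fun_prop
    exact this.hasDerivAt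
  have := ((hasDerivAt_id p.1).mul h).deriv
  unfold pdx at this ⊢
  refine Eq.trans ?_ (this.trans ?_)
  · rfl
  · simp

theorem pdy_snd_mul {f : ℝ × ℝ → ℝ} (hf : SmoothFun f) (p : ℝ × ℝ) :
    pdy (fun q => q.2 * f q) p = f p + p.2 * pdy f p := by
  have h : HasDerivAt (fun y => f (p.1, y)) (pdy f p) p.2 := by
    have : DifferentiableAt ℝ (fun y => f (p.1, y)) p.2 := by
      have := hf.differentiable (by simp)
      fun_prop
    exact this.hasDerivAt
  have := ((hasDerivAt_id p.2).mul h).deriv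
  unfold pdy at this ⊢
  refine Eq.trans ?_ (this.trans ?_)
  · rfl
  · simp

theorem pdx_snd_mul (f : ℝ × ℝ → ℝ) (p : ℝ × ℝ) :
    pdx (fun q => q.2 * f q) p = p.2 * pdx f p := by
  unfold pdx
  exact deriv_const_mul_field _

theorem fst_sq_mul_pdx_pdx_form (d : ℕ) (b : ℕ → ℝ) (p : ℝ × ℝ) :
    p.1 ^ 2 * pdx (pdx (form d b)) p = form d (fun i => i * (i - 1) * b i) p := by
  have h1 := fst_mul_pdx_form d (fun i => i * b i) p
  rw [show form d (fun i => i * b i) = fun q => q.1 * pdx (form d b) q from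
    funext fun q => (fst_mul_pdx_form d b q).symm, pdx_fst_mul (contDiff_pdx (smoothFun_form d b)),
    mul_add, fst_mul_pdx_form] at h1
  calc _ = p.1 * (p.1 * pdx (pdx (form d b)) p) := by ring
    _ = form d (fun i => i * (i * b i)) p - form d (fun i => i * b i) p := by linarith
    _ = _ := by
      unfold form
      rw [← Finset.sum_sub_distrib]
      exact Finset.sum_congr rfl fun i _ => by ring

theorem snd_sq_mul_pdy_pdy_form (d : ℕ) (b : ℕ → ℝ) (p : ℝ × ℝ) :
    p.2 ^ 2 * pdy (pdy (form d b)) p =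
      form d (fun i => ((d - i : ℕ) : ℝ) * (((d - i : ℕ) : ℝ) - 1) * b i) p := by
  have h1 := snd_mul_pdy_form d (fun i => ((d - i : ℕ) : ℝ) * b i) p
  rw [show form d (fun i => ((d - i : ℕ) : ℝ) * b i) = fun q => q.2 * pdy (form d b) q from
    funext fun q => (snd_mul_pdy_form d b q).symm, pdy_snd_mul (contDiff_pdy (smoothFun_form d b)),
    mul_add, snd_mul_pdy_form] at h1
  calc _ = p.2 * (p.2 * pdy (pdy (form d b)) p) := by ring
    _ = form d (fun i => ((d - i : ℕ) : ℝ) * (((d - i : ℕ) : ℝ) * b i)) p -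
        form d (fun i => ((d - i : ℕ) : ℝ) * b i) p := by linarith
    _ = _ := by
      unfold form
      rw [← Finset.sum_sub_distrib]
      exact Finset.sum_congr rfl fun i _ => by ring

theorem fst_mul_snd_mul_pdx_pdy_form (d : ℕ) (b : ℕ → ℝ) (p : ℝ × ℝ) :
    p.1 * p.2 * pdx (pdy (form d b)) p =
      form d (fun i => i * ((d - i : ℕ) : ℝ) * b i) p := by
  have h1 := fst_mul_pdx_form d (fun i => ((d - i : ℕ) : ℝ) * b i) p
  rw [show form d (fun i => ((d - i : ℕ) : ℝ) * b i) = fun q => q.2 * pdy (form d b) q from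
    funext fun q => (snd_mul_pdy_form d b q).symm, pdx_snd_mul] at h1
  simp only [← mul_assoc] at h1
  exact h1

theorem abs_form_sub_le {j l : ℕ} (hj : 1 ≤ j) {b : ℕ → ℝ} (hb : ∀ i, 0 < i → i < j → b i = 0)
    {ε : ℝ} (hε : ε ≤ 1) {p : ℝ × ℝ} (h1 : 0 < p.1) (h2 : 0 < p.2) (h : p.1 ≤ ε * p.2) :
    |form (j + l) b p - b j * (p.1 ^ j * p.2 ^ l) - b 0 * p.2 ^ (j + l)| ≤
      (∑ i ∈ Finset.range (j + l + 1), |b i|) * ε * (p.1 ^ j * p.2 ^ l) := by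
  have hε0 : 0 < ε := by
    by_contra hc
    nlinarith
  have e1 : form (j + l) b p - b j * (p.1 ^ j * p.2 ^ l) - b 0 * p.2 ^ (j + l) =
      ∑ i ∈ Finset.range (j + l + 1), (b i * p.1 ^ i * p.2 ^ (j + l - i) -
        (if i = j then b j * (p.1 ^ j * p.2 ^ l) else 0) -
        (if i = 0 then b 0 * p.2 ^ (j + l) else 0)) := by
    rw [Finset.sum_sub_distrib, Finset.sum_sub_distrib, Finset.sum_ite_eq', Finset.sum_ite_eq',
      if_pos (by simp), if_pos (by simp), form]
  rw [e1, Finset.sum_mul, Finset.sum_mul]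
  refine (Finset.abs_sum_le_sum_abs _ _).trans (Finset.sum_le_sum fun i hi => ?_)
  have hu : 0 < p.1 ^ j * p.2 ^ l := by positivity
  rcases Nat.eq_zero_or_pos i with rfl | hi0
  · rw [if_neg (by omega), if_pos rfl]
    simp
    positivity
  rw [if_neg (show ¬ i = 0 by omega)]
  rcases lt_trichotomy i j with hij | rfl | hij
  · rw [hb i hi0 hij, if_neg (by omega)]
    simp
  · rw [if_pos rfl, Nat.add_sub_cancel_left]
    have : b i * p.1 ^ i * p.2 ^ l - b i * (p.1 ^ i * p.2 ^ l) - 0 = 0 := by ring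
    rw [this, abs_zero]
    positivity
  · rw [if_neg (by omega), sub_zero, sub_zero, abs_mul, abs_mul, abs_of_pos (by positivity : (0:ℝ) < p.1 ^ i),
      abs_of_pos (by positivity : (0:ℝ) < p.2 ^ (j + l - i)), mul_assoc, mul_assoc]
    gcongr |b i| * ?_
    obtain ⟨k, rfl⟩ := Nat.exists_eq_add_of_lt hij
    have hi' : j + k + 1 ≤ j + l := by simpa [Nat.lt_succ_iff] using hi
    obtain ⟨m, rfl⟩ : ∃ m, l = k + 1 + m := ⟨l - (k + 1), by omega⟩
    rw [show j + (k + 1 + m) - (j + k + 1) = m by omega]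
    have h3 : p.1 ^ (k + 1) ≤ ε * p.2 ^ (k + 1) := by
      calc p.1 ^ (k + 1) ≤ (ε * p.2) ^ (k + 1) := by gcongr
        _ = ε ^ (k + 1) * p.2 ^ (k + 1) := mul_pow _ _ _
        _ ≤ ε * p.2 ^ (k + 1) := by
          gcongr
          exact pow_le_of_le_one hε0.le hε (by omega)
    calc p.1 ^ (j + k + 1) * p.2 ^ m = p.1 ^ j * p.1 ^ (k + 1) * p.2 ^ m := by ring
      _ ≤ p.1 ^ j * (ε * p.2 ^ (k + 1)) * p.2 ^ m := by gcongr
      _ = _ := by ring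

/-- The derivatives of `ω` up to order two are those of `a ξ ^ j μ ^ l + c μ ^ (j + l)` on `S`,
up to a relative error `e`. -/
structure NearBinomial (j l : ℕ) (a c e : ℝ) (ω : ℝ × ℝ → ℝ) (S : Set (ℝ × ℝ)) : Prop where
  pos : ∀ p ∈ S, 0 < p.1 ∧ 0 < p.2
  le : ∀ p ∈ S, p.1 ≤ e * p.2
  x : ∀ p ∈ S, |p.1 * pdx ω p - j * a * (p.1 ^ j * p.2 ^ l)| ≤ e * (p.1 ^ j * p.2 ^ l)
  y : ∀ p ∈ S, |p.2 * pdy ω p - l * a * (p.1 ^ j * p.2 ^ l) - (j + l) * c * p.2 ^ (j + l)| ≤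
    e * (p.1 ^ j * p.2 ^ l)
  xx : ∀ p ∈ S, |p.1 ^ 2 * pdx (pdx ω) p - j * (j - 1) * a * (p.1 ^ j * p.2 ^ l)| ≤
    e * (p.1 ^ j * p.2 ^ l)
  xy : ∀ p ∈ S, |p.1 * p.2 * pdx (pdy ω) p - j * l * a * (p.1 ^ j * p.2 ^ l)| ≤
    e * (p.1 ^ j * p.2 ^ l)
  yy : ∀ p ∈ S, |p.2 ^ 2 * pdy (pdy ω) p - l * (l - 1) * a * (p.1 ^ j * p.2 ^ l) -
    (j + l) * (j + l - 1) * c * p.2 ^ (j + l)| ≤ e * (p.1 ^ j * p.2 ^ l)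

/-- The sector of points of the open first quadrant below the line `ξ = ε μ`. -/
def sector (ε : ℝ) : Set (ℝ × ℝ) := {p | 0 < p.1 ∧ 0 < p.2 ∧ p.1 ≤ ε * p.2}

theorem exists_nearBinomial_form {j l : ℕ} (hj : 1 ≤ j) {b : ℕ → ℝ}
    (hb : ∀ i, 0 < i → i < j → b i = 0) {e : ℝ} (he : 0 < e) :
    ∃ ε > 0, NearBinomial j l (b j) (b 0) e (form (j + l) b) (sector ε) := by
  have key : ∀ w : ℕ → ℝ, ∃ ε₀ > 0, ∀ ε ≤ ε₀, ∀ p ∈ sector ε,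
      |form (j + l) (fun i => w i * b i) p - w j * b j * (p.1 ^ j * p.2 ^ l) -
        w 0 * b 0 * p.2 ^ (j + l)| ≤ e * (p.1 ^ j * p.2 ^ l) := by
    intro w
    set Z := ∑ i ∈ Finset.range (j + l + 1), |w i * b i| with hZ
    have hZ0 : 0 ≤ Z := Finset.sum_nonneg fun i _ => abs_nonneg _
    refine ⟨min 1 (e / (Z + 1)), by positivity, fun ε hε p hp => ?_⟩
    have hu : 0 < p.1 ^ j * p.2 ^ l := by have := hp.1; have := hp.2.1; positivity
    refine (abs_form_sub_le hj (fun i hi hij => by rw [hb i hi hij, mul_zero])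
      (hε.trans (min_le_left _ _)) hp.1 hp.2.1 hp.2.2).trans ?_
    gcongr
    rw [← hZ]
    have h1 : ε * (Z + 1) ≤ e := (le_div_iff₀ (by positivity)).1 (hε.trans (min_le_right _ _))
    have hε0 : 0 < ε := by
      by_contra hc
      nlinarith [hp.1, hp.2.1, hp.2.2]
    nlinarith
  obtain ⟨ε₁, p1, k1⟩ := key fun i => i
  obtain ⟨ε₂, p2, k2⟩ := key fun i => ((j + l - i : ℕ) : ℝ)
  obtain ⟨ε₃, p3, k3⟩ := key fun i => i * (i - 1)
  obtain ⟨ε₄, p4, k4⟩ := key fun i => i * ((j + l - i : ℕ) : ℝ)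
  obtain ⟨ε₅, p5, k5⟩ := key fun i => ((j + l - i : ℕ) : ℝ) * (((j + l - i : ℕ) : ℝ) - 1)
  refine ⟨min e (min ε₁ (min ε₂ (min ε₃ (min ε₄ ε₅)))), by positivity,
    fun p hp => ⟨hp.1, hp.2.1⟩, ?_, ?_, ?_, ?_, ?_, ?_⟩
  · intro p hp
    refine hp.2.2.trans ?_
    have := hp.2.1
    gcongr
    exact min_le_left _ _
  · intro p hp
    have := k1 _ (by simp) p hp
    rw [fst_mul_pdx_form]
    simpa using this
  · intro p hp
    have := k2 _ (by simp) p hp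
    rw [snd_mul_pdy_form]
    simpa using this
  · intro p hp
    have := k3 _ (by simp) p hp
    rw [fst_sq_mul_pdx_pdx_form]
    simpa using this
  · intro p hp
    have := k4 _ (by simp) p hp
    rw [fst_mul_snd_mul_pdx_pdy_form]
    simpa using this
  · intro p hp
    have := k5 _ (by simp) p hp
    rw [snd_sq_mul_pdy_pdy_form]
    simpa using this

theorem measurableSet_sector (ε : ℝ) : MeasurableSet (sector ε) := by
  have h1 : MeasurableSet {p : ℝ × ℝ | 0 < p.1} := measurableSet_lt (by fun_prop) (by fun_prop)
  have h2 : MeasurableSet {p : ℝ × ℝ | 0 < p.2} := measurableSet_lt (by fun_prop) (by fun_prop)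
  have h3 : MeasurableSet {p : ℝ × ℝ | p.1 ≤ ε * p.2} :=
    measurableSet_le (by fun_prop) (by fun_prop)
  exact h1.inter (h2.inter h3)

theorem convex_sector (ε : ℝ) : Convex ℝ (sector ε) := by
  rintro p ⟨h1, h2, h3⟩ q ⟨k1, k2, k3⟩ s t hs ht hst
  rcases hs.eq_or_lt with rfl | hs
  · obtain rfl : t = 1 := by linarith
    simpa using ⟨k1, k2, k3⟩
  · refine ⟨?_, ?_, ?_⟩
    all_goals simp only [Prod.fst_add, Prod.snd_add, Prod.smul_fst, Prod.smul_snd, smul_eq_mul]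
    · positivity
    · positivity
    · nlinarith [mul_le_mul_of_nonneg_left h3 hs.le, mul_le_mul_of_nonneg_left k3 ht]

theorem exists_ratio_close {φ : ℝ × ℝ → ℝ} (hφ : ContinuousAt φ (1, 1)) (h1 : φ (1, 1) = 1)
    {δ : ℝ} (hδ : 0 < δ) :
    ∃ θ > 0, ∀ r s : ℝ, |r - 1| ≤ θ → |s - 1| ≤ θ → |φ (r, s) - 1| ≤ δ := by
  obtain ⟨θ, hθ, h⟩ := Metric.continuousAt_iff.1 hφ δ hδ
  refine ⟨θ / 2, by positivity, fun r s hr hs => ?_⟩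
  have := h (x := (r, s)) (by
    rw [Prod.dist_eq, Real.dist_eq, Real.dist_eq]
    exact max_lt (by dsimp only; linarith) (by dsimp only; linarith))
  rw [Real.dist_eq, h1] at this
  exact this.le

theorem abs_mul_sub_le {X m e δ φ uq up t : ℝ} (hX : |X - m * uq| ≤ e * uq) (he : 0 ≤ e)
    (hup : 0 ≤ up) (ht : 0 ≤ t) (hφ : t * uq = φ * up) (hφ1 : |φ - 1| ≤ δ) :
    |t * X - m * up| ≤ ((1 + δ) * e + |m| * δ) * up := by
  have h1 : |t * (X - m * uq)| ≤ e * (φ * up) := by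
    rw [abs_mul, abs_of_nonneg ht, ← hφ]
    nlinarith
  have h2 : e * (φ * up) ≤ e * ((1 + δ) * up) := by
    gcongr
    linarith [(abs_le.1 hφ1).2]
  have h3 : |m * (φ - 1) * up| ≤ |m| * δ * up := by
    rw [abs_mul, abs_mul, abs_of_nonneg hup]
    gcongr
  calc |t * X - m * up| = |t * (X - m * uq) + m * (φ - 1) * up| := by
        congr 1; linear_combination m * hφ
    _ ≤ _ := abs_add_le _ _
    _ ≤ _ := by linarith

theorem abs_div_sub_one_le {x y θ : ℝ} (hx : 0 < x) (h : |y - x| ≤ θ * x) : |y / x - 1| ≤ θ := by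
  rw [div_sub_one hx.ne', abs_div, abs_of_pos hx, div_le_iff₀ hx]
  exact h

theorem damping_sq_mul_le {ω : ℝ × ℝ → ℝ} {p q : ℝ × ℝ} {w C Δ : ℝ} (hw : 0 < w) (hC : 0 ≤ C)
    (hΔ : 0 ≤ Δ) (h : |hessDet ω p| * |hessDet ω q| * w ^ 4 ≤ (C * Δ) ^ 4) :
    damping ω p ^ 2 * damping ω q ^ 2 ≤ ENNReal.ofReal Δ * ENNReal.ofReal (C / w) := by
  unfold damping
  rw [← ENNReal.ofReal_pow (by positivity), ← ENNReal.ofReal_pow (by positivity),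
    ← ENNReal.ofReal_mul (by positivity), ← ENNReal.ofReal_mul hΔ]
  apply ENNReal.ofReal_le_ofReal
  refine le_of_pow_le_pow_left₀ (n := 4) (by norm_num) (by positivity) ?_
  have e : ∀ x : ℝ, ((|x| ^ ((1 : ℝ) / 8)) ^ 2) ^ 4 = |x| := by
    intro x
    rw [← pow_mul, ← Real.rpow_natCast, ← Real.rpow_mul (abs_nonneg x)]
    norm_num
  rw [mul_pow, e, e, show Δ * (C / w) = C * Δ / w by ring, div_pow, le_div_iff₀ (by positivity)]
  exact h

theorem ratio_of_balanced {b t : ℝ} (hb : b ≠ 0) (ht : 0 < t) : ∃ κ > 0, ∃ e₀ > 0,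
    ∀ U W A B : ℝ, 0 < U → 0 < W → |A - b * U| ≤ e₀ * U → |B - b * W| ≤ e₀ * W →
      (A - B) ^ 2 < κ ^ 2 * |A * B| → |U / W - 1| ≤ t := by
  set s := min (1 / 3) (t / 3) with hs
  have hs0 : 0 < s := by positivity
  have hs1 : s ≤ 1 / 3 := min_le_left _ _
  have hs2 : s ≤ t / 3 := min_le_right _ _
  have hb0 : 0 < |b| := abs_pos.2 hb
  refine ⟨s / 2, by positivity, |b| * s / 2, by positivity, ?_⟩
  intro U W A B hU hW hA hB hAB
  have bd : ∀ {A U : ℝ}, 0 < U → |A - b * U| ≤ |b| * s / 2 * U → |A| ≤ 2 * |b| * U := by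
    intro A U hU hA
    calc |A| = |(A - b * U) + b * U| := by congr 1; ring
      _ ≤ |A - b * U| + |b| * U := by
        refine (abs_add_le _ _).trans (le_of_eq ?_)
        rw [abs_mul b U, abs_of_pos hU]
      _ ≤ |b| * (1 / 3) / 2 * U + |b| * U := by
        have : |b| * s / 2 * U ≤ |b| * (1 / 3) / 2 * U := by gcongr
        linarith
      _ ≤ _ := by nlinarith [mul_pos hb0 hU]
  have h1 : |A * B| ≤ (|b| * (U + W)) ^ 2 := by
    rw [abs_mul]
    calc |A| * |B| ≤ (2 * |b| * U) * (2 * |b| * W) := by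
          gcongr
          · exact bd hU hA
          · exact bd hW hB
      _ ≤ _ := by nlinarith [mul_nonneg (sq_nonneg |b|) (sq_nonneg (U - W))]
  have h2 : |A - B| ≤ s / 2 * (|b| * (U + W)) := by
    apply abs_le_of_sq_le_sq _ (by positivity)
    calc (A - B) ^ 2 ≤ (s / 2) ^ 2 * |A * B| := hAB.le
      _ ≤ (s / 2) ^ 2 * (|b| * (U + W)) ^ 2 := by gcongr
      _ = _ := by ring
  have h3 : |b| * |U - W| ≤ |b| * (s * (U + W)) := by
    rw [← abs_mul]
    calc |b * (U - W)| = |(A - B) - (A - b * U) + (B - b * W)| := by congr 1; ring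
      _ ≤ |A - B| + |A - b * U| + |B - b * W| :=
        (abs_add_le _ _).trans (by gcongr; exact abs_sub _ _)
      _ ≤ _ := by linarith
  have h4 : |U - W| ≤ s * (U + W) := le_of_mul_le_mul_left h3 hb0
  have h5 : U ≤ 2 * W := by
    have := (abs_le.1 h4).2
    nlinarith
  apply abs_div_sub_one_le hW
  refine h4.trans ?_
  nlinarith

theorem abs_sub_one_le_of_pow {x : ℝ} (hx : 0 ≤ x) {n : ℕ} (hn : n ≠ 0) :
    |x - 1| ≤ |x ^ n - 1| := by
  rcases le_total x 1 with h | h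
  · have : x ^ n ≤ x := pow_le_of_le_one hx h hn
    rw [abs_of_nonpos (by linarith), abs_of_nonpos (by linarith)]
    linarith
  · have : x ≤ x ^ n := le_self_pow₀ h hn
    rw [abs_of_nonneg (by linarith), abs_of_nonneg (by linarith)]
    linarith

theorem near_of_balanced (k m : ℕ) {a η : ℝ} (ha : a ≠ 0) (hη : 0 < η) :
    ∃ κ > 0, ∃ e₀ > 0, ∀ p q : ℝ × ℝ, 0 < p.1 → 0 < p.2 → 0 < q.1 → 0 < q.2 →
      ∀ A B A' B' : ℝ,
      |A - (k + 1 : ℝ) * a * (p.1 ^ k * p.2 ^ (m + 1))| ≤ e₀ * (p.1 ^ k * p.2 ^ (m + 1)) →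
      |B - (k + 1 : ℝ) * a * (q.1 ^ k * q.2 ^ (m + 1))| ≤ e₀ * (q.1 ^ k * q.2 ^ (m + 1)) →
      |A' - (m + 1 : ℝ) * a * (p.1 ^ (k + 1) * p.2 ^ m)| ≤ e₀ * (p.1 ^ (k + 1) * p.2 ^ m) →
      |B' - (m + 1 : ℝ) * a * (q.1 ^ (k + 1) * q.2 ^ m)| ≤ e₀ * (q.1 ^ (k + 1) * q.2 ^ m) →
      (A - B) ^ 2 < κ ^ 2 * |A * B| → (A' - B') ^ 2 < κ ^ 2 * |A' * B'| →
      (p, q) ∈ nearSet η := by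
  obtain ⟨t₁, ht₁, h₁⟩ := exists_ratio_close (φ := fun z => z.2 ^ (m + 1) / z.1 ^ m)
    (by fun_prop (disch := simp)) (by simp) hη
  obtain ⟨t₂, ht₂, h₂⟩ := exists_ratio_close (φ := fun z => z.1 ^ (k + 1) / z.2 ^ k)
    (by fun_prop (disch := simp)) (by simp) hη
  have ht : 0 < min t₁ t₂ := by positivity
  obtain ⟨κ, hκ, e, he, H⟩ := ratio_of_balanced (b := (k + 1 : ℝ) * a) (by positivity) ht
  obtain ⟨κ', hκ', e', he', H'⟩ := ratio_of_balanced (b := (m + 1 : ℝ) * a) (by positivity) ht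
  refine ⟨min κ κ', by positivity, min e e', by positivity, ?_⟩
  intro p q hp1 hp2 hq1 hq2 A B A' B' hA hB hA' hB' hAB hAB'
  have r₁ := H _ _ A B (by positivity : 0 < p.1 ^ k * p.2 ^ (m + 1))
    (by positivity : 0 < q.1 ^ k * q.2 ^ (m + 1))
    (hA.trans (by gcongr; exact min_le_left _ _)) (hB.trans (by gcongr; exact min_le_left _ _))
    (hAB.trans_le (by gcongr; exact min_le_left _ _))
  have r₂ := H' _ _ A' B' (by positivity : 0 < p.1 ^ (k + 1) * p.2 ^ m)
    (by positivity : 0 < q.1 ^ (k + 1) * q.2 ^ m)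
    (hA'.trans (by gcongr; exact min_le_right _ _))
    (hB'.trans (by gcongr; exact min_le_right _ _))
    (hAB'.trans_le (by gcongr; exact min_le_right _ _))
  have e1 := h₁ _ _ (r₁.trans (min_le_left _ _)) (r₂.trans (min_le_left _ _))
  have e2 := h₂ _ _ (r₁.trans (min_le_right _ _)) (r₂.trans (min_le_right _ _))
  dsimp only at e1 e2
  have f1 : (p.1 ^ (k + 1) * p.2 ^ m / (q.1 ^ (k + 1) * q.2 ^ m)) ^ (m + 1) /
      (p.1 ^ k * p.2 ^ (m + 1) / (q.1 ^ k * q.2 ^ (m + 1))) ^ m = (p.1 / q.1) ^ (k + m + 1) := by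
    field_simp
    ring
  have f2 : (p.1 ^ k * p.2 ^ (m + 1) / (q.1 ^ k * q.2 ^ (m + 1))) ^ (k + 1) /
      (p.1 ^ (k + 1) * p.2 ^ m / (q.1 ^ (k + 1) * q.2 ^ m)) ^ k = (p.2 / q.2) ^ (k + m + 1) := by
    field_simp
    ring
  rw [f1] at e1
  rw [f2] at e2
  have g1 := (abs_sub_one_le_of_pow (by positivity) (by omega)).trans e1
  have g2 := (abs_sub_one_le_of_pow (by positivity) (by omega)).trans e2
  rw [div_sub_one hq1.ne', abs_div, abs_of_pos hq1, div_le_iff₀ hq1] at g1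
  rw [div_sub_one hq2.ne', abs_div, abs_of_pos hq2, div_le_iff₀ hq2] at g2
  refine ⟨g1.trans ?_, g2.trans ?_⟩
  · dsimp only; gcongr; linarith
  · dsimp only; gcongr; linarith

theorem lintegral_inv_sqrt {M : ℝ} (hM : 0 < M) :
    ∫⁻ y in Set.Ioo 0 M, ENNReal.ofReal (1 / √y) = ENNReal.ofReal (2 * √M) := by
  have hi : IntervalIntegrable (fun y : ℝ => y ^ (-(1 / 2) : ℝ)) volume 0 M :=
    intervalIntegral.intervalIntegrable_rpow' (by norm_num)
  have h1 : ∫ y in (0 : ℝ)..M, y ^ (-(1 / 2) : ℝ) = 2 * √M := by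
    rw [integral_rpow (Or.inl (by norm_num)), Real.sqrt_eq_rpow,
      show (-(1 / 2) + 1 : ℝ) = 1 / 2 by norm_num, Real.zero_rpow (by norm_num)]
    ring
  rw [intervalIntegral.integral_of_le hM.le, integral_Ioc_eq_integral_Ioo] at h1
  rw [intervalIntegrable_iff_integrableOn_Ioo_of_le hM.le] at hi
  rw [← h1, ofReal_integral_eq_lintegral_ofReal hi
    ((ae_restrict_iff' measurableSet_Ioo).2 (.of_forall fun y hy => Real.rpow_nonneg hy.1.le _))]
  refine setLIntegral_congr_fun measurableSet_Ioo fun y hy => ?_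
  rw [Real.rpow_neg hy.1.le, ← Real.sqrt_eq_rpow, one_div]

theorem lintegral_beta_kernel (M : ℝ) {C : ℝ} (hC : 0 ≤ C) :
    ∫⁻ y, (Set.Ioo 0 M).indicator (fun y => ENNReal.ofReal (C / √(y * (M - y)))) y ≤
      ENNReal.ofReal (8 * C) := by
  rw [lintegral_indicator measurableSet_Ioo]
  rcases le_or_gt M 0 with hM | hM
  · rw [Set.Ioo_eq_empty (by simpa using hM)]
    simp
  have hs : 0 < √M := Real.sqrt_pos.2 hM
  have h2 : √M * √M = M := Real.mul_self_sqrt hM.le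
  have key : ∀ y ∈ Set.Ioo 0 M, ENNReal.ofReal (C / √(y * (M - y))) ≤
      ENNReal.ofReal (2 * C / √M) *
        (ENNReal.ofReal (1 / √y) + ENNReal.ofReal (1 / √(M - y))) := by
    intro y hy
    have hy1 : 0 < √y := Real.sqrt_pos.2 hy.1
    have hy2 : 0 < √(M - y) := Real.sqrt_pos.2 (by linarith [hy.2])
    have e1 : √y * √y = y := Real.mul_self_sqrt hy.1.le
    have e2 : √(M - y) * √(M - y) = M - y := Real.mul_self_sqrt (by linarith [hy.2])
    rw [← ENNReal.ofReal_add (by positivity) (by positivity), ← ENNReal.ofReal_mul (by positivity)]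
    apply ENNReal.ofReal_le_ofReal
    rw [Real.sqrt_mul hy.1.le]
    have h3 : √M ≤ √y + √(M - y) := by
      nlinarith [mul_pos hy1 hy2]
    rw [show 2 * C / √M * (1 / √y + 1 / √(M - y)) =
      2 * C * (√y + √(M - y)) / (√M * (√y * √(M - y))) by field_simp; ring,
      div_le_div_iff₀ (by positivity) (by positivity)]
    have : 0 ≤ C * (√y * √(M - y)) := by positivity
    nlinarith
  have hrefl : ∫⁻ y in Set.Ioo 0 M, ENNReal.ofReal (1 / √(M - y)) =
      ∫⁻ y in Set.Ioo 0 M, ENNReal.ofReal (1 / √y) := by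
    rw [← lintegral_indicator measurableSet_Ioo, ← lintegral_indicator measurableSet_Ioo,
      ← lintegral_sub_left_eq_self _ M]
    refine lintegral_congr fun y => ?_
    have : M - y ∈ Set.Ioo 0 M ↔ y ∈ Set.Ioo 0 M := by
      simp only [Set.mem_Ioo]; constructor <;> rintro ⟨h, h'⟩ <;> constructor <;> linarith
    simp only [Set.indicator, this, sub_sub_cancel]
  calc _ ≤ ∫⁻ y in Set.Ioo 0 M, ENNReal.ofReal (2 * C / √M) *
        (ENNReal.ofReal (1 / √y) + ENNReal.ofReal (1 / √(M - y))) :=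
        setLIntegral_mono' measurableSet_Ioo key
    _ = ENNReal.ofReal (2 * C / √M) * (ENNReal.ofReal (2 * √M) + ENNReal.ofReal (2 * √M)) := by
        rw [lintegral_const_mul _ (by fun_prop), lintegral_add_left (by fun_prop), hrefl,
          lintegral_inv_sqrt hM]
    _ = _ := by
        rw [← ENNReal.ofReal_add (by positivity) (by positivity),
          ← ENNReal.ofReal_mul (by positivity)]
        congr 1
        field_simp
        ring

theorem abs_le_of_abs_sub_le {x m e u : ℝ} (hu : 0 ≤ u) (h : |x - m * u| ≤ e * u) :
    |x| ≤ (|m| + e) * u := by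
  calc |x| = |(x - m * u) + m * u| := by congr 1; ring
    _ ≤ |x - m * u| + |m * u| := abs_add_le _ _
    _ ≤ _ := by rw [abs_mul, abs_of_nonneg hu]; linarith

theorem le_abs_of_abs_sub_le {x m e u : ℝ} (hu : 0 ≤ u) (h : |x - m * u| ≤ e * u) :
    (|m| - e) * u ≤ |x| := by
  have : |m * u| ≤ |x| + |x - m * u| := by
    calc |m * u| = |x - (x - m * u)| := by congr 1; ring
      _ ≤ _ := abs_sub _ _
  rw [abs_mul, abs_of_nonneg hu] at this
  linarith

theorem error_le {δ m e M : ℝ} (hδ : 0 < δ) (hm : |m| ≤ M) (he0 : 0 ≤ e) (he : e ≤ δ / 4) :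
    (1 + min 1 (δ / (2 * (M + 1)))) * e + |m| * min 1 (δ / (2 * (M + 1))) ≤ δ := by
  have hM : 0 ≤ M := (abs_nonneg m).trans hm
  have h1 : min 1 (δ / (2 * (M + 1))) ≤ 1 := min_le_left _ _
  have h2 : |m| * min 1 (δ / (2 * (M + 1))) ≤ (M + 1) * (δ / (2 * (M + 1))) := by
    gcongr
    · linarith
    · exact min_le_right _ _
  have h3 : (M + 1) * (δ / (2 * (M + 1))) = δ / 2 := by field_simp
  have h4 : (1 + min 1 (δ / (2 * (M + 1)))) * e ≤ (1 + 1) * (δ / 4) := by gcongr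
  linarith

theorem measurableSet_pairs {S : Set (ℝ × ℝ)} (hS : MeasurableSet S) {f g : ℝ × ℝ → ℝ}
    (hf : Continuous f) (hg : Continuous g) (κ : ℝ) :
    MeasurableSet {z : (ℝ × ℝ) × (ℝ × ℝ) | z.1 ∈ S ∧ z.2 ∈ S ∧
      κ ^ 2 * |f z.1 * g z.2| ≤ (f z.1 - g z.2) ^ 2} := by
  have h1 : MeasurableSet {z : (ℝ × ℝ) × (ℝ × ℝ) |
      κ ^ 2 * |f z.1 * g z.2| ≤ (f z.1 - g z.2) ^ 2} :=
    (isClosed_le (by fun_prop) (by fun_prop)).measurableSet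
  exact (measurable_fst hS).inter ((measurable_snd hS).inter h1)

theorem balanced_damping_le {ω : ℝ × ℝ → ℝ} {p q : ℝ × ℝ} {x y A B κ C : ℝ} (hx : 0 < x)
    (hy : 0 < y) (hκ : 0 < κ) (hC : 0 ≤ C) (hp : |hessDet ω p| * x ^ 2 ≤ C * A ^ 2)
    (hq : |hessDet ω q| * y ^ 2 ≤ C * B ^ 2) (h : κ ^ 2 * |A * B| ≤ (A - B) ^ 2) :
    damping ω p ^ 2 * damping ω q ^ 2 ≤
      ENNReal.ofReal |A - B| * ENNReal.ofReal (√C / κ / √(x * y)) := by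
  refine damping_sq_mul_le (by positivity) (by positivity) (abs_nonneg _) ?_
  have e1 : √(x * y) ^ 4 = (x * y) ^ 2 := by
    rw [show (4 : ℕ) = 2 * 2 by norm_num, pow_mul, Real.sq_sqrt (by positivity)]
  have e2 : √C ^ 4 = C ^ 2 := by
    rw [show (4 : ℕ) = 2 * 2 by norm_num, pow_mul, Real.sq_sqrt hC]
  have e3 : |A - B| ^ 4 = ((A - B) ^ 2) ^ 2 := by
    rw [← pow_mul, ← abs_pow, abs_of_nonneg (by positivity)]
  rw [mul_pow, div_pow, e1, e2, e3]
  calc |hessDet ω p| * |hessDet ω q| * (x * y) ^ 2 =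
        (|hessDet ω p| * x ^ 2) * (|hessDet ω q| * y ^ 2) := by ring
    _ ≤ (C * A ^ 2) * (C * B ^ 2) := by gcongr
    _ = C ^ 2 / κ ^ 4 * (κ ^ 2 * |A * B|) ^ 2 := by
      rw [mul_pow, sq_abs]; field_simp
    _ ≤ C ^ 2 / κ ^ 4 * ((A - B) ^ 2) ^ 2 := by gcongr

theorem sq_le_of_abs_sub_le {a c e u z : ℝ} (hu : 0 ≤ u) (ha : a ≠ 0) (he : e ≤ |a| / 2)
    (hc : 1 ≤ c) (hz : |z - c * a * u| ≤ e * u) : u ^ 2 ≤ 4 / |a| ^ 2 * z ^ 2 := by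
  have ha0 : 0 < |a| := abs_pos.2 ha
  have hc0 : |c| = c := abs_of_pos (by linarith)
  have h1 := le_abs_of_abs_sub_le hu hz
  have h2 : |a| / 2 * u ≤ |z| := by
    refine le_trans ?_ h1
    gcongr
    rw [abs_mul, hc0]
    nlinarith
  have h3 : (|a| / 2 * u) ^ 2 ≤ |z| ^ 2 := by gcongr
  rw [sq_abs] at h3
  rw [div_mul_eq_mul_div, le_div_iff₀ (by positivity)]
  nlinarith

/-- Bounds for the second derivatives of `ω`, after rescaling, bound its Hessian determinant. -/
theorem hessDet_le_of_le {ω : ℝ × ℝ → ℝ} {p : ℝ × ℝ} {r s A B E : ℝ} (hr : 0 < r) (hs : 0 < s)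
    (h1 : |r ^ 2 * pdx (pdx ω) p| ≤ A) (h2 : |r * s * pdx (pdy ω) p| ≤ B)
    (h3 : |s ^ 2 * pdy (pdy ω) p| ≤ E) : (r * s) ^ 2 * |hessDet ω p| ≤ A * E + B ^ 2 := by
  rw [← abs_of_pos (by positivity : 0 < (r * s) ^ 2), ← abs_mul,
    show (r * s) ^ 2 * hessDet ω p = (r ^ 2 * pdx (pdx ω) p) *
      (s ^ 2 * pdy (pdy ω) p) - (r * s * pdx (pdy ω) p) ^ 2 by unfold hessDet; ring]
  refine (abs_sub _ _).trans ?_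
  rw [abs_mul, abs_pow]
  have := (abs_nonneg _).trans h1
  gcongr

set_option maxHeartbeats 400000 in
theorem posBound_monomial (k m : ℕ) {a : ℝ} (ha : a ≠ 0) :
    ∃ e > 0, ∀ (n : ℕ) (ω : ℝ × ℝ → ℝ) (S : Set (ℝ × ℝ)), PolySlices n ω → SmoothFun ω →
      MeasurableSet S → Convex ℝ S → NearBinomial (k + 1) (m + 1) a 0 e ω S →
      PosBound ω (damping ω) S := by
  set m₁ : ℝ := (k + 1) * k * a with hm₁
  set m₂ : ℝ := (k + 1) * (m + 1) * a with hm₂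
  set m₃ : ℝ := (m + 1) * m * a with hm₃
  have hdet : m₁ * m₃ - m₂ ^ 2 ≠ 0 := by
    have : m₁ * m₃ - m₂ ^ 2 = -((k + 1) * (m + 1) * (k + m + 1) * a ^ 2) := by
      rw [hm₁, hm₂, hm₃]; ring
    rw [this, neg_ne_zero]
    positivity
  obtain ⟨δ, hδ, hm⟩ := exists_nondegeneracy_constant hdet
  set M := |m₁| + |m₂| + |m₃| with hM
  have b1 : |m₁| ≤ M := by rw [hM]; linarith [abs_nonneg m₂, abs_nonneg m₃]
  have b2 : |m₂| ≤ M := by rw [hM]; linarith [abs_nonneg m₁, abs_nonneg m₃]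
  have b3 : |m₃| ≤ M := by rw [hM]; linarith [abs_nonneg m₁, abs_nonneg m₂]
  have hM0 : 0 ≤ M := (abs_nonneg _).trans b1
  have hδ₁ : 0 < min 1 (δ / (2 * (M + 1))) := by positivity
  obtain ⟨θ₁, hθ₁, φ₁⟩ := exists_ratio_close
    (φ := fun z => (z.1 ^ 2)⁻¹ * (z.1 ^ (k + 1) * z.2 ^ (m + 1)))
    (by fun_prop (disch := simp)) (by simp) hδ₁
  obtain ⟨θ₂, hθ₂, φ₂⟩ := exists_ratio_close
    (φ := fun z => (z.1 * z.2)⁻¹ * (z.1 ^ (k + 1) * z.2 ^ (m + 1)))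
    (by fun_prop (disch := simp)) (by simp) hδ₁
  obtain ⟨θ₃, hθ₃, φ₃⟩ := exists_ratio_close
    (φ := fun z => (z.2 ^ 2)⁻¹ * (z.1 ^ (k + 1) * z.2 ^ (m + 1)))
    (by fun_prop (disch := simp)) (by simp) hδ₁
  set θ := min 1 (min θ₁ (min θ₂ θ₃)) with hθ
  have hθ0 : 0 < θ := by positivity
  have t1 : θ ≤ 1 := min_le_left _ _
  have t2 : θ ≤ θ₁ := (min_le_right _ _).trans (min_le_left _ _)
  have t3 : θ ≤ θ₂ := (min_le_right _ _).trans ((min_le_right _ _).trans (min_le_left _ _))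
  have t4 : θ ≤ θ₃ := (min_le_right _ _).trans ((min_le_right _ _).trans (min_le_right _ _))
  set η := θ / 4 with hη
  obtain ⟨κ, hκ, e₀, he₀, near⟩ := near_of_balanced k m (η := η) ha (by positivity)
  have ha0 : 0 < |a| := abs_pos.2 ha
  refine ⟨min e₀ (min (δ / 4) (|a| / 2)), by positivity, ?_⟩
  intro n ω S hs hω hSm hSc nb
  set e := min e₀ (min (δ / 4) (|a| / 2)) with he
  have he1 : e ≤ e₀ := min_le_left _ _
  have he2 : e ≤ δ / 4 := (min_le_right _ _).trans (min_le_left _ _)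
  have he3 : e ≤ |a| / 2 := (min_le_right _ _).trans (min_le_right _ _)
  have hepos : 0 < e := by positivity
  have xx : ∀ p ∈ S, |p.1 ^ 2 * pdx (pdx ω) p - m₁ * (p.1 ^ (k + 1) * p.2 ^ (m + 1))| ≤
      e * (p.1 ^ (k + 1) * p.2 ^ (m + 1)) := fun p hp => by
    have := nb.xx p hp
    push_cast at this
    rw [add_sub_cancel_right] at this
    exact this
  have xy : ∀ p ∈ S, |p.1 * p.2 * pdx (pdy ω) p - m₂ * (p.1 ^ (k + 1) * p.2 ^ (m + 1))| ≤
      e * (p.1 ^ (k + 1) * p.2 ^ (m + 1)) := fun p hp => by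
    have := nb.xy p hp
    push_cast at this
    exact this
  have yy : ∀ p ∈ S, |p.2 ^ 2 * pdy (pdy ω) p - m₃ * (p.1 ^ (k + 1) * p.2 ^ (m + 1))| ≤
      e * (p.1 ^ (k + 1) * p.2 ^ (m + 1)) := fun p hp => by
    have := nb.yy p hp
    push_cast at this
    rw [add_sub_cancel_right, mul_zero, zero_mul, sub_zero] at this
    exact this
  have dx : ∀ p ∈ S, |p.1 * pdx ω p - (k + 1 : ℝ) * a * (p.1 ^ (k + 1) * p.2 ^ (m + 1))| ≤
      e * (p.1 ^ (k + 1) * p.2 ^ (m + 1)) := fun p hp => by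
    have := nb.x p hp
    push_cast at this
    exact this
  have dy : ∀ p ∈ S, |p.2 * pdy ω p - (m + 1 : ℝ) * a * (p.1 ^ (k + 1) * p.2 ^ (m + 1))| ≤
      e * (p.1 ^ (k + 1) * p.2 ^ (m + 1)) := fun p hp => by
    have := nb.y p hp
    push_cast at this
    rw [mul_zero, zero_mul, sub_zero] at this
    exact this
  have hcont1 : Continuous (pdx ω) := (contDiff_pdx hω).continuous
  have hcont2 : Continuous (pdy ω) := (contDiff_pdy hω).continuous
  set Q : ℝ := 2 * (M + e) ^ 2 * (4 / |a| ^ 2) with hQ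
  have hQ0 : 0 ≤ Q := by positivity
  -- both gradient components control the Hessian determinant
  have hK : ∀ p ∈ S, |hessDet ω p| * p.2 ^ 2 ≤ Q * pdx ω p ^ 2 ∧
      |hessDet ω p| * p.1 ^ 2 ≤ Q * pdy ω p ^ 2 := by
    intro p hp
    obtain ⟨hp1, hp2⟩ := nb.pos p hp
    set u := p.1 ^ (k + 1) * p.2 ^ (m + 1) with hu
    have hu0 : 0 < u := by positivity
    have c1 : |p.1 ^ 2 * pdx (pdx ω) p| ≤ (M + e) * u :=
      (abs_le_of_abs_sub_le hu0.le (xx p hp)).trans (by gcongr)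
    have c2 : |p.1 * p.2 * pdx (pdy ω) p| ≤ (M + e) * u :=
      (abs_le_of_abs_sub_le hu0.le (xy p hp)).trans (by gcongr)
    have c3 : |p.2 ^ 2 * pdy (pdy ω) p| ≤ (M + e) * u :=
      (abs_le_of_abs_sub_le hu0.le (yy p hp)).trans (by gcongr)
    have hKu : (p.1 * p.2) ^ 2 * |hessDet ω p| ≤ 2 * (M + e) ^ 2 * u ^ 2 := by
      refine (hessDet_le_of_le hp1 hp2 c1 c2 c3).trans (le_of_eq ?_)
      ring
    have l1 := sq_le_of_abs_sub_le (c := k + 1) hu0.le ha he3 (by linarith [k.cast_nonneg (α := ℝ)]) (dx p hp)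
    have l2 := sq_le_of_abs_sub_le (c := m + 1) hu0.le ha he3 (by linarith [m.cast_nonneg (α := ℝ)]) (dy p hp)
    constructor
    · refine le_of_mul_le_mul_left ?_ (by positivity : 0 < p.1 ^ 2)
      calc p.1 ^ 2 * (|hessDet ω p| * p.2 ^ 2) = (p.1 * p.2) ^ 2 * |hessDet ω p| := by ring
        _ ≤ 2 * (M + e) ^ 2 * u ^ 2 := hKu
        _ ≤ 2 * (M + e) ^ 2 * (4 / |a| ^ 2 * (p.1 * pdx ω p) ^ 2) := by gcongr
        _ = _ := by rw [hQ]; ring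
    · refine le_of_mul_le_mul_left ?_ (by positivity : 0 < p.2 ^ 2)
      calc p.2 ^ 2 * (|hessDet ω p| * p.1 ^ 2) = (p.1 * p.2) ^ 2 * |hessDet ω p| := by ring
        _ ≤ 2 * (M + e) ^ 2 * u ^ 2 := hKu
        _ ≤ 2 * (M + e) ^ 2 * (4 / |a| ^ 2 * (p.2 * pdy ω p) ^ 2) := by gcongr
        _ = _ := by rw [hQ]; ring
  refine posBound_of_normal_form (a := fun p => p.1) (b := fun p => p.2)
    (D := fun p => p.1 ^ (k + 1) * p.2 ^ (m + 1)) (C₁ := Real.toNNReal (8 * (√Q / κ)))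
    (C₂ := Real.toNNReal (8 * (√Q / κ))) hs hω hSm hSc nb.pos measurable_fst measurable_snd
    (fun p hp => (nb.pos p hp).1) (fun p hp => (nb.pos p hp).2) ?_ hδ hm
    (η := η) (θ := θ) (by positivity) (by linarith) (by linarith) ?_ ?_
    (measurableSet_pairs hSm hcont1 hcont1 κ) (measurableSet_pairs hSm hcont2 hcont2 κ) ?_ ?_ ?_
  · intro p hp
    obtain ⟨hp1, hp2⟩ := nb.pos p hp
    positivity
  · rintro p hp q ⟨hq, h1, h2⟩
    obtain ⟨hp1, hp2⟩ := nb.pos p hp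
    have h1 := (abs_le.1 h1).2
    have h2 := (abs_le.1 h2).2
    constructor <;> nlinarith
  · rintro p hp q ⟨hq, h1, h2⟩
    obtain ⟨hp1, hp2⟩ := nb.pos p hp
    obtain ⟨hq1, hq2⟩ := nb.pos q hq
    have r1 := abs_div_sub_one_le hp1 h1
    have r2 := abs_div_sub_one_le hp2 h2
    have u0 : 0 ≤ p.1 ^ (k + 1) * p.2 ^ (m + 1) := by positivity
    refine ⟨?_, ?_, ?_⟩
    · have := abs_mul_sub_le (t := p.1 ^ 2 / q.1 ^ 2) (xx q hq) hepos.le u0 (by positivity)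
        (by simp only [div_pow]; field_simp) (φ₁ _ _ (r1.trans t2) (r2.trans t2))
      rw [show p.1 ^ 2 / q.1 ^ 2 * (q.1 ^ 2 * pdx (pdx ω) q) = p.1 ^ 2 * pdx (pdx ω) q by
        field_simp] at this
      exact this.trans (by gcongr; exact error_le hδ b1 hepos.le he2)
    · have := abs_mul_sub_le (t := p.1 * p.2 / (q.1 * q.2)) (xy q hq) hepos.le u0 (by positivity)
        (by simp only [div_pow]; field_simp) (φ₂ _ _ (r1.trans t3) (r2.trans t3))
      rw [show p.1 * p.2 / (q.1 * q.2) * (q.1 * q.2 * pdx (pdy ω) q) =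
        p.1 * p.2 * pdx (pdy ω) q by field_simp] at this
      exact this.trans (by gcongr; exact error_le hδ b2 hepos.le he2)
    · have := abs_mul_sub_le (t := p.2 ^ 2 / q.2 ^ 2) (yy q hq) hepos.le u0 (by positivity)
        (by simp only [div_pow]; field_simp) (φ₃ _ _ (r1.trans t4) (r2.trans t4))
      rw [show p.2 ^ 2 / q.2 ^ 2 * (q.2 ^ 2 * pdy (pdy ω) q) = p.2 ^ 2 * pdy (pdy ω) q by
        field_simp] at this
      exact this.trans (by gcongr; exact error_le hδ b3 hepos.le he2)
  · intro p hp q hq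
    by_contra! hc
    obtain ⟨hc1, hc2, hc3⟩ := hc
    obtain ⟨hp1, hp2⟩ := nb.pos p hp
    obtain ⟨hq1, hq2⟩ := nb.pos q hq
    refine hc3 (near p q hp1 hp2 hq1 hq2 (pdx ω p) (pdx ω q) (pdy ω p) (pdy ω q) ?_ ?_ ?_ ?_
      (not_le.1 fun h => hc1 ⟨hp, hq, h⟩) (not_le.1 fun h => hc2 ⟨hp, hq, h⟩))
    · refine le_of_mul_le_mul_left ?_ hp1
      rw [← abs_of_pos hp1, ← abs_mul, abs_of_pos hp1]
      convert (dx p hp).trans (mul_le_mul_of_nonneg_right he1 (by positivity)) using 1 <;> ring_nf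
    · refine le_of_mul_le_mul_left ?_ hq1
      rw [← abs_of_pos hq1, ← abs_mul, abs_of_pos hq1]
      convert (dx q hq).trans (mul_le_mul_of_nonneg_right he1 (by positivity)) using 1 <;> ring_nf
    · refine le_of_mul_le_mul_left ?_ hp2
      rw [← abs_of_pos hp2, ← abs_mul, abs_of_pos hp2]
      convert (dy p hp).trans (mul_le_mul_of_nonneg_right he1 (by positivity)) using 1 <;> ring_nf
    · refine le_of_mul_le_mul_left ?_ hq2
      rw [← abs_of_pos hq2, ← abs_mul, abs_of_pos hq2]
      convert (dy q hq).trans (mul_le_mul_of_nonneg_right he1 (by positivity)) using 1 <;> ring_nf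
  · intro P
    refine ⟨_, ?_, lintegral_beta_kernel P.2 (by positivity : 0 ≤ √Q / κ), ?_⟩
    · exact Measurable.indicator (by fun_prop) measurableSet_Ioo
    · rintro p ⟨hp, hq, h⟩
      have hp2 := (nb.pos _ hp).2
      have hq2 := (nb.pos _ hq).2
      dsimp only at hp hq h hp2 hq2
      rw [Prod.snd_sub] at hq2
      rw [Set.indicator_of_mem (show p.2 ∈ Set.Ioo 0 P.2 from ⟨hp2, by linarith⟩)]
      exact balanced_damping_le hp2 hq2 hκ hQ0 (hK _ hp).1 (hK _ hq).1 h
  · intro P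
    refine ⟨_, ?_, lintegral_beta_kernel P.1 (by positivity : 0 ≤ √Q / κ), ?_⟩
    · exact Measurable.indicator (by fun_prop) measurableSet_Ioo
    · rintro p ⟨hp, hq, h⟩
      have hp1 := (nb.pos _ hp).1
      have hq1 := (nb.pos _ hq).1
      dsimp only at hp hq h hp1 hq1
      rw [Prod.fst_sub] at hq1
      rw [Set.indicator_of_mem (show p.1 ∈ Set.Ioo 0 P.1 from ⟨hp1, by linarith⟩)]
      exact balanced_damping_le hp1 hq1 hκ hQ0 (hK _ hp).2 (hK _ hq).2 h

theorem abs_sub_mul_pow_le {x y : ℝ} (hx : 0 ≤ x) (hy : 0 ≤ y) (n : ℕ) :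
    |x - y| * ((x + y) / 2) ^ n ≤ |x ^ (n + 1) - y ^ (n + 1)| := by
  wlog h : y ≤ x generalizing x y
  · have := this hy hx (le_of_not_ge h)
    rwa [abs_sub_comm, add_comm y x, abs_sub_comm (y ^ (n + 1))] at this
  have h1 : y ^ n ≤ x ^ n := by gcongr
  have h2 : ((x + y) / 2) ^ n ≤ x ^ n := by gcongr; linarith
  rw [abs_of_nonneg (by linarith), abs_of_nonneg (by rw [sub_nonneg]; gcongr)]
  calc (x - y) * ((x + y) / 2) ^ n ≤ (x - y) * x ^ n := by
        gcongr
    _ ≤ (x - y) * x ^ n + y * (x ^ n - y ^ n) := by nlinarith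
    _ = _ := by ring

theorem sqrt_ratio_pow {X M e : ℝ} (hX : 0 < X) (hM : 0 < M) (he : e ≤ 1) (h : X ≤ e * M) (k : ℕ) :
    √((X / M) ^ (k + 2)) ≤ e ∧ X ^ (k + 1) ≤ M ^ (k + 1) * √((X / M) ^ (k + 2)) := by
  have hr0 : 0 < X / M := by positivity
  have hr : X / M ≤ e := (div_le_iff₀ hM).2 h
  have he0 : 0 < e := hr0.trans_le hr
  constructor
  · apply Real.sqrt_le_iff.2 ⟨he0.le, ?_⟩
    calc (X / M) ^ (k + 2) ≤ e ^ (k + 2) := by gcongr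
      _ ≤ e ^ 2 := pow_le_pow_of_le_one he0.le he (by omega)
  · have : (X / M) ^ (k + 1) ≤ √((X / M) ^ (k + 2)) := by
      apply Real.le_sqrt_of_sq_le
      rw [← pow_mul]
      exact pow_le_pow_of_le_one hr0.le (hr.trans he) (by omega)
    rw [div_pow, div_le_iff₀ (by positivity)] at this
    linarith

theorem le_abs_sub_of_snd_far {k l : ℕ} {c e N h A B : ℝ} {p q : ℝ × ℝ} (hp1 : 0 < p.1)
    (hp2 : 0 < p.2) (hq1 : 0 < q.1) (hq2 : 0 < q.2) (hp : p.1 ≤ e * p.2) (hq : q.1 ≤ e * q.2)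
    (hN : 0 ≤ N) (heN : e * N * (4 * 2 ^ (k + l)) ≤ |c|) (h0 : 0 ≤ h)
    (hA : |p.2 * A - (k + 2 + l : ℝ) * c * p.2 ^ (k + 2 + l)| ≤ N * (p.1 ^ (k + 2) * p.2 ^ l))
    (hB : |q.2 * B - (k + 2 + l : ℝ) * c * q.2 ^ (k + 2 + l)| ≤ N * (q.1 ^ (k + 2) * q.2 ^ l))
    (hX : (p.1 + q.1) ^ (k + 1) ≤ (p.2 + q.2) ^ (k + 1) * h)
    (hfar : (p.2 + q.2) * h ≤ |p.2 - q.2|) :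
    |c| / 2 ^ (k + l) * ((p.2 + q.2) ^ (k + l + 1) * h) ≤ |A - B| := by
  have he : 0 < e := by
    by_contra hc
    nlinarith
  set G := (p.2 + q.2) ^ (k + l + 1) * h with hG
  have hG0 : 0 ≤ G := by positivity
  have err : ∀ {p' : ℝ × ℝ} {A : ℝ}, 0 < p'.1 → 0 < p'.2 → p'.1 ≤ e * p'.2 →
      p'.1 ≤ p.1 + q.1 → p'.2 ≤ p.2 + q.2 →
      |p'.2 * A - (k + 2 + l : ℝ) * c * p'.2 ^ (k + 2 + l)| ≤ N * (p'.1 ^ (k + 2) * p'.2 ^ l) →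
      |A - (k + 2 + l : ℝ) * c * p'.2 ^ (k + l + 1)| ≤ e * N * G := by
    intro p' A h1 h2 h3 h4 h5 h6
    have h7 : p'.2 * |A - (k + 2 + l : ℝ) * c * p'.2 ^ (k + l + 1)| ≤
        p'.2 * (N * (e * (p'.1 ^ (k + 1) * p'.2 ^ l))) := by
      nth_rw 1 [← abs_of_pos h2]
      rw [← abs_mul]
      calc _ = |p'.2 * A - (k + 2 + l : ℝ) * c * p'.2 ^ (k + 2 + l)| := by congr 1; ring
        _ ≤ N * (p'.1 ^ (k + 1) * p'.1 * p'.2 ^ l) := by rw [← pow_succ]; exact h6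
        _ ≤ N * (p'.1 ^ (k + 1) * (e * p'.2) * p'.2 ^ l) := by gcongr
        _ = _ := by ring
    refine (le_of_mul_le_mul_left h7 h2).trans ?_
    calc N * (e * (p'.1 ^ (k + 1) * p'.2 ^ l)) ≤
          N * (e * ((p.1 + q.1) ^ (k + 1) * (p.2 + q.2) ^ l)) := by gcongr
      _ ≤ N * (e * ((p.2 + q.2) ^ (k + 1) * h * (p.2 + q.2) ^ l)) := by gcongr
      _ = _ := by rw [hG]; ring
  have eA := err hp1 hp2 hp (by linarith) (by linarith) hA
  have eB := err hq1 hq2 hq (by linarith) (by linarith) hB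
  have main : 2 * (|c| / 2 ^ (k + l) * G) ≤
      |(k + 2 + l : ℝ) * c * (p.2 ^ (k + l + 1) - q.2 ^ (k + l + 1))| := by
    rw [abs_mul, abs_mul, abs_of_pos (by positivity : (0 : ℝ) < k + 2 + l)]
    calc 2 * (|c| / 2 ^ (k + l) * G) = 2 * |c| * ((p.2 + q.2) * h *
          ((p.2 + q.2) / 2) ^ (k + l)) := by rw [hG, div_pow]; field_simp; ring
      _ ≤ (k + 2 + l) * |c| * (|p.2 - q.2| * ((p.2 + q.2) / 2) ^ (k + l)) := by
        gcongr
        linarith [k.cast_nonneg (α := ℝ), l.cast_nonneg (α := ℝ)]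
      _ ≤ _ := by
        gcongr
        exact abs_sub_mul_pow_le hp2.le hq2.le _
  have small : e * N * G ≤ |c| / 2 ^ (k + l) * G / 4 := by
    rw [show |c| / 2 ^ (k + l) * G / 4 = |c| / (4 * 2 ^ (k + l)) * G by field_simp]
    gcongr
    rwa [le_div_iff₀ (by positivity)]
  have tri : |(k + 2 + l : ℝ) * c * (p.2 ^ (k + l + 1) - q.2 ^ (k + l + 1))| ≤
      |A - B| + |A - (k + 2 + l : ℝ) * c * p.2 ^ (k + l + 1)| +
        |B - (k + 2 + l : ℝ) * c * q.2 ^ (k + l + 1)| := by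
    calc _ = |(A - B) - (A - (k + 2 + l : ℝ) * c * p.2 ^ (k + l + 1)) +
          (B - (k + 2 + l : ℝ) * c * q.2 ^ (k + l + 1))| := by congr 1; ring
      _ ≤ _ := (abs_add_le _ _).trans (by gcongr; exact abs_sub _ _)
  have : 0 ≤ |c| / 2 ^ (k + l) * G := by positivity
  linarith

theorem le_abs_sub_of_fst_far {k l : ℕ} {a e η A B : ℝ} {p q : ℝ × ℝ} (hp1 : 0 < p.1)
    (hp2 : 0 < p.2) (hq1 : 0 < q.1) (hq2 : 0 < q.2) (hη : 0 < η) (he0 : 0 < e) (he : e ≤ 1 / 2)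
    (he1 : l * e ≤ η / (2 ^ k * 4 ^ l) / 4) (he2 : 2 * e ≤ |a| * (η / (2 ^ k * 4 ^ l)) / 4)
    (hA : |p.1 * A - (k + 2 : ℝ) * a * (p.1 ^ (k + 2) * p.2 ^ l)| ≤ e * (p.1 ^ (k + 2) * p.2 ^ l))
    (hB : |q.1 * B - (k + 2 : ℝ) * a * (q.1 ^ (k + 2) * q.2 ^ l)| ≤ e * (q.1 ^ (k + 2) * q.2 ^ l))
    (hnear : |p.2 - q.2| ≤ e * (p.2 + q.2)) (hfar : η * (p.1 + q.1) ≤ |p.1 - q.1|) :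
    |a| * (η / (2 ^ k * 4 ^ l)) / 2 * ((p.1 + q.1) ^ (k + 1) * (p.2 + q.2) ^ l) ≤ |A - B| := by
  set τ := η / (2 ^ k * 4 ^ l) with hτ
  have hτ0 : 0 < τ := by positivity
  set G := (p.1 + q.1) ^ (k + 1) * (p.2 + q.2) ^ l with hG
  have hG0 : 0 ≤ G := by positivity
  have err : ∀ {p' : ℝ × ℝ} {A : ℝ}, 0 < p'.1 → 0 < p'.2 →
      p'.1 ≤ p.1 + q.1 → p'.2 ≤ p.2 + q.2 →
      |p'.1 * A - (k + 2 : ℝ) * a * (p'.1 ^ (k + 2) * p'.2 ^ l)| ≤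
        e * (p'.1 ^ (k + 2) * p'.2 ^ l) →
      |A - (k + 2 : ℝ) * a * (p'.1 ^ (k + 1) * p'.2 ^ l)| ≤ e * G := by
    intro p' A h1 h2 h4 h5 h6
    have h7 : p'.1 * |A - (k + 2 : ℝ) * a * (p'.1 ^ (k + 1) * p'.2 ^ l)| ≤
        p'.1 * (e * (p'.1 ^ (k + 1) * p'.2 ^ l)) := by
      nth_rw 1 [← abs_of_pos h1]
      rw [← abs_mul]
      calc _ = |p'.1 * A - (k + 2 : ℝ) * a * (p'.1 ^ (k + 2) * p'.2 ^ l)| := by congr 1; ring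
        _ ≤ _ := h6
        _ = _ := by ring
    refine (le_of_mul_le_mul_left h7 h1).trans ?_
    rw [hG]
    gcongr
  have eA := err hp1 hp2 (by linarith) (by linarith) hA
  have eB := err hq1 hq2 (by linarith) (by linarith) hB
  have h1 : τ * G ≤ |p.1 ^ (k + 1) - q.1 ^ (k + 1)| * p.2 ^ l := by
    have hp2' : (p.2 + q.2) / 4 ≤ p.2 := by
      have := (abs_le.1 hnear).1
      nlinarith
    calc τ * G = η * (p.1 + q.1) * ((p.1 + q.1) / 2) ^ k * ((p.2 + q.2) / 4) ^ l := by
          rw [hτ, hG, div_pow, div_pow]; field_simp; ring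
      _ ≤ |p.1 - q.1| * ((p.1 + q.1) / 2) ^ k * p.2 ^ l := by gcongr
      _ ≤ _ := by
        gcongr
        exact abs_sub_mul_pow_le hp1.le hq1.le _
  have h2 : q.1 ^ (k + 1) * |p.2 ^ l - q.2 ^ l| ≤ τ / 4 * G := by
    have h3 : |p.2 ^ l - q.2 ^ l| ≤ l * e * (p.2 + q.2) ^ l := by
      rcases l with _ | l
      · simp
      refine (abs_pow_sub_pow_le _ _ _).trans ?_
      rw [Nat.add_sub_cancel, abs_of_pos hp2, abs_of_pos hq2]
      calc |p.2 - q.2| * ((l + 1 : ℕ) : ℝ) * max p.2 q.2 ^ l ≤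
            e * (p.2 + q.2) * ((l + 1 : ℕ) : ℝ) * (p.2 + q.2) ^ l := by
            gcongr
            exact max_le (by linarith) (by linarith)
        _ = _ := by ring
    calc q.1 ^ (k + 1) * |p.2 ^ l - q.2 ^ l| ≤
          (p.1 + q.1) ^ (k + 1) * (l * e * (p.2 + q.2) ^ l) := by
          gcongr
          linarith
      _ = l * e * G := by rw [hG]; ring
      _ ≤ _ := by gcongr
  have h4 : 3 / 4 * τ * G ≤ |p.1 ^ (k + 1) * p.2 ^ l - q.1 ^ (k + 1) * q.2 ^ l| := by
    have : |p.1 ^ (k + 1) - q.1 ^ (k + 1)| * p.2 ^ l ≤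
        |p.1 ^ (k + 1) * p.2 ^ l - q.1 ^ (k + 1) * q.2 ^ l| + q.1 ^ (k + 1) * |p.2 ^ l - q.2 ^ l| := by
      rw [← abs_of_pos (by positivity : 0 < p.2 ^ l), ← abs_mul,
        abs_of_pos (by positivity : 0 < p.2 ^ l)]
      nth_rw 3 [← abs_of_pos (by positivity : 0 < q.1 ^ (k + 1))]
      rw [← abs_mul]
      calc _ = |(p.1 ^ (k + 1) * p.2 ^ l - q.1 ^ (k + 1) * q.2 ^ l) -
            q.1 ^ (k + 1) * (p.2 ^ l - q.2 ^ l)| := by congr 1; ring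
        _ ≤ _ := abs_sub _ _
    linarith
  have h5 : |a| * (3 / 4 * τ * G) ≤
      |(k + 2 : ℝ) * a * (p.1 ^ (k + 1) * p.2 ^ l - q.1 ^ (k + 1) * q.2 ^ l)| := by
    rw [abs_mul, abs_mul, abs_of_pos (by positivity : (0 : ℝ) < k + 2)]
    gcongr
    nlinarith [abs_nonneg a, k.cast_nonneg (α := ℝ), mul_nonneg (k.cast_nonneg (α := ℝ)) (abs_nonneg a)]
  have tri : |(k + 2 : ℝ) * a * (p.1 ^ (k + 1) * p.2 ^ l - q.1 ^ (k + 1) * q.2 ^ l)| ≤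
      |A - B| + |A - (k + 2 : ℝ) * a * (p.1 ^ (k + 1) * p.2 ^ l)| +
        |B - (k + 2 : ℝ) * a * (q.1 ^ (k + 1) * q.2 ^ l)| := by
    calc _ = |(A - B) - (A - (k + 2 : ℝ) * a * (p.1 ^ (k + 1) * p.2 ^ l)) +
          (B - (k + 2 : ℝ) * a * (q.1 ^ (k + 1) * q.2 ^ l))| := by congr 1; ring
      _ ≤ _ := (abs_add_le _ _).trans (by gcongr; exact abs_sub _ _)
  have h6 : 2 * e * G ≤ |a| * τ / 4 * G := by gcongr
  linarith

theorem damping_sq_mul_le_of_le {k l : ℕ} {ω : ℝ × ℝ → ℝ} {p q : ℝ × ℝ} {Q X M c G w Δ : ℝ}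
    (hp : |hessDet ω p| ≤ Q * (X ^ k * M ^ (k + 2 * l)))
    (hq : |hessDet ω q| ≤ Q * (X ^ k * M ^ (k + 2 * l))) (hQ : 0 ≤ Q) (hX : 0 ≤ X) (hM : 0 ≤ M)
    (hw : 0 < w) (hc : 0 < c) (hG0 : 0 ≤ G) (hG : (X ^ k * M ^ (k + 2 * l)) ^ 2 * w ^ 4 ≤ G ^ 4)
    (hΔ : c * G ≤ Δ) :
    damping ω p ^ 2 * damping ω q ^ 2 ≤ ENNReal.ofReal Δ * ENNReal.ofReal (√Q / c / w) := by
  have hΔ0 : 0 ≤ Δ := le_trans (by positivity) hΔ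
  refine damping_sq_mul_le hw (by positivity) hΔ0 ?_
  calc |hessDet ω p| * |hessDet ω q| * w ^ 4 ≤
        (Q * (X ^ k * M ^ (k + 2 * l))) * (Q * (X ^ k * M ^ (k + 2 * l))) * w ^ 4 := by gcongr
    _ = (√Q ^ 2) ^ 2 * ((X ^ k * M ^ (k + 2 * l)) ^ 2 * w ^ 4) := by
      rw [Real.sq_sqrt hQ]; ring
    _ ≤ (√Q ^ 2) ^ 2 * G ^ 4 := by gcongr
    _ = (√Q / c * (c * G)) ^ 4 := by field_simp
    _ ≤ _ := by gcongr

theorem lintegral_indicator_Ioo_const (x y : ℝ) {C : ℝ} (hC : 0 ≤ C) :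
    ∫⁻ s, (Set.Ioo x y).indicator (fun _ => ENNReal.ofReal (C / (y - x))) s ≤
      ENNReal.ofReal C := by
  rw [lintegral_indicator measurableSet_Ioo, setLIntegral_const, Real.volume_Ioo]
  rcases le_or_gt y x with h | h
  · rw [ENNReal.ofReal_of_nonpos (p := y - x) (by linarith), mul_zero]
    exact zero_le
  · rw [← ENNReal.ofReal_mul (div_nonneg hC (by linarith)), div_mul_cancel₀ _ (by linarith)]

theorem sqrt_ratio_pow_four {X M : ℝ} (hX : 0 < X) (hM : 0 < M) (k : ℕ) :
    M ^ (2 * k + 4) * √((X / M) ^ (k + 2)) ^ 4 = X ^ (2 * k + 4) := by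
  rw [show √((X / M) ^ (k + 2)) ^ 4 = (√((X / M) ^ (k + 2)) ^ 2) ^ 2 by ring,
    Real.sq_sqrt (by positivity), ← pow_mul, div_pow]
  field_simp
  ring

theorem pow_mul_pow_le_of_le_mul {x y e : ℝ} (hx : 0 < x) (hy : 0 < y) (he0 : 0 < e) (he : e ≤ 1)
    (h : x ≤ e * y) (k l : ℕ) : x ^ (k + 2) * y ^ l ≤ e * y ^ (k + 2 + l) := by
  calc x ^ (k + 2) * y ^ l ≤ (e * y) ^ (k + 2) * y ^ l := by gcongr
    _ = e ^ (k + 2) * y ^ (k + 2 + l) := by ring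
    _ ≤ e ^ 1 * y ^ (k + 2 + l) := by
      gcongr ?_ * _
      exact pow_le_pow_of_le_one he0.le he (by omega)
    _ = _ := by rw [pow_one]

set_option maxHeartbeats 2000000 in
theorem posBound_binomial (k l : ℕ) {a c : ℝ} (ha : a ≠ 0) (hc : c ≠ 0) :
    ∃ e > 0, ∀ (n : ℕ) (ω : ℝ × ℝ → ℝ) (S : Set (ℝ × ℝ)), PolySlices n ω → SmoothFun ω →
      MeasurableSet S → Convex ℝ S → NearBinomial (k + 2) l a c e ω S →
      PosBound ω (damping ω) S := by
  set m₁ : ℝ := (k + 2) * (k + 1) * a with hm₁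
  set m₃ : ℝ := (k + 2 + l) * (k + 1 + l) * c with hm₃
  have hm₁0 : m₁ ≠ 0 := by rw [hm₁]; positivity
  have hm₃0 : m₃ ≠ 0 := by rw [hm₃]; positivity
  have hdet : m₁ * m₃ - (0 : ℝ) ^ 2 ≠ 0 := by
    rw [zero_pow two_ne_zero, sub_zero]
    exact mul_ne_zero hm₁0 hm₃0
  obtain ⟨δ, hδ, hm⟩ := exists_nondegeneracy_constant hdet
  set M := |m₁| + |m₃| with hM
  have b1 : |m₁| ≤ M := by rw [hM]; linarith [abs_nonneg m₃]
  have b3 : |m₃| ≤ M := by rw [hM]; linarith [abs_nonneg m₁]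
  have hM0 : 0 ≤ M := (abs_nonneg _).trans b1
  have hδ₁ : 0 < min 1 (δ / (2 * (M + 1))) := by positivity
  obtain ⟨θ₁, hθ₁, φ₁⟩ := exists_ratio_close
    (φ := fun z => (z.1 ^ 2)⁻¹ * (z.1 ^ (k + 2) * z.2 ^ l))
    (by fun_prop (disch := simp)) (by simp) hδ₁
  obtain ⟨θ₂, hθ₂, φ₂⟩ := exists_ratio_close
    (φ := fun z => (z.1 * z.2)⁻¹ * (z.1 ^ (k + 2) * z.2 ^ l))
    (by fun_prop (disch := simp)) (by simp) one_pos
  obtain ⟨θ₃, hθ₃, φ₃⟩ := exists_ratio_close (φ := fun z => z.2 ^ (k + l))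
    (by fun_prop) (by simp) hδ₁
  obtain ⟨θ₄, hθ₄, φ₄⟩ := exists_ratio_close (φ := fun z => z.2 * √((z.1 / z.2) ^ (k + 2)))
    (by fun_prop (disch := simp)) (by simp) one_pos
  set θ := min 1 (min θ₁ (min θ₂ (min θ₃ θ₄))) with hθ
  have hθ0 : 0 < θ := by positivity
  have t1 : θ ≤ 1 := min_le_left _ _
  have t2 : θ ≤ θ₁ := (min_le_right _ _).trans (min_le_left _ _)
  have t3 : θ ≤ θ₂ := (min_le_right _ _).trans ((min_le_right _ _).trans (min_le_left _ _))
  have t4 : θ ≤ θ₃ := (min_le_right _ _).trans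
    ((min_le_right _ _).trans ((min_le_right _ _).trans (min_le_left _ _)))
  have t5 : θ ≤ θ₄ := (min_le_right _ _).trans
    ((min_le_right _ _).trans ((min_le_right _ _).trans (min_le_right _ _)))
  set η := θ / 4 with hη
  have hη0 : 0 < η := by positivity
  set τ := η / (2 ^ k * 4 ^ l) with hτ
  have hτ0 : 0 < τ := by positivity
  have ha0 : 0 < |a| := abs_pos.2 ha
  have hc0 : 0 < |c| := abs_pos.2 hc
  set N : ℝ := l * |a| + 1 with hN
  set N₂ : ℝ := |(k + 2) * l * a| + 1 with hN₂
  set N₃ : ℝ := |l * (l - 1) * a| + 1 with hN₃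
  set R := min (1 / 2) (min η (min |c| (min (τ / 4) (min (|a| * τ / 4) (δ / 4))))) with hR
  have hR0 : 0 < R := by positivity
  have r1 : R ≤ 1 / 2 := min_le_left _ _
  have r2 : R ≤ η := (min_le_right _ _).trans (min_le_left _ _)
  have r3 : R ≤ |c| := (min_le_right _ _).trans ((min_le_right _ _).trans (min_le_left _ _))
  have r4 : R ≤ τ / 4 := (min_le_right _ _).trans
    ((min_le_right _ _).trans ((min_le_right _ _).trans (min_le_left _ _)))
  have r5 : R ≤ |a| * τ / 4 := (min_le_right _ _).trans ((min_le_right _ _).trans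
    ((min_le_right _ _).trans ((min_le_right _ _).trans (min_le_left _ _))))
  have r6 : R ≤ δ / 4 := (min_le_right _ _).trans ((min_le_right _ _).trans
    ((min_le_right _ _).trans ((min_le_right _ _).trans (min_le_right _ _))))
  set B := 2 + N * (4 * 2 ^ (k + l)) + l + 2 * N₂ + N₃ with hB
  have hN0 : 0 < N := by positivity
  have hN₂0 : 0 < N₂ := by positivity
  have hN₃0 : 0 < N₃ := by positivity
  have hB0 : 0 < B := by positivity
  refine ⟨R / B, by positivity, ?_⟩
  intro n ω S hs hω hSm hSc nb
  set e := R / B with he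
  have hepos : 0 < e := by positivity
  have heR : ∀ x, x ≤ B → e * x ≤ R := fun x hx => by
    calc e * x ≤ e * B := by gcongr
      _ = R := by rw [he]; field_simp
  have q0 : 0 ≤ N * (4 * 2 ^ (k + l)) := by positivity
  have q1 : 0 ≤ (l : ℝ) := by positivity
  have e1 := heR 1 (by linarith)
  have e2 := heR 2 (by linarith)
  have e3 := heR (N * (4 * 2 ^ (k + l))) (by linarith)
  have e4 := heR l (by linarith)
  have e5 := heR (2 * N₂) (by linarith)
  have e6 := heR N₃ (by linarith)
  rw [mul_one] at e1
  have xx : ∀ p ∈ S, |p.1 ^ 2 * pdx (pdx ω) p - m₁ * (p.1 ^ (k + 2) * p.2 ^ l)| ≤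
      e * (p.1 ^ (k + 2) * p.2 ^ l) := fun p hp => by
    have := nb.xx p hp
    push_cast at this
    rw [hm₁]
    convert this using 4
    ring
  have xy : ∀ p ∈ S, |p.1 * p.2 * pdx (pdy ω) p| ≤ N₂ * (p.1 ^ (k + 2) * p.2 ^ l) := fun p hp => by
    obtain ⟨hp1, hp2⟩ := nb.pos p hp
    have := nb.xy p hp
    push_cast at this
    refine (abs_le_of_abs_sub_le (by positivity) this).trans ?_
    gcongr
    linarith
  have yy : ∀ p ∈ S, |p.2 ^ 2 * pdy (pdy ω) p - m₃ * p.2 ^ (k + 2 + l)| ≤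
      N₃ * (p.1 ^ (k + 2) * p.2 ^ l) := fun p hp => by
    obtain ⟨hp1, hp2⟩ := nb.pos p hp
    have := nb.yy p hp
    push_cast at this
    rw [sub_right_comm] at this
    refine le_trans (le_of_eq ?_) ((abs_le_of_abs_sub_le (by positivity) this).trans ?_)
    · rw [hm₃]
      congr 2
      ring
    · gcongr
      linarith
  have dx : ∀ p ∈ S, |p.1 * pdx ω p - (k + 2 : ℝ) * a * (p.1 ^ (k + 2) * p.2 ^ l)| ≤
      e * (p.1 ^ (k + 2) * p.2 ^ l) := fun p hp => by
    have := nb.x p hp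
    push_cast at this
    exact this
  have dy : ∀ p ∈ S, |p.2 * pdy ω p - (k + 2 + l : ℝ) * c * p.2 ^ (k + 2 + l)| ≤
      N * (p.1 ^ (k + 2) * p.2 ^ l) := fun p hp => by
    obtain ⟨hp1, hp2⟩ := nb.pos p hp
    have := nb.y p hp
    push_cast at this
    rw [sub_right_comm] at this
    refine (abs_le_of_abs_sub_le (by positivity) this).trans ?_
    rw [abs_mul, abs_of_nonneg q1]
    gcongr
    linarith
  have he1 : e ≤ 1 := by linarith
  have hu : ∀ p ∈ S, p.1 ^ (k + 2) * p.2 ^ l ≤ e * p.2 ^ (k + 2 + l) := fun p hp =>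
    pow_mul_pow_le_of_le_mul (nb.pos p hp).1 (nb.pos p hp).2 hepos he1 (nb.le p hp) k l
  set Q : ℝ := (|m₁| + e) * (|m₃| + N₃) + N₂ ^ 2 with hQ
  have hQ0 : 0 ≤ Q := by positivity
  have hK : ∀ p ∈ S, |hessDet ω p| ≤ Q * (p.1 ^ k * p.2 ^ (k + 2 * l)) := by
    intro p hp
    obtain ⟨hp1, hp2⟩ := nb.pos p hp
    have hu' := hu p hp
    have c1 := abs_le_of_abs_sub_le (by positivity) (xx p hp)
    have hle : p.1 ^ (k + 2) * p.2 ^ l ≤ p.2 ^ (k + 2 + l) :=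
      hu'.trans (mul_le_of_le_one_left (by positivity) he1)
    have c3 : |p.2 ^ 2 * pdy (pdy ω) p| ≤ (|m₃| + N₃) * p.2 ^ (k + 2 + l) :=
      abs_le_of_abs_sub_le (by positivity) ((yy p hp).trans (by gcongr))
    refine le_of_mul_le_mul_left ((hessDet_le_of_le hp1 hp2 c1 (xy p hp) c3).trans ?_)
      (by positivity : 0 < (p.1 * p.2) ^ 2)
    calc (|m₁| + e) * (p.1 ^ (k + 2) * p.2 ^ l) * ((|m₃| + N₃) * p.2 ^ (k + 2 + l)) +
          (N₂ * (p.1 ^ (k + 2) * p.2 ^ l)) ^ 2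
        = (|m₁| + e) * (p.1 ^ (k + 2) * p.2 ^ l) * ((|m₃| + N₃) * p.2 ^ (k + 2 + l)) +
          N₂ ^ 2 * ((p.1 ^ (k + 2) * p.2 ^ l) * (p.1 ^ (k + 2) * p.2 ^ l)) := by ring
      _ ≤ (|m₁| + e) * (p.1 ^ (k + 2) * p.2 ^ l) * ((|m₃| + N₃) * p.2 ^ (k + 2 + l)) +
          N₂ ^ 2 * ((p.1 ^ (k + 2) * p.2 ^ l) * p.2 ^ (k + 2 + l)) := by gcongr
      _ = _ := by rw [hQ]; ring
  have hKP : ∀ p ∈ S, ∀ q : ℝ × ℝ, 0 < q.1 → 0 < q.2 →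
      |hessDet ω p| ≤ Q * ((p + q).1 ^ k * (p + q).2 ^ (k + 2 * l)) := by
    intro p hp q hq1 hq2
    obtain ⟨hp1, hp2⟩ := nb.pos p hp
    refine (hK p hp).trans ?_
    rw [Prod.fst_add, Prod.snd_add]
    gcongr <;> linarith
  set h : ℝ × ℝ → ℝ := fun p => √((p.1 / p.2) ^ (k + 2)) with hh
  have hhm : Measurable h := by fun_prop
  have hsqrt : ∀ p : ℝ × ℝ, 0 < p.1 → 0 < p.2 → p.1 ≤ e * p.2 →
      0 < h p ∧ h p ≤ e ∧ p.1 ^ (k + 1) ≤ p.2 ^ (k + 1) * h p ∧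
        p.2 ^ (2 * k + 4) * h p ^ 4 = p.1 ^ (2 * k + 4) := fun p h1 h2 h3 =>
    ⟨Real.sqrt_pos.2 (by positivity), (sqrt_ratio_pow h1 h2 he1 h3 k).1,
      (sqrt_ratio_pow h1 h2 he1 h3 k).2, sqrt_ratio_pow_four h1 h2 k⟩
  set c₂ := |c| / 2 ^ (k + l) with hc₂
  set c₁ := |a| * τ / 2 with hc₁
  have hc₁0 : 0 < c₁ := by positivity
  have hc₂0 : 0 < c₂ := by positivity
  refine posBound_of_normal_form (a := fun p => p.1) (b := fun p => p.2 * h p)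
    (D := fun p => p.1 ^ (k + 2) * p.2 ^ l) (m₂ := 0) (C₁ := Real.toNNReal (√Q / c₁))
    (C₂ := Real.toNNReal (√Q / c₂)) hs hω hSm hSc nb.pos measurable_fst (by fun_prop)
    (fun p hp => (nb.pos p hp).1) ?_ ?_ hδ hm
    (η := η) (θ := θ) (by positivity) (by linarith) (by linarith) ?_ ?_
    (O₁ := {z | z.1 ∈ S ∧ z.2 ∈ S ∧ |z.1.2 - z.2.2| < (z.1 + z.2).2 * h (z.1 + z.2) ∧
      η * (z.1.1 + z.2.1) < |z.1.1 - z.2.1|})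
    (O₂ := {z | z.1 ∈ S ∧ z.2 ∈ S ∧ (z.1 + z.2).2 * h (z.1 + z.2) ≤ |z.1.2 - z.2.2|})
    ?_ ?_ ?_ ?_ ?_
  · intro p hp
    obtain ⟨hp1, hp2⟩ := nb.pos p hp
    have := (hsqrt p hp1 hp2 (nb.le p hp)).1
    positivity
  · intro p hp
    obtain ⟨hp1, hp2⟩ := nb.pos p hp
    positivity
  · rintro p hp q ⟨hq, h1, h2⟩
    obtain ⟨hp1, hp2⟩ := nb.pos p hp
    obtain ⟨hq1, hq2⟩ := nb.pos q hq
    have r1 := abs_div_sub_one_le hp1 h1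
    have r2 := abs_div_sub_one_le hp2 h2
    refine ⟨by nlinarith [(abs_le.1 h1).2], ?_⟩
    have h3 := (abs_le.1 (φ₄ _ _ (r1.trans t5) (r2.trans t5))).2
    have h4 : q.2 * h q = (q.2 / p.2 * √((q.1 / p.1 / (q.2 / p.2)) ^ (k + 2))) * (p.2 * h p) := by
      rw [hh]
      dsimp only
      have : (q.1 / q.2) ^ (k + 2) =
          (q.1 / p.1 / (q.2 / p.2)) ^ (k + 2) * (p.1 / p.2) ^ (k + 2) := by
        rw [← mul_pow]
        congr 1
        field_simp
      rw [this, Real.sqrt_mul (by positivity)]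
      field_simp
    have h5 := (hsqrt p hp1 hp2 (nb.le p hp)).1
    dsimp only at h3
    rw [h4]
    gcongr
    linarith
  · rintro p hp q ⟨hq, h1, h2⟩
    obtain ⟨hp1, hp2⟩ := nb.pos p hp
    obtain ⟨hq1, hq2⟩ := nb.pos q hq
    have r1 := abs_div_sub_one_le hp1 h1
    have r2 := abs_div_sub_one_le hp2 h2
    have u0 : 0 ≤ p.1 ^ (k + 2) * p.2 ^ l := by positivity
    obtain ⟨hp0, hpe, -, -⟩ := hsqrt p hp1 hp2 (nb.le p hp)
    refine ⟨?_, ?_, ?_⟩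
    · have := abs_mul_sub_le (t := p.1 ^ 2 / q.1 ^ 2) (xx q hq) hepos.le u0 (by positivity)
        (by simp only [div_pow]; field_simp) (φ₁ _ _ (r1.trans t2) (r2.trans t2))
      rw [show p.1 ^ 2 / q.1 ^ 2 * (q.1 ^ 2 * pdx (pdx ω) q) = p.1 ^ 2 * pdx (pdx ω) q by
        field_simp] at this
      exact this.trans (by gcongr; exact error_le hδ b1 hepos.le (e1.trans r6))
    · have h3 := (abs_le.1 (φ₂ _ _ (r1.trans t3) (r2.trans t3))).2
      dsimp only at h3
      set φ := (q.1 / p.1 * (q.2 / p.2))⁻¹ * ((q.1 / p.1) ^ (k + 2) * (q.2 / p.2) ^ l) with hφ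
      have h4 : p.1 * p.2 / (q.1 * q.2) * (q.1 ^ (k + 2) * q.2 ^ l) =
          φ * (p.1 ^ (k + 2) * p.2 ^ l) := by
        rw [hφ]
        simp only [div_pow]
        field_simp
      rw [zero_mul, sub_zero]
      calc |p.1 * (p.2 * h p) * pdx (pdy ω) q|
          = |h p * (p.1 * p.2 / (q.1 * q.2)) * (q.1 * q.2 * pdx (pdy ω) q)| := by
            congr 1; field_simp
        _ = h p * (p.1 * p.2 / (q.1 * q.2)) * |q.1 * q.2 * pdx (pdy ω) q| := by
            rw [abs_mul, abs_of_pos (by positivity)]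
        _ ≤ h p * (p.1 * p.2 / (q.1 * q.2)) * (N₂ * (q.1 ^ (k + 2) * q.2 ^ l)) := by
            gcongr
            exact xy q hq
        _ = h p * N₂ * (p.1 * p.2 / (q.1 * q.2) * (q.1 ^ (k + 2) * q.2 ^ l)) := by ring
        _ = h p * N₂ * φ * (p.1 ^ (k + 2) * p.2 ^ l) := by rw [h4]; ring
        _ ≤ e * N₂ * 2 * (p.1 ^ (k + 2) * p.2 ^ l) := by
            gcongr
            linarith
        _ ≤ δ * (p.1 ^ (k + 2) * p.2 ^ l) := by
            gcongr
            linarith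
    · have hyy : |q.2 ^ 2 * pdy (pdy ω) q - m₃ * q.2 ^ (k + 2 + l)| ≤
          e * N₃ * q.2 ^ (k + 2 + l) := (yy q hq).trans (by
        calc _ ≤ N₃ * (e * q.2 ^ (k + 2 + l)) := mul_le_mul_of_nonneg_left (hu q hq) hN₃0.le
          _ = _ := by ring)
      have hsq : h p ^ 2 = (p.1 / p.2) ^ (k + 2) := Real.sq_sqrt (by positivity)
      have := abs_mul_sub_le (t := (p.2 * h p) ^ 2 / q.2 ^ 2) hyy (by positivity) u0
        (by positivity) (by rw [mul_pow, hsq]; simp only [div_pow]; field_simp; ring)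
        (φ₃ (q.1 / p.1) _ (r1.trans t4) (r2.trans t4))
      rw [show (p.2 * h p) ^ 2 / q.2 ^ 2 * (q.2 ^ 2 * pdy (pdy ω) q) =
        (p.2 * h p) ^ 2 * pdy (pdy ω) q by field_simp] at this
      exact this.trans (by gcongr; exact error_le hδ b3 (by positivity) (e6.trans r6))
  · have h1 : MeasurableSet {z : (ℝ × ℝ) × (ℝ × ℝ) |
        |z.1.2 - z.2.2| < (z.1 + z.2).2 * h (z.1 + z.2)} :=
      measurableSet_lt (by fun_prop) (by fun_prop)
    have h2 : MeasurableSet {z : (ℝ × ℝ) × (ℝ × ℝ) | η * (z.1.1 + z.2.1) < |z.1.1 - z.2.1|} :=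
      measurableSet_lt (by fun_prop) (by fun_prop)
    exact (measurable_fst hSm).inter ((measurable_snd hSm).inter (h1.inter h2))
  · have h1 : MeasurableSet {z : (ℝ × ℝ) × (ℝ × ℝ) |
        (z.1 + z.2).2 * h (z.1 + z.2) ≤ |z.1.2 - z.2.2|} :=
      measurableSet_le (by fun_prop) (by fun_prop)
    exact (measurable_fst hSm).inter ((measurable_snd hSm).inter h1)
  · intro p hp q hq
    by_contra! hc
    obtain ⟨hc1, hc2, hc3⟩ := hc
    obtain ⟨hp1, hp2⟩ := nb.pos p hp
    obtain ⟨hq1, hq2⟩ := nb.pos q hq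
    have h1 : |p.2 - q.2| < (p + q).2 * h (p + q) := not_le.1 fun h => hc2 ⟨hp, hq, h⟩
    have h2 : |p.1 - q.1| ≤ η * (p.1 + q.1) := not_lt.1 fun h => hc1 ⟨hp, hq, h1, h⟩
    refine hc3 ⟨h2, h1.le.trans ?_⟩
    have h3 := (hsqrt (p + q) (add_pos hp1 hq1) (add_pos hp2 hq2) (by
      rw [Prod.fst_add, Prod.snd_add]
      linarith [nb.le p hp, nb.le q hq])).2.1
    rw [Prod.snd_add, mul_comm]
    dsimp only
    gcongr
    linarith
  · intro P
    refine ⟨_, ?_, lintegral_indicator_Ioo_const ((P.2 - P.2 * h P) / 2) ((P.2 + P.2 * h P) / 2)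
      (by positivity : 0 ≤ √Q / c₁), ?_⟩
    · exact Measurable.indicator (by fun_prop) measurableSet_Ioo
    · rintro p ⟨hp, hq, h1, h2⟩
      obtain ⟨q, rfl⟩ : ∃ q, P = p + q := ⟨P - p, by abel⟩
      rw [add_sub_cancel_left] at hq h1 h2 ⊢
      dsimp only at hp hq h1 h2
      obtain ⟨hp1, hp2⟩ := nb.pos p hp
      obtain ⟨hq1, hq2⟩ := nb.pos q hq
      obtain ⟨s1, s2, s3, s4⟩ := hsqrt (p + q) (add_pos hp1 hq1) (add_pos hp2 hq2) (by
        rw [Prod.fst_add, Prod.snd_add]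
        linarith [nb.le p hp, nb.le q hq])
      have a1 := abs_lt.1 h1
      rw [Set.indicator_of_mem]
      swap
      · rw [Prod.snd_add] at a1 ⊢
        constructor <;> linarith [a1.1, a1.2]
      rw [show ((p + q).2 + (p + q).2 * h (p + q)) / 2 - ((p + q).2 - (p + q).2 * h (p + q)) / 2 =
        (p + q).2 * h (p + q) by ring]
      have hP1 : 0 < (p + q).1 := add_pos hp1 hq1
      have hP2 : 0 < (p + q).2 := add_pos hp2 hq2
      refine damping_sq_mul_le_of_le (hKP p hp q hq1 hq2) (add_comm q p ▸ hKP q hq p hp1 hp2) hQ0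
        hP1.le hP2.le (by positivity) hc₁0
        (G := (p + q).1 ^ (k + 1) * (p + q).2 ^ l) (by positivity) (le_of_eq ?_)
        (le_abs_sub_of_fst_far hp1 hp2 hq1 hq2 hη0 hepos (by linarith) ?_ ?_ (dx p hp) (dx q hq)
          ?_ h2.le)
      · refine mul_left_cancel₀ (by positivity : (p + q).2 ^ (2 * k) ≠ 0) ?_
        calc _ = (p + q).1 ^ (2 * k) * (p + q).2 ^ (2 * k + 4 * l) *
              ((p + q).2 ^ (2 * k + 4) * h (p + q) ^ 4) := by ring
          _ = _ := by rw [s4]; ring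
      · linarith
      · linarith
      · refine h1.le.trans ?_
        rw [mul_comm, Prod.snd_add] at *
        gcongr
  · intro P
    refine ⟨_, ?_, lintegral_indicator_Ioo_const 0 P.1
      (by positivity : 0 ≤ √Q / c₂), ?_⟩
    · exact Measurable.indicator (by fun_prop) measurableSet_Ioo
    · rintro p ⟨hp, hq, h1⟩
      obtain ⟨q, rfl⟩ : ∃ q, P = p + q := ⟨P - p, by abel⟩
      rw [add_sub_cancel_left] at hq h1 ⊢
      dsimp only at hp hq h1
      obtain ⟨hp1, hp2⟩ := nb.pos p hp
      obtain ⟨hq1, hq2⟩ := nb.pos q hq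
      obtain ⟨s1, s2, s3, s4⟩ := hsqrt (p + q) (add_pos hp1 hq1) (add_pos hp2 hq2) (by
        rw [Prod.fst_add, Prod.snd_add]
        linarith [nb.le p hp, nb.le q hq])
      rw [Set.indicator_of_mem (show p.1 ∈ Set.Ioo 0 (p + q).1 from
        ⟨hp1, by rw [Prod.fst_add]; linarith⟩), sub_zero]
      have hP1 : 0 < (p + q).1 := add_pos hp1 hq1
      have hP2 : 0 < (p + q).2 := add_pos hp2 hq2
      refine damping_sq_mul_le_of_le (hKP p hp q hq1 hq2) (add_comm q p ▸ hKP q hq p hp1 hp2) hQ0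
        hP1.le hP2.le hP1 hc₂0
        (G := (p + q).2 ^ (k + l + 1) * h (p + q)) (by positivity) (le_of_eq ?_)
        (le_abs_sub_of_snd_far hp1 hp2 hq1 hq2 (nb.le p hp) (nb.le q hq) hN0.le ?_ s1.le
          (dy p hp) (dy q hq) s3 h1)
      · calc _ = (p + q).1 ^ (2 * k + 4) * (p + q).2 ^ (2 * k + 4 * l) := by ring
          _ = _ := by rw [← s4]; ring
      · linarith

section

variable {ω : ℝ × ℝ → ℝ}

theorem pdx_comp_linear {f : ℝ × ℝ → ℝ} (hf : SmoothFun f) (L : (ℝ × ℝ) →L[ℝ] ℝ × ℝ) :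
    pdx (fun p => f (L p)) =
      fun p => (L (1, 0)).1 * pdx f (L p) + (L (1, 0)).2 * pdy f (L p) := by
  funext p
  have h1 := hf.differentiable (by simp) (L p)
  have h2 : HasFDerivAt (fun p => f (L p)) ((fderiv ℝ f (L p)).comp L) p :=
    h1.hasFDerivAt.comp p L.hasFDerivAt
  rw [pdx_eq_fderiv h2.differentiableAt, h2.fderiv, ContinuousLinearMap.comp_apply,
    fderiv_apply_eq h1]
  ring

theorem pdy_comp_linear {f : ℝ × ℝ → ℝ} (hf : SmoothFun f) (L : (ℝ × ℝ) →L[ℝ] ℝ × ℝ) :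
    pdy (fun p => f (L p)) =
      fun p => (L (0, 1)).1 * pdx f (L p) + (L (0, 1)).2 * pdy f (L p) := by
  funext p
  have h1 := hf.differentiable (by simp) (L p)
  have h2 : HasFDerivAt (fun p => f (L p)) ((fderiv ℝ f (L p)).comp L) p :=
    h1.hasFDerivAt.comp p L.hasFDerivAt
  rw [pdy_eq_fderiv h2.differentiableAt, h2.fderiv, ContinuousLinearMap.comp_apply,
    fderiv_apply_eq h1]
  ring

theorem pdx_const_mul_add {f g : ℝ × ℝ → ℝ} (hf : SmoothFun f) (hg : SmoothFun g) (a b : ℝ)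
    (p : ℝ × ℝ) : pdx (fun p => a * f p + b * g p) p = a * pdx f p + b * pdx g p := by
  have h1 := hf.differentiable (by simp) p
  have h2 := hg.differentiable (by simp) p
  have h3 : HasFDerivAt (fun p => a * f p + b * g p) (a • fderiv ℝ f p + b • fderiv ℝ g p) p :=
    (h1.hasFDerivAt.const_mul a).add (h2.hasFDerivAt.const_mul b)
  rw [pdx_eq_fderiv h1, pdx_eq_fderiv h2, pdx_eq_fderiv h3.differentiableAt, h3.fderiv]
  simp

theorem pdy_const_mul_add {f g : ℝ × ℝ → ℝ} (hf : SmoothFun f) (hg : SmoothFun g) (a b : ℝ)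
    (p : ℝ × ℝ) : pdy (fun p => a * f p + b * g p) p = a * pdy f p + b * pdy g p := by
  have h1 := hf.differentiable (by simp) p
  have h2 := hg.differentiable (by simp) p
  have h3 : HasFDerivAt (fun p => a * f p + b * g p) (a • fderiv ℝ f p + b • fderiv ℝ g p) p :=
    (h1.hasFDerivAt.const_mul a).add (h2.hasFDerivAt.const_mul b)
  rw [pdy_eq_fderiv h1, pdy_eq_fderiv h2, pdy_eq_fderiv h3.differentiableAt, h3.fderiv]
  simp

theorem hessDet_comp_linear (hω : SmoothFun ω) (L : (ℝ × ℝ) →L[ℝ] ℝ × ℝ) (p : ℝ × ℝ) :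
    hessDet (fun p => ω (L p)) p =
      ((L (1, 0)).1 * (L (0, 1)).2 - (L (1, 0)).2 * (L (0, 1)).1) ^ 2 * hessDet ω (L p) := by
  have hx := contDiff_pdx hω
  have hy := contDiff_pdy hω
  have hxL : SmoothFun fun p => pdx ω (L p) := hx.comp L.contDiff
  have hyL : SmoothFun fun p => pdy ω (L p) := hy.comp L.contDiff
  unfold hessDet
  rw [pdx_comp_linear hω, pdy_comp_linear hω, pdx_const_mul_add hxL hyL, pdx_const_mul_add hxL hyL,
    pdy_const_mul_add hxL hyL, pdx_comp_linear hx, pdx_comp_linear hy, pdy_comp_linear hx,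
    pdy_comp_linear hy]
  dsimp only
  rw [pdy_pdx hω]
  ring

theorem exists_lintegral_comp_linear (L : (ℝ × ℝ) ≃L[ℝ] ℝ × ℝ) :
    ∃ c : ℝ≥0, c ≠ 0 ∧ ∀ f : ℝ × ℝ → ℝ≥0∞, ∫⁻ p, f (L p) = c * ∫⁻ p, f p := by
  have hdet : LinearMap.det (L : (ℝ × ℝ) →ₗ[ℝ] ℝ × ℝ) ≠ 0 :=
    (LinearEquiv.isUnit_det' L.toLinearEquiv).ne_zero
  refine ⟨Real.toNNReal |(LinearMap.det (L : (ℝ × ℝ) →ₗ[ℝ] ℝ × ℝ))⁻¹|, ?_, fun f => ?_⟩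
  · have : 0 < |(LinearMap.det (L : (ℝ × ℝ) →ₗ[ℝ] ℝ × ℝ))⁻¹| := abs_pos.2 (inv_ne_zero hdet)
    simpa using hdet
  · have h := Measure.map_linearMap_addHaar_eq_smul_addHaar (volume : Measure (ℝ × ℝ)) hdet
    have h2 : ∫⁻ p, f p ∂(Measure.map L volume) = ∫⁻ p, f (L p) :=
      lintegral_map_equiv f L.toHomeomorph.toMeasurableEquiv
    rw [← h2]
    change ∫⁻ p, f p ∂(Measure.map (L : (ℝ × ℝ) →ₗ[ℝ] ℝ × ℝ) volume) = _
    rw [h, lintegral_smul_measure]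
    rfl

theorem PosBound.comp_linear {V : ℝ × ℝ → ℝ≥0∞} {S : Set (ℝ × ℝ)} (L : (ℝ × ℝ) ≃L[ℝ] ℝ × ℝ)
    (h : PosBound (fun p => ω (L p)) (fun p => V (L p)) S) : PosBound ω V (L '' S) := by
  obtain ⟨C, hC⟩ := h
  obtain ⟨c, hc, hcf⟩ := exists_lintegral_comp_linear L
  have hc' : (c : ℝ≥0∞) ≠ 0 := by exact_mod_cast hc
  refine ⟨C * c⁻¹, fun χ hχ h1 g hg hgS => ?_⟩
  have key := hC χ hχ h1 (fun p => g (L p)) (hg.comp L.continuous.measurable)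
    (fun p hp => hgS _ fun hq => hp ((L.injective.mem_set_image).1 hq))
  rw [hcf (fun p => g p ^ 2)] at key
  have e : posForm (fun p => ω (L p)) χ (fun p => V (L p) * g (L p)) =
      c ^ 3 * posForm ω χ (fun p => V p * g p) := by
    unfold posForm
    have h2 : ∀ P τ, ∫⁻ p, χ (τ - ω (L p) - ω (L (P - p))) *
        (V (L p) * g (L p) * (V (L (P - p)) * g (L (P - p)))) =
        c * ∫⁻ p, χ (τ - ω p - ω (L P - p)) * (V p * g p * (V (L P - p) * g (L P - p))) := by
      intro P τ
      rw [← hcf]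
      simp only [map_sub]
    simp only [h2, mul_pow]
    rw [hcf fun P => ∫⁻ τ, c ^ 2 * (∫⁻ p, χ (τ - ω p - ω (P - p)) *
      (V p * g p * (V (P - p) * g (P - p)))) ^ 2]
    simp only [lintegral_const_mul' _ _ (ENNReal.pow_ne_top ENNReal.coe_ne_top : (c : ℝ≥0∞) ^ 2 ≠ ⊤)]
    ring
  rw [e, mul_pow] at key
  have hc3 : (c : ℝ≥0∞) ^ 3 ≠ 0 := pow_ne_zero _ hc'
  have hc3' : (c : ℝ≥0∞) ^ 3 ≠ ⊤ := ENNReal.pow_ne_top ENNReal.coe_ne_top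
  refine (ENNReal.mul_le_mul_iff_right hc3 hc3').1 (key.trans (le_of_eq ?_))
  rw [ENNReal.coe_mul, ENNReal.coe_inv hc]
  calc _ = (c : ℝ≥0∞) ^ 2 * C * (∫⁻ p, g p ^ 2) ^ 2 * 1 := by ring
    _ = (c : ℝ≥0∞) ^ 2 * C * (∫⁻ p, g p ^ 2) ^ 2 * (c * (c : ℝ≥0∞)⁻¹) := by
      rw [ENNReal.mul_inv_cancel hc' ENNReal.coe_ne_top]
    _ = _ := by ring

theorem PosBound.const_mul {V : ℝ × ℝ → ℝ≥0∞} {S : Set (ℝ × ℝ)} (κ : ℝ≥0) (h : PosBound ω V S) :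
    PosBound ω (fun p => κ * V p) S := by
  obtain ⟨C, hC⟩ := h
  refine ⟨C * κ ^ 4, fun χ hχ h1 g hg hgS => ?_⟩
  have key := hC χ hχ h1 (fun p => κ * g p) (hg.const_mul _) fun p hp => by rw [hgS p hp, mul_zero]
  have e : (fun p => V p * (κ * g p)) = fun p => κ * V p * g p := by funext p; ring
  rw [e] at key
  refine key.trans (le_of_eq ?_)
  simp only [mul_pow]
  rw [lintegral_const_mul' _ _ (ENNReal.pow_ne_top ENNReal.coe_ne_top)]
  push_cast
  ring

theorem posBound_damping_of_comp_linear (hω : SmoothFun ω) {S : Set (ℝ × ℝ)}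
    (L : (ℝ × ℝ) ≃L[ℝ] ℝ × ℝ)
    (hL : (L (1, 0)).1 * (L (0, 1)).2 - (L (1, 0)).2 * (L (0, 1)).1 ≠ 0)
    (h : PosBound (fun p => ω (L p)) (damping fun p => ω (L p)) S) :
    PosBound ω (damping ω) (L '' S) := by
  refine PosBound.comp_linear L ?_
  set Δ := (L (1, 0)).1 * (L (0, 1)).2 - (L (1, 0)).2 * (L (0, 1)).1 with hΔ
  have hΔ2 : 0 < Δ ^ 2 := by positivity
  have : (fun p => damping ω (L p)) = fun p =>
      (Real.toNNReal ((Δ ^ 2)⁻¹ ^ ((1 : ℝ) / 8)) : ℝ≥0∞) * damping (fun p => ω (L p)) p := by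
    funext p
    unfold damping
    have := hessDet_comp_linear hω (L : (ℝ × ℝ) →L[ℝ] ℝ × ℝ) p
    simp only [ContinuousLinearEquiv.coe_coe] at this
    rw [this, ← hΔ, abs_mul, abs_of_pos hΔ2]
    change _ = ENNReal.ofReal _ * _
    rw [← ENNReal.ofReal_mul (by positivity), ← Real.mul_rpow (by positivity) (by positivity),
      inv_mul_cancel_left₀ hΔ2.ne']
  rw [this]
  exact h.const_mul _

theorem posBound_of_hessDet_eq_zero {S : Set (ℝ × ℝ)} (h : ∀ p ∈ S, hessDet ω p = 0) :
    PosBound ω (damping ω) S := by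
  refine ⟨0, fun χ _ _ g _ hgS => ?_⟩
  have : ∀ p, damping ω p * g p = 0 := fun p => by
    by_cases hp : p ∈ S
    · rw [damping, h p hp]
      simp
    · rw [hgS p hp, mul_zero]
  simp [posForm, this]

/-- The linear automorphism of the plane sending the standard basis to `w, v`. -/
def frame (w v : ℝ × ℝ) (h : w.1 * v.2 - w.2 * v.1 ≠ 0) : (ℝ × ℝ) ≃L[ℝ] ℝ × ℝ :=
  LinearEquiv.toContinuousLinearEquiv
    { toFun := fun p => (p.1 * w.1 + p.2 * v.1, p.1 * w.2 + p.2 * v.2)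
      map_add' := fun p q => by ext <;> simp <;> ring
      map_smul' := fun c p => by ext <;> simp <;> ring
      invFun := fun q => ((q.1 * v.2 - q.2 * v.1) / (w.1 * v.2 - w.2 * v.1),
        (w.1 * q.2 - w.2 * q.1) / (w.1 * v.2 - w.2 * v.1))
      left_inv := fun p => by
        ext
        · dsimp only
          rw [div_eq_iff h]
          ring
        · dsimp only
          rw [div_eq_iff h]
          ring
      right_inv := fun q => by
        ext
        · dsimp only
          rw [div_mul_eq_mul_div, div_mul_eq_mul_div, ← add_div, div_eq_iff h]
          ring
        · dsimp only
          rw [div_mul_eq_mul_div, div_mul_eq_mul_div, ← add_div, div_eq_iff h]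
          ring }

theorem frame_apply {w v : ℝ × ℝ} (h : w.1 * v.2 - w.2 * v.1 ≠ 0) (p : ℝ × ℝ) :
    frame w v h p = (p.1 * w.1 + p.2 * v.1, p.1 * w.2 + p.2 * v.2) := rfl

end

theorem exists_eval_eq_form {d : ℕ} {P : MvPolynomial (Fin 2) ℝ} (hP : P.IsHomogeneous d) :
    ∃ b, ∀ p : ℝ × ℝ, MvPolynomial.eval ![p.1, p.2] P = form d b p := by
  have hdeg : ∀ m ∈ P.support, m 0 + m 1 = d := fun m hm => by
    have := hP (MvPolynomial.mem_support_iff.1 hm)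
    rw [Finsupp.weight_apply, Finsupp.sum_fintype _ _ (by simp), Fin.sum_univ_two] at this
    simpa using this
  refine ⟨fun i => ∑ m ∈ P.support with m 0 = i, P.coeff m, fun p => ?_⟩
  rw [MvPolynomial.eval_eq', form, ← Finset.sum_fiberwise_of_maps_to
    (g := fun m : Fin 2 →₀ ℕ => m 0) (t := Finset.range (d + 1))
    (fun m hm => Finset.mem_range.2 (by have := hdeg m hm; omega))]
  refine Finset.sum_congr rfl fun i _ => ?_
  rw [Finset.sum_mul, Finset.sum_mul]
  refine Finset.sum_congr rfl fun m hm => ?_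
  rw [Finset.mem_filter] at hm
  have := hdeg m hm.1
  rw [Fin.prod_univ_two, show m 0 = i from hm.2, show m 1 = d - i by omega]
  simp [mul_assoc]

theorem exists_eval_frame_eq_form {d : ℕ} {P : MvPolynomial (Fin 2) ℝ} (hP : P.IsHomogeneous d)
    {w v : ℝ × ℝ} (h : w.1 * v.2 - w.2 * v.1 ≠ 0) :
    ∃ b, ∀ p : ℝ × ℝ,
      MvPolynomial.eval ![(frame w v h p).1, (frame w v h p).2] P = form d b p := by
  set g : Fin 2 → MvPolynomial (Fin 2) ℝ :=
    ![.C w.1 * .X 0 + .C v.1 * .X 1, .C w.2 * .X 0 + .C v.2 * .X 1] with hg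
  have hg1 : ∀ i, (g i).IsHomogeneous 1 := by
    intro i
    fin_cases i
    · exact (MvPolynomial.isHomogeneous_C_mul_X _ _).add (MvPolynomial.isHomogeneous_C_mul_X _ _)
    · exact (MvPolynomial.isHomogeneous_C_mul_X _ _).add (MvPolynomial.isHomogeneous_C_mul_X _ _)
  have h1 := hP.aeval g hg1
  rw [one_mul] at h1
  obtain ⟨b, hb⟩ := exists_eval_eq_form h1
  refine ⟨b, fun p => ?_⟩
  rw [← hb]
  have := MvPolynomial.comp_aeval_apply (f := g) (MvPolynomial.aeval ![p.1, p.2]) P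
  simp only [MvPolynomial.aeval_eq_eval] at this
  rw [this]
  have hv : (fun i => MvPolynomial.eval ![p.1, p.2] (g i)) =
      ![(frame w v h p).1, (frame w v h p).2] := by
    funext i
    fin_cases i <;> simp [hg, frame_apply] <;> ring
  exact congrArg (fun u => MvPolynomial.eval u P) hv.symm

theorem form_zero_one (d : ℕ) (b : ℕ → ℝ) : form d b (0, 1) = b 0 := by
  rw [form, Finset.sum_eq_single 0]
  · simp
  · intro i _ hi
    simp [hi]
  · simp

theorem pdx_form_zero_one {d : ℕ} (hd : 1 ≤ d) (b : ℕ → ℝ) : pdx (form d b) (0, 1) = b 1 := by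
  have h : HasDerivAt (fun x => form d b (x, 1))
      (∑ i ∈ Finset.range (d + 1), b i * (i * (0 : ℝ) ^ (i - 1)) * 1 ^ (d - i)) 0 := by
    unfold form
    refine HasDerivAt.fun_sum fun i _ => ?_
    exact ((hasDerivAt_pow i (0 : ℝ)).const_mul (b i)).mul_const ((1 : ℝ) ^ (d - i))
  unfold pdx
  rw [h.deriv, Finset.sum_eq_single 1]
  · simp
  · intro i _ hi
    rcases i with _ | _ | i
    · simp
    · simp at hi
    · simp
  · intro h
    simp at h
    omega

theorem form_eq_zero {d : ℕ} {b : ℕ → ℝ} (h : ∀ i ≤ d, b i = 0) (p : ℝ × ℝ) : form d b p = 0 :=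
  Finset.sum_eq_zero fun i hi => by
    rw [h i (Nat.lt_succ_iff.1 (Finset.mem_range.1 hi)), zero_mul, zero_mul]

theorem fst_mul_pdx_add_snd_mul_pdy_form (d : ℕ) (b : ℕ → ℝ) (p : ℝ × ℝ) :
    p.1 * pdx (form d b) p + p.2 * pdy (form d b) p = d * form d b p := by
  rw [fst_mul_pdx_form, snd_mul_pdy_form, form, form, form, ← Finset.sum_add_distrib,
    Finset.mul_sum]
  refine Finset.sum_congr rfl fun i hi => ?_
  rw [Nat.cast_sub (Nat.lt_succ_iff.1 (Finset.mem_range.1 hi))]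
  ring

/-- A binary form without `ξ μ ^ (d - 1)` term, or without `μ ^ d` term, satisfies the positive
bilinear estimate in a thin sector along the positive `μ` axis. -/
theorem exists_posBound_form_sector {d : ℕ} {b : ℕ → ℝ} (h : b 0 = 0 ∨ b 1 = 0) :
    ∃ ε > 0, PosBound (form d b) (damping (form d b)) (sector ε) := by
  by_cases H : ∃ j, 1 ≤ j ∧ j ≤ d ∧ b j ≠ 0
  swap
  · push Not at H
    refine ⟨1, one_pos, posBound_of_hessDet_eq_zero fun p hp => ?_⟩
    obtain ⟨h1, h2, -⟩ := hp
    have hx := fst_sq_mul_pdx_pdx_form d b p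
    have hy := fst_mul_snd_mul_pdx_pdy_form d b p
    rw [form_eq_zero, mul_eq_zero_iff_left (by positivity)] at hx
    · rw [form_eq_zero, mul_eq_zero_iff_left (by positivity)] at hy
      · simp [hessDet, hx, hy]
      · intro i hi
        rcases i with _ | i
        · simp
        · simp [H (i + 1) (by omega) hi]
    · intro i hi
      rcases i with _ | i
      · simp
      · simp [H (i + 1) (by omega) hi]
  classical
  obtain ⟨hj1, hjd, hbj⟩ := Nat.find_spec H
  have hmin : ∀ i, 0 < i → i < Nat.find H → b i = 0 := fun i hi hij => by
    by_contra hb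
    exact Nat.find_min H hij ⟨hi, by omega, hb⟩
  set j := Nat.find H
  clear_value j
  by_cases hc : b 0 = 0
  · rcases hjd.eq_or_lt with rfl | hlt
    · refine ⟨1, one_pos, posBound_of_hessDet_eq_zero fun p hp => ?_⟩
      obtain ⟨h1, h2, -⟩ := hp
      have hb : ∀ i < j, b i = 0 := fun i hi => by
        rcases i with _ | i
        · exact hc
        · exact hmin _ (by omega) hi
      have hx := snd_sq_mul_pdy_pdy_form j b p
      have hy := fst_mul_snd_mul_pdx_pdy_form j b p
      rw [form_eq_zero, mul_eq_zero_iff_left (by positivity)] at hx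
      · rw [form_eq_zero, mul_eq_zero_iff_left (by positivity)] at hy
        · simp [hessDet, hx, hy]
        · intro i hi
          rcases hi.eq_or_lt with rfl | hi
          · simp
          · simp [hb i hi]
      · intro i hi
        rcases hi.eq_or_lt with rfl | hi
        · simp
        · simp [hb i hi]
    · obtain ⟨k, rfl⟩ : ∃ k, j = k + 1 := ⟨j - 1, by omega⟩
      obtain ⟨m, rfl⟩ : ∃ m, d = k + 1 + (m + 1) := ⟨d - (k + 1) - 1, by omega⟩
      obtain ⟨e, he, hP⟩ := posBound_monomial k m hbj
      obtain ⟨ε, hε, nb⟩ := exists_nearBinomial_form (l := m + 1) hj1 hmin he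
      rw [hc] at nb
      exact ⟨ε, hε, hP _ _ _ (polySlices_form _ _) (smoothFun_form _ _) (measurableSet_sector _)
        (convex_sector _) nb⟩
  · have hj2 : j ≠ 1 := by
      rintro rfl
      exact hbj (h.resolve_left hc)
    obtain ⟨k, rfl⟩ : ∃ k, j = k + 2 := ⟨j - 2, by omega⟩
    obtain ⟨l, rfl⟩ : ∃ l, d = k + 2 + l := ⟨d - (k + 2), by omega⟩
    obtain ⟨e, he, hP⟩ := posBound_binomial k l hbj hc
    obtain ⟨ε, hε, nb⟩ := exists_nearBinomial_form (l := l) hj1 hmin he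
    exact ⟨ε, hε, hP _ _ _ (polySlices_form _ _) (smoothFun_form _ _) (measurableSet_sector _)
      (convex_sector _) nb⟩

theorem exists_posBound_frame_sector {d : ℕ} (hd : 1 ≤ d) {ω : ℝ × ℝ → ℝ}
    {P : MvPolynomial (Fin 2) ℝ} (hP : P.IsHomogeneous d)
    (hω : ∀ p : ℝ × ℝ, ω p = MvPolynomial.eval ![p.1, p.2] P) {w v : ℝ × ℝ}
    (h : w.1 * v.2 - w.2 * v.1 ≠ 0) (hv : ω v = 0 ∨ w.1 * pdx ω v + w.2 * pdy ω v = 0) :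
    ∃ ε > 0, PosBound ω (damping ω) (frame w v h '' sector ε) := by
  obtain ⟨b, hb⟩ := exists_eval_frame_eq_form hP h
  obtain ⟨b', hb'⟩ := exists_eval_eq_form hP
  have hsm : SmoothFun ω := by
    rw [show ω = form d b' from funext fun p => (hω p).trans (hb' p)]
    exact smoothFun_form _ _
  have hL : (fun p => ω (frame w v h p)) = form d b := funext fun p => (hω _).trans (hb p)
  have h01 : frame w v h (0, 1) = v := by rw [frame_apply]; simp
  have h10 : frame w v h (1, 0) = w := by rw [frame_apply]; simp
  have hb0 : b 0 = ω v := by rw [← form_zero_one d b, ← hL]; simp only [h01]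
  have hb1 : b 1 = w.1 * pdx ω v + w.2 * pdy ω v := by
    rw [← pdx_form_zero_one hd b, ← hL]
    have := congrFun (pdx_comp_linear hsm (frame w v h : (ℝ × ℝ) →L[ℝ] ℝ × ℝ)) (0, 1)
    simp only [ContinuousLinearEquiv.coe_coe, h01, h10] at this
    exact this
  obtain ⟨ε, hε, hpos⟩ := exists_posBound_form_sector (d := d) (b := b) (by rwa [hb0, hb1])
  refine ⟨ε, hε, posBound_damping_of_comp_linear hsm (frame w v h) ?_ ?_⟩
  · rwa [h01, h10]
  · rwa [hL]

/-- Every direction has a frame such that the positive bilinear estimate holds in thin sectors on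
both sides. -/
theorem exists_frame_posBound {d : ℕ} (hd : 1 ≤ d) {ω : ℝ × ℝ → ℝ}
    {P : MvPolynomial (Fin 2) ℝ} (hP : P.IsHomogeneous d)
    (hω : ∀ p : ℝ × ℝ, ω p = MvPolynomial.eval ![p.1, p.2] P) {v : ℝ × ℝ} (hv : v ≠ 0) :
    ∃ (w : ℝ × ℝ) (h : w.1 * v.2 - w.2 * v.1 ≠ 0) (h' : (-w).1 * v.2 - (-w).2 * v.1 ≠ 0),
      (∃ ε > 0, PosBound ω (damping ω) (frame w v h '' sector ε)) ∧
      ∃ ε > 0, PosBound ω (damping ω) (frame (-w) v h' '' sector ε) := by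
  have key : ∃ w : ℝ × ℝ, w.1 * v.2 - w.2 * v.1 ≠ 0 ∧
      (ω v = 0 ∨ w.1 * pdx ω v + w.2 * pdy ω v = 0) := by
    by_cases h0 : ω v = 0
    · refine ⟨(v.2, -v.1), ?_, Or.inl h0⟩
      intro h
      apply hv
      have h1 : v.1 ^ 2 + v.2 ^ 2 = 0 := by simp only at h; linarith
      ext
      · simp only [Prod.fst_zero]; nlinarith [sq_nonneg v.1, sq_nonneg v.2]
      · simp only [Prod.snd_zero]; nlinarith [sq_nonneg v.1, sq_nonneg v.2]
    · refine ⟨(pdy ω v, -pdx ω v), ?_, Or.inr (by ring)⟩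
      obtain ⟨b', hb'⟩ := exists_eval_eq_form hP
      have hωf : ω = form d b' := funext fun p => (hω p).trans (hb' p)
      have := fst_mul_pdx_add_snd_mul_pdy_form d b' v
      rw [← hωf] at this
      have hd0 : (d : ℝ) ≠ 0 := by exact_mod_cast (by omega : d ≠ 0)
      have h2 : (d : ℝ) * ω v ≠ 0 := mul_ne_zero hd0 h0
      rw [← this] at h2
      convert h2 using 1
      ring
  obtain ⟨w, h, h1⟩ := key
  have h' : (-w).1 * v.2 - (-w).2 * v.1 ≠ 0 := by
    rw [Prod.fst_neg, Prod.snd_neg]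
    intro h2
    exact h (by linarith)
  refine ⟨w, h, h', exists_posBound_frame_sector hd hP hω h h1,
    exists_posBound_frame_sector hd hP hω h' (h1.imp id fun h2 => ?_)⟩
  rw [Prod.fst_neg, Prod.snd_neg]
  linarith

/-- The `TT*` bound of a weighted `L²` norm of an oscillatory integral operator by the absolute
value of its kernel. -/
theorem lintegral_mul_enorm_integral_sq_le {Y Z : Type*} [MeasurableSpace Y] [MeasurableSpace Z]
    {μ : Measure Y} {ν : Measure Z} [SFinite μ] [SFinite ν] {e : Z → Y → ℂ}
    (he : Measurable (Function.uncurry e)) (he1 : ∀ z y, ‖e z y‖ ≤ 1) {c : Z → ℝ}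
    (hc0 : ∀ z, 0 ≤ c z) (hc : Integrable c ν) {H : Y → ℂ} (hH : Integrable H μ)
    {k : Y → Y → ℝ≥0∞}
    (hk : ∀ y y', ‖∫ z, (c z : ℂ) * (e z y * starRingEnd ℂ (e z y')) ∂ν‖ₑ ≤ k y y') :
    ∫⁻ z, ENNReal.ofReal (c z) * ‖∫ y, e z y * H y ∂μ‖ₑ ^ 2 ∂ν ≤
      ∫⁻ w, ‖H w.1‖ₑ * ‖H w.2‖ₑ * k w.1 w.2 ∂(μ.prod μ) := by
  set Φ : Z × Y × Y → ℂ := fun u =>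
    (c u.1 : ℂ) * (e u.1 u.2.1 * starRingEnd ℂ (e u.1 u.2.2)) *
      (H u.2.1 * starRingEnd ℂ (H u.2.2)) with hΦ
  have hHc : Integrable (fun y => starRingEnd ℂ (H y)) μ := by
    refine hH.mono (Complex.continuous_conj.comp_aestronglyMeasurable hH.1) (ae_of_all _ fun y => ?_)
    simp
  have hHH : Integrable (fun w : Y × Y => H w.1 * starRingEnd ℂ (H w.2)) (μ.prod μ) :=
    hH.mul_prod hHc
  have hcC : Integrable (fun z => (c z : ℂ)) ν := hc.ofReal
  have h0 : Integrable (fun u : Z × Y × Y => (c u.1 : ℂ) * (H u.2.1 * starRingEnd ℂ (H u.2.2)))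
      (ν.prod (μ.prod μ)) := hcC.mul_prod hHH
  have hem : Measurable fun u : Z × Y × Y => e u.1 u.2.1 * starRingEnd ℂ (e u.1 u.2.2) := by
    have h1 : Measurable fun u : Z × Y × Y => e u.1 u.2.1 :=
      he.comp (measurable_fst.prodMk measurable_snd.fst)
    have h2 : Measurable fun u : Z × Y × Y => e u.1 u.2.2 :=
      he.comp (measurable_fst.prodMk measurable_snd.snd)
    exact h1.mul (Complex.continuous_conj.measurable.comp h2)
  have hΦi : Integrable Φ (ν.prod (μ.prod μ)) := by
    have h1 : Φ = fun u => (e u.1 u.2.1 * starRingEnd ℂ (e u.1 u.2.2)) *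
        ((c u.1 : ℂ) * (H u.2.1 * starRingEnd ℂ (H u.2.2))) := by
      funext u
      simp only [hΦ]
      ring
    rw [h1]
    refine h0.bdd_mul (c := 1) hem.aestronglyMeasurable (ae_of_all _ fun u => ?_)
    rw [norm_mul, RCLike.norm_conj]
    exact mul_le_one₀ (he1 _ _) (norm_nonneg _) (he1 _ _)
  have h1 : ∀ z, ∫ w, Φ (z, w) ∂(μ.prod μ) =
      ((c z * ‖∫ y, e z y * H y ∂μ‖ ^ 2 : ℝ) : ℂ) := by
    intro z
    have h2 : ∀ w : Y × Y, Φ (z, w) =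
        (c z : ℂ) * ((e z w.1 * H w.1) * starRingEnd ℂ (e z w.2 * H w.2)) := by
      intro w
      simp only [hΦ, map_mul]
      ring
    simp only [h2]
    rw [integral_const_mul, integral_prod_mul (fun y => e z y * H y)
      (fun y => starRingEnd ℂ (e z y * H y)), integral_conj, Complex.mul_conj,
      Complex.normSq_eq_norm_sq]
    push_cast
    ring
  have h3 : Integrable (fun z => c z * ‖∫ y, e z y * H y ∂μ‖ ^ 2) ν := by
    have := hΦi.integral_prod_left
    simp only [h1] at this
    simpa only [RCLike.re_to_complex, Complex.ofReal_re] using this.re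
  have h4 : ∫⁻ z, ENNReal.ofReal (c z) * ‖∫ y, e z y * H y ∂μ‖ₑ ^ 2 ∂ν =
      ENNReal.ofReal (∫ z, c z * ‖∫ y, e z y * H y ∂μ‖ ^ 2 ∂ν) := by
    rw [ofReal_integral_eq_lintegral_ofReal h3
      (ae_of_all _ fun z => mul_nonneg (hc0 z) (sq_nonneg _))]
    refine lintegral_congr fun z => ?_
    rw [ENNReal.ofReal_mul (hc0 z), ENNReal.ofReal_pow (norm_nonneg _), ofReal_norm]
  have h5 : ((∫ z, c z * ‖∫ y, e z y * H y ∂μ‖ ^ 2 ∂ν : ℝ) : ℂ) =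
      ∫ w : Y × Y, ∫ z, Φ (z, w) ∂ν ∂(μ.prod μ) := by
    rw [← integral_complex_ofReal, ← integral_integral_swap (f := fun z w => Φ (z, w)) hΦi]
    exact integral_congr_ae (ae_of_all _ fun z => (h1 z).symm)
  rw [h4]
  calc ENNReal.ofReal (∫ z, c z * ‖∫ y, e z y * H y ∂μ‖ ^ 2 ∂ν)
      ≤ ‖((∫ z, c z * ‖∫ y, e z y * H y ∂μ‖ ^ 2 ∂ν : ℝ) : ℂ)‖ₑ := by
        rw [← ofReal_norm, Complex.norm_real]
        exact ENNReal.ofReal_le_ofReal (le_abs_self _)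
    _ ≤ ∫⁻ w : Y × Y, ‖∫ z, Φ (z, w) ∂ν‖ₑ ∂(μ.prod μ) := by
        rw [h5]
        exact enorm_integral_le_lintegral_enorm _
    _ ≤ _ := by
        refine lintegral_mono fun w => ?_
        simp only [hΦ]
        rw [integral_mul_const, enorm_mul, enorm_mul, mul_comm]
        have : ‖starRingEnd ℂ (H w.2)‖ₑ = ‖H w.2‖ₑ := by
          rw [← ofReal_norm, RCLike.norm_conj, ofReal_norm]
        rw [this]
        gcongr
        exact hk _ _

/-- Schur's test for a convolution kernel. -/
theorem lintegral_lintegral_conv_mul_mul_le {G : Type*} [MeasurableSpace G] [AddCommGroup G]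
    [MeasurableAdd₂ G] [MeasurableNeg G] {μ : Measure G} [SFinite μ] [μ.IsAddLeftInvariant]
    [μ.IsNegInvariant] {κ : G → ℝ≥0∞} (hκ : Measurable κ) {A : G → ℝ≥0∞} (hA : Measurable A) :
    ∫⁻ x, ∫⁻ y, κ (x - y) * (A x * A y) ∂μ ∂μ ≤ (∫⁻ x, κ x ∂μ) * ∫⁻ x, A x ^ 2 ∂μ := by
  have hy : ∀ a b : ℝ≥0∞, 2 * (a * b) ≤ a ^ 2 + b ^ 2 := by
    intro a b
    rcases eq_or_ne a ⊤ with rfl | ha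
    · simp
    rcases eq_or_ne b ⊤ with rfl | hb
    · simp
    lift a to ℝ≥0 using ha
    lift b to ℝ≥0 using hb
    exact_mod_cast (by simpa [mul_assoc] using two_mul_le_add_sq a b : 2 * (a * b) ≤ a ^ 2 + b ^ 2)
  have h1 : ∫⁻ x, ∫⁻ y, κ (x - y) * A x ^ 2 ∂μ ∂μ = (∫⁻ x, κ x ∂μ) * ∫⁻ x, A x ^ 2 ∂μ := by
    rw [← lintegral_const_mul _ (hA.pow_const 2)]
    refine lintegral_congr fun x => ?_
    have : Measurable fun y => κ (x - y) := hκ.comp (measurable_const.sub measurable_id)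
    rw [lintegral_mul_const _ this, lintegral_sub_left_eq_self κ x]
  have h2 : ∫⁻ x, ∫⁻ y, κ (x - y) * A y ^ 2 ∂μ ∂μ = (∫⁻ x, κ x ∂μ) * ∫⁻ x, A x ^ 2 ∂μ := by
    rw [lintegral_lintegral_swap (by fun_prop), ← lintegral_const_mul _ (hA.pow_const 2)]
    refine lintegral_congr fun y => ?_
    have : Measurable fun x => κ (x - y) := hκ.comp (measurable_id.sub measurable_const)
    rw [lintegral_mul_const _ this, lintegral_sub_right_eq_self κ y]
  have h3 : 2 * ∫⁻ x, ∫⁻ y, κ (x - y) * (A x * A y) ∂μ ∂μ ≤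
      2 * ((∫⁻ x, κ x ∂μ) * ∫⁻ x, A x ^ 2 ∂μ) := by
    rw [two_mul (_ * _)]
    nth_rw 1 [← h1]
    rw [← h2, ← lintegral_add_left (by fun_prop), ← lintegral_const_mul _ (by fun_prop)]
    refine lintegral_mono fun x => ?_
    rw [← lintegral_add_left (by fun_prop), ← lintegral_const_mul _ (by fun_prop)]
    refine lintegral_mono fun y => ?_
    rw [← mul_add, mul_left_comm]
    gcongr
    exact hy _ _
  exact (ENNReal.mul_le_mul_iff_right (by norm_num) (by norm_num)).1 h3

/-- The Fourier transform of `t ↦ exp (-ε t ^ 2)`. -/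
def gaussKernel (ε s : ℝ) : ℝ≥0∞ :=
  ENNReal.ofReal (Real.sqrt (Real.pi / ε) * Real.exp (-(1 / (4 * ε)) * s ^ 2))

theorem measurable_gaussKernel (ε : ℝ) : Measurable (gaussKernel ε) := by
  unfold gaussKernel
  fun_prop

theorem lintegral_exp_neg_mul_sq {b : ℝ} (hb : 0 < b) :
    ∫⁻ x : ℝ, ENNReal.ofReal (Real.exp (-b * x ^ 2)) = ENNReal.ofReal (Real.sqrt (Real.pi / b)) := by
  rw [← integral_gaussian b,
    ofReal_integral_eq_lintegral_ofReal (integrable_exp_neg_mul_sq hb)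
      (ae_of_all _ fun x => (Real.exp_pos _).le)]

theorem lintegral_gaussKernel {ε : ℝ} (hε : 0 < ε) :
    ∫⁻ s, gaussKernel ε s = ENNReal.ofReal (2 * Real.pi) := by
  unfold gaussKernel
  simp only [ENNReal.ofReal_mul (Real.sqrt_nonneg _)]
  rw [lintegral_const_mul _ (by fun_prop), lintegral_exp_neg_mul_sq (by positivity),
    ← ENNReal.ofReal_mul (Real.sqrt_nonneg _), ← Real.sqrt_mul (by positivity)]
  congr 1
  rw [show Real.pi / ε * (Real.pi / (1 / (4 * ε))) = (2 * Real.pi) ^ 2 by field_simp; norm_num]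
  exact Real.sqrt_sq (by positivity)

theorem enorm_integral_gaussian_mul_exp {ε : ℝ} (hε : 0 < ε) (s : ℝ) :
    ‖∫ t : ℝ, (Real.exp (-ε * t ^ 2) : ℂ) * Complex.exp (Complex.I * (s * t))‖ₑ =
      gaussKernel ε s := by
  have h1 := fourierIntegral_gaussian (b := (ε : ℂ)) (by simpa using hε) (s : ℂ)
  have h2 : (∫ t : ℝ, (Real.exp (-ε * t ^ 2) : ℂ) * Complex.exp (Complex.I * (s * t))) =
      ((Real.sqrt (Real.pi / ε) * Real.exp (-(1 / (4 * ε)) * s ^ 2) : ℝ) : ℂ) := by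
    have h3 : ((Real.sqrt (Real.pi / ε) * Real.exp (-(1 / (4 * ε)) * s ^ 2) : ℝ) : ℂ) =
        (Real.pi / ε : ℂ) ^ (1 / 2 : ℂ) * Complex.exp (-(s : ℂ) ^ 2 / (4 * ε)) := by
      rw [Real.sqrt_eq_rpow, Complex.ofReal_mul, Complex.ofReal_cpow (by positivity)]
      push_cast
      congr 2
      ring
    rw [h3, ← h1]
    refine integral_congr_ae (ae_of_all _ fun t => ?_)
    simp only
    rw [mul_comm]
    push_cast
    congr 2
    ring
  rw [h2, ← ofReal_norm, Complex.norm_real, Real.norm_of_nonneg (by positivity)]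
  rfl

/-- The density of the centred Gaussian of variance `ε`. -/
def gaussDensity (ε s : ℝ) : ℝ≥0∞ :=
  ENNReal.ofReal ((Real.sqrt (2 * Real.pi * ε))⁻¹ * Real.exp (-(1 / (2 * ε)) * s ^ 2))

theorem measurable_gaussDensity (ε : ℝ) : Measurable (gaussDensity ε) := by
  unfold gaussDensity
  fun_prop

theorem lintegral_gaussDensity {ε : ℝ} (hε : 0 < ε) : ∫⁻ s, gaussDensity ε s = 1 := by
  unfold gaussDensity
  have h0 : 0 ≤ (Real.sqrt (2 * Real.pi * ε))⁻¹ := by positivity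
  simp only [ENNReal.ofReal_mul h0]
  rw [lintegral_const_mul _ (by fun_prop), lintegral_exp_neg_mul_sq (by positivity),
    ← ENNReal.ofReal_mul h0,
    show Real.pi / (1 / (2 * ε)) = 2 * Real.pi * ε by field_simp,
    inv_mul_cancel₀ (by positivity), ENNReal.ofReal_one]

theorem gaussKernel_sub_eq {ε : ℝ} (hε : 0 < ε) (σ σ' : ℝ) :
    gaussKernel ε (σ - σ') =
      ENNReal.ofReal (2 * Real.pi) * ∫⁻ τ, gaussDensity ε (τ - σ) * gaussDensity ε (τ - σ') := by
  have h0 : 0 ≤ (2 * Real.pi * ε)⁻¹ * Real.exp (-(1 / (4 * ε)) * (σ - σ') ^ 2) := by positivity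
  have h1 : ∀ τ, gaussDensity ε (τ - σ) * gaussDensity ε (τ - σ') =
      ENNReal.ofReal ((2 * Real.pi * ε)⁻¹ * Real.exp (-(1 / (4 * ε)) * (σ - σ') ^ 2)) *
        ENNReal.ofReal (Real.exp (-(1 / ε) * (τ - (σ + σ') / 2) ^ 2)) := by
    intro τ
    unfold gaussDensity
    rw [← ENNReal.ofReal_mul (by positivity), ← ENNReal.ofReal_mul h0]
    congr 1
    have h2 : (Real.sqrt (2 * Real.pi * ε))⁻¹ * (Real.sqrt (2 * Real.pi * ε))⁻¹ =
        (2 * Real.pi * ε)⁻¹ := by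
      rw [← mul_inv, Real.mul_self_sqrt (by positivity)]
    rw [mul_mul_mul_comm, h2, ← Real.exp_add, mul_assoc (2 * Real.pi * ε)⁻¹, ← Real.exp_add]
    congr 2
    field_simp
    ring
  simp only [h1]
  rw [lintegral_const_mul _ (by fun_prop),
    lintegral_sub_right_eq_self (fun τ => ENNReal.ofReal (Real.exp (-(1 / ε) * τ ^ 2))),
    lintegral_exp_neg_mul_sq (by positivity), ← ENNReal.ofReal_mul h0,
    ← ENNReal.ofReal_mul (by positivity)]
  unfold gaussKernel
  congr 1
  have h3 : Real.sqrt (Real.pi / (1 / ε)) = ε * Real.sqrt (Real.pi / ε) := by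
    rw [show Real.pi / (1 / ε) = ε ^ 2 * (Real.pi / ε) by field_simp,
      Real.sqrt_mul (by positivity), Real.sqrt_sq hε.le]
  rw [h3]
  field_simp

/-- Removing a Gaussian cut-off. -/
theorem lintegral_le_of_forall_gaussian {Z : Type*} [MeasurableSpace Z] {ν : Measure Z}
    {q : Z → ℝ} (hq : Measurable q) {Φ : Z → ℝ≥0∞} (hΦ : AEMeasurable Φ ν) {M : ℝ≥0∞}
    (h : ∀ ε > 0, ∫⁻ z, ENNReal.ofReal (Real.exp (-ε * q z)) * Φ z ∂ν ≤ M) :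
    ∫⁻ z, Φ z ∂ν ≤ M := by
  have h1 : ∀ z, Filter.Tendsto
      (fun n : ℕ => ENNReal.ofReal (Real.exp (-(1 / ((n : ℝ) + 1)) * q z)) * Φ z)
      Filter.atTop (nhds (Φ z)) := by
    intro z
    have h2 : Filter.Tendsto (fun n : ℕ => Real.exp (-(1 / ((n : ℝ) + 1)) * q z))
        Filter.atTop (nhds 1) := by
      have := ((tendsto_one_div_add_atTop_nhds_zero_nat (𝕜 := ℝ)).neg.mul_const (q z)).rexp
      simpa using this
    have h3 := ENNReal.tendsto_ofReal h2
    rw [ENNReal.ofReal_one] at h3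
    have h4 := ENNReal.Tendsto.mul_const (b := Φ z) h3 (Or.inl one_ne_zero)
    rwa [one_mul] at h4
  calc ∫⁻ z, Φ z ∂ν = ∫⁻ z, Filter.liminf
        (fun n : ℕ => ENNReal.ofReal (Real.exp (-(1 / ((n : ℝ) + 1)) * q z)) * Φ z)
        Filter.atTop ∂ν := lintegral_congr fun z => ((h1 z).liminf_eq).symm
    _ ≤ Filter.liminf (fun n : ℕ => ∫⁻ z,
        ENNReal.ofReal (Real.exp (-(1 / ((n : ℝ) + 1)) * q z)) * Φ z ∂ν) Filter.atTop :=
      lintegral_liminf_le' fun n => AEMeasurable.mul (by fun_prop) hΦ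
    _ ≤ M := by
      refine Filter.liminf_le_of_frequently_le' (Filter.Frequently.of_forall fun n => ?_)
      exact h _ (by positivity)

theorem measurable_ftn2 {u : ℝ × ℝ → ℂ} (hu : Measurable u) : Measurable (ftn2 u) := by
  unfold ftn2
  have : Measurable (Function.uncurry fun p q : ℝ × ℝ =>
      Complex.exp (-(Complex.I * (q.1 * p.1 + q.2 * p.2))) * u q) := by
    unfold Function.uncurry
    fun_prop
  exact (this.stronglyMeasurable.integral_prod_right (ν := volume)).measurable

theorem norm_exp_I_mul_ofReal (x : ℝ) : ‖Complex.exp (Complex.I * x)‖ = 1 := by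
  rw [mul_comm, Complex.norm_exp_ofReal_mul_I]

theorem conj_exp_I_mul_ofReal (x : ℝ) :
    starRingEnd ℂ (Complex.exp (Complex.I * x)) = Complex.exp (Complex.I * ((-x : ℝ) : ℂ)) := by
  rw [← Complex.exp_conj, map_mul, Complex.conj_I, Complex.conj_ofReal]
  congr 1
  push_cast
  ring

/-- The upper bound in Plancherel's theorem. -/
theorem lintegral_enorm_ftn2_sq_le {u : ℝ × ℝ → ℂ} (hum : Measurable u) (hu : Integrable u) :
    ∫⁻ p, ‖ftn2 u p‖ₑ ^ 2 ≤ ENNReal.ofReal (2 * Real.pi) ^ 2 * ∫⁻ q, ‖u q‖ₑ ^ 2 := by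
  refine lintegral_le_of_forall_gaussian (q := fun p : ℝ × ℝ => p.1 ^ 2 + p.2 ^ 2) (by fun_prop)
    ((measurable_ftn2 hum).enorm.pow_const 2).aemeasurable fun ε hε => ?_
  have hexp : ∀ p : ℝ × ℝ, Real.exp (-ε * (p.1 ^ 2 + p.2 ^ 2)) =
      Real.exp (-ε * p.1 ^ 2) * Real.exp (-ε * p.2 ^ 2) := by
    intro p
    rw [← Real.exp_add]
    congr 1
    ring
  have hg := integrable_exp_neg_mul_sq hε
  have hκm : Measurable fun q : ℝ × ℝ => gaussKernel ε q.1 * gaussKernel ε q.2 :=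
    ((measurable_gaussKernel ε).comp measurable_fst).mul
      ((measurable_gaussKernel ε).comp measurable_snd)
  have hκ : ∫⁻ q : ℝ × ℝ, gaussKernel ε q.1 * gaussKernel ε q.2 =
      ENNReal.ofReal (2 * Real.pi) ^ 2 := by
    rw [Measure.volume_eq_prod, lintegral_prod_mul (measurable_gaussKernel ε).aemeasurable
      (measurable_gaussKernel ε).aemeasurable, lintegral_gaussKernel hε, sq]
  have key := lintegral_mul_enorm_integral_sq_le (μ := volume) (ν := volume)
    (e := fun p q : ℝ × ℝ => Complex.exp (-(Complex.I * (q.1 * p.1 + q.2 * p.2))))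
    (by unfold Function.uncurry; fun_prop) (fun p q => by
      have := norm_exp_I_mul_ofReal (-(q.1 * p.1 + q.2 * p.2))
      push_cast at this
      rw [mul_neg] at this
      exact this.le)
    (c := fun p => Real.exp (-ε * p.1 ^ 2) * Real.exp (-ε * p.2 ^ 2))
    (fun p => by positivity) (hg.mul_prod hg) hu
    (k := fun q q' => gaussKernel ε (q - q').1 * gaussKernel ε (q - q').2) (fun q q' => by
      have h1 : ∀ p : ℝ × ℝ,
          ((Real.exp (-ε * p.1 ^ 2) * Real.exp (-ε * p.2 ^ 2) : ℝ) : ℂ) *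
            (Complex.exp (-(Complex.I * (q.1 * p.1 + q.2 * p.2))) *
              starRingEnd ℂ (Complex.exp (-(Complex.I * (q'.1 * p.1 + q'.2 * p.2))))) =
          ((Real.exp (-ε * p.1 ^ 2) : ℂ) *
            Complex.exp (Complex.I * (((q' - q).1 : ℝ) * p.1))) *
          ((Real.exp (-ε * p.2 ^ 2) : ℂ) *
            Complex.exp (Complex.I * (((q' - q).2 : ℝ) * p.2))) := by
        intro p
        have h2 := conj_exp_I_mul_ofReal (-(q'.1 * p.1 + q'.2 * p.2))
        push_cast at h2
        rw [mul_neg, neg_neg] at h2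
        rw [h2, mul_mul_mul_comm, ← Complex.exp_add, ← Complex.exp_add]
        push_cast [Prod.fst_sub, Prod.snd_sub]
        congr 2
        ring
      simp only [h1]
      rw [Measure.volume_eq_prod, integral_prod_mul
        (fun x : ℝ => (Real.exp (-ε * x ^ 2) : ℂ) *
            Complex.exp (Complex.I * (((q' - q).1 : ℝ) * x)))
        (fun x : ℝ => (Real.exp (-ε * x ^ 2) : ℂ) *
            Complex.exp (Complex.I * (((q' - q).2 : ℝ) * x))), enorm_mul,
        enorm_integral_gaussian_mul_exp hε, enorm_integral_gaussian_mul_exp hε]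
      refine le_of_eq ?_
      unfold gaussKernel
      simp only [Prod.fst_sub, Prod.snd_sub]
      rw [sub_sq_comm q'.1, sub_sq_comm q'.2])
  simp only [hexp]
  refine key.trans ?_
  have hm : Measurable fun w : (ℝ × ℝ) × ℝ × ℝ => ‖u w.1‖ₑ * ‖u w.2‖ₑ *
      (gaussKernel ε (w.1 - w.2).1 * gaussKernel ε (w.1 - w.2).2) :=
    ((hum.comp measurable_fst).enorm.mul (hum.comp measurable_snd).enorm).mul
      (hκm.comp (measurable_fst.sub measurable_snd))
  rw [lintegral_prod _ hm.aemeasurable]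
  have := lintegral_lintegral_conv_mul_mul_le (μ := volume) hκm hum.enorm
  rw [hκ] at this
  refine le_trans (le_of_eq ?_) this
  refine lintegral_congr fun q => lintegral_congr fun q' => ?_
  rw [mul_comm]

theorem lintegral_comp_add_mul {F : ℝ × ℝ → ℝ≥0∞} (hF : Measurable F)
    {b : (ℝ × ℝ) × ℝ × ℝ → ℝ≥0∞} (hb : Measurable b) :
    ∫⁻ y : (ℝ × ℝ) × ℝ × ℝ, F (y.1 + y.2) * b y = ∫⁻ P, F P * ∫⁻ p, b (p, P - p) := by
  have h1 : ∀ P, F P * ∫⁻ p, b (p, P - p) = ∫⁻ p, F P * b (p, P - p) := by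
    intro P
    have : Measurable fun p => b (p, P - p) := by fun_prop
    rw [lintegral_const_mul _ this]
  simp only [h1]
  rw [lintegral_lintegral_swap (by fun_prop), Measure.volume_eq_prod,
    lintegral_prod _ (by fun_prop)]
  refine lintegral_congr fun p => ?_
  rw [← lintegral_add_left_eq_self (fun P => F P * b (p, P - p)) p]
  refine lintegral_congr fun q => ?_
  simp only [add_sub_cancel_left]

theorem lintegral_lintegral_conv_add_le {κ : ℝ × ℝ → ℝ≥0∞} (hκ : Measurable κ)
    {b : (ℝ × ℝ) × ℝ × ℝ → ℝ≥0∞} (hb : Measurable b) :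
    ∫⁻ y : (ℝ × ℝ) × ℝ × ℝ, ∫⁻ y' : (ℝ × ℝ) × ℝ × ℝ, b y * b y' * κ ((y.1 + y.2) - (y'.1 + y'.2)) ≤
      (∫⁻ P, κ P) * ∫⁻ P, (∫⁻ p, b (p, P - p)) ^ 2 := by
  have hA : Measurable fun P => ∫⁻ p, b (p, P - p) := by
    have : Measurable (Function.uncurry fun P p : ℝ × ℝ => b (p, P - p)) := by
      unfold Function.uncurry
      fun_prop
    exact this.lintegral_prod_right'
  refine le_trans (le_of_eq ?_) (lintegral_lintegral_conv_mul_mul_le hκ hA)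
  have h1 : ∀ y : (ℝ × ℝ) × ℝ × ℝ,
      ∫⁻ y' : (ℝ × ℝ) × ℝ × ℝ, b y * b y' * κ ((y.1 + y.2) - (y'.1 + y'.2)) =
      (∫⁻ P', κ ((y.1 + y.2) - P') * ∫⁻ p, b (p, P' - p)) * b y := by
    intro y
    have hF : Measurable fun P' => κ ((y.1 + y.2) - P') := by fun_prop
    rw [← lintegral_comp_add_mul hF hb, ← lintegral_mul_const _ (by fun_prop)]
    exact lintegral_congr fun y' => by ring
  simp only [h1]
  have hF : Measurable fun P => ∫⁻ P', κ (P - P') * ∫⁻ p, b (p, P' - p) := by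
    have : Measurable (Function.uncurry fun P P' : ℝ × ℝ => κ (P - P') * ∫⁻ p, b (p, P' - p)) := by
      unfold Function.uncurry
      exact (hκ.comp (measurable_fst.sub measurable_snd)).mul (hA.comp measurable_snd)
    exact this.lintegral_prod_right'
  rw [lintegral_comp_add_mul hF hb]
  refine lintegral_congr fun P => ?_
  have : Measurable fun P' => κ (P - P') * ∫⁻ p, b (p, P' - p) :=
    (hκ.comp (measurable_const.sub measurable_id)).mul hA
  rw [← lintegral_mul_const _ this]
  exact lintegral_congr fun P' => by ring

theorem lintegral_gaussKernel_le_posForm {ω : ℝ × ℝ → ℝ} (hω : Measurable ω)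
    {g : ℝ × ℝ → ℝ≥0∞} (hg : Measurable g) {ε : ℝ} (hε : 0 < ε) :
    ∫⁻ y : (ℝ × ℝ) × ℝ × ℝ, ∫⁻ y' : (ℝ × ℝ) × ℝ × ℝ, (g y.1 * g y.2) * (g y'.1 * g y'.2) *
      (gaussKernel ε ((ω y.1 + ω y.2) - (ω y'.1 + ω y'.2)) *
        (gaussKernel ε ((y.1 + y.2) - (y'.1 + y'.2)).1 *
          gaussKernel ε ((y.1 + y.2) - (y'.1 + y'.2)).2)) ≤
      ENNReal.ofReal (2 * Real.pi) ^ 3 * posForm ω (gaussDensity ε) g := by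
  obtain ⟨κ, hκdef⟩ : ∃ κ : ℝ × ℝ → ℝ≥0∞, ∀ q, κ q = gaussKernel ε q.1 * gaussKernel ε q.2 :=
    ⟨_, fun _ => rfl⟩
  obtain ⟨b, hbdef⟩ : ∃ b : ℝ → (ℝ × ℝ) × ℝ × ℝ → ℝ≥0∞, ∀ τ y,
      b τ y = gaussDensity ε (τ - ω y.1 - ω y.2) * (g y.1 * g y.2) := ⟨_, fun _ _ => rfl⟩
  have hdm := measurable_gaussDensity ε
  have hkm := measurable_gaussKernel ε
  have hκm : Measurable κ := by
    rw [funext hκdef]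
    exact (hkm.comp measurable_fst).mul (hkm.comp measurable_snd)
  have hκ : ∫⁻ q : ℝ × ℝ, κ q = ENNReal.ofReal (2 * Real.pi) ^ 2 := by
    simp only [hκdef]
    rw [Measure.volume_eq_prod, lintegral_prod_mul hkm.aemeasurable hkm.aemeasurable,
      lintegral_gaussKernel hε, sq]
  have hbm : Measurable fun u : ℝ × (ℝ × ℝ) × ℝ × ℝ => b u.1 u.2 := by
    simp only [hbdef]
    have h1 : Measurable fun u : ℝ × (ℝ × ℝ) × ℝ × ℝ => u.1 - ω u.2.1 - ω u.2.2 :=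
      (measurable_fst.sub (hω.comp measurable_snd.fst)).sub (hω.comp measurable_snd.snd)
    exact (hdm.comp h1).mul ((hg.comp measurable_snd.fst).mul (hg.comp measurable_snd.snd))
  have hbτ : ∀ τ, Measurable (b τ) := fun τ => hbm.comp (measurable_const.prodMk measurable_id)
  have h1 : ∀ y y' : (ℝ × ℝ) × ℝ × ℝ, (g y.1 * g y.2) * (g y'.1 * g y'.2) *
      (gaussKernel ε ((ω y.1 + ω y.2) - (ω y'.1 + ω y'.2)) * κ ((y.1 + y.2) - (y'.1 + y'.2))) =
      ENNReal.ofReal (2 * Real.pi) *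
        ∫⁻ τ, b τ y * b τ y' * κ ((y.1 + y.2) - (y'.1 + y'.2)) := by
    intro y y'
    have hm : Measurable fun τ => gaussDensity ε (τ - (ω y.1 + ω y.2)) *
      gaussDensity ε (τ - (ω y'.1 + ω y'.2)) := by fun_prop
    rw [gaussKernel_sub_eq hε, mul_assoc (ENNReal.ofReal _), mul_left_comm,
      ← lintegral_mul_const _ hm, ← lintegral_const_mul _ (by fun_prop)]
    congr 1
    refine lintegral_congr fun τ => ?_
    simp only [hbdef, ← sub_sub]
    ring
  have h2 : Measurable fun u : (((ℝ × ℝ) × ℝ × ℝ) × (ℝ × ℝ) × ℝ × ℝ) × ℝ =>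
      b u.2 u.1.1 * b u.2 u.1.2 * κ ((u.1.1.1 + u.1.1.2) - (u.1.2.1 + u.1.2.2)) := by
    refine Measurable.mul (Measurable.mul ?_ ?_) ?_
    · exact hbm.comp (measurable_snd.prodMk measurable_fst.fst)
    · exact hbm.comp (measurable_snd.prodMk measurable_fst.snd)
    · exact hκm.comp (by fun_prop)
  have h3 : ∫⁻ y : (ℝ × ℝ) × ℝ × ℝ, ∫⁻ y' : (ℝ × ℝ) × ℝ × ℝ,
      ∫⁻ τ, b τ y * b τ y' * κ ((y.1 + y.2) - (y'.1 + y'.2)) =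
      ∫⁻ τ, ∫⁻ y : (ℝ × ℝ) × ℝ × ℝ, ∫⁻ y' : (ℝ × ℝ) × ℝ × ℝ, b τ y * b τ y' * κ ((y.1 + y.2) - (y'.1 + y'.2)) := by
    rw [lintegral_lintegral_swap (α := ℝ)]
    · refine lintegral_congr fun y => ?_
      rw [lintegral_lintegral_swap (α := ℝ)]
      have : Measurable fun u : ℝ × (ℝ × ℝ) × ℝ × ℝ =>
          b u.1 y * b u.1 u.2 * κ ((y.1 + y.2) - (u.2.1 + u.2.2)) :=
        h2.comp ((measurable_const.prodMk measurable_snd).prodMk measurable_fst)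
      exact this.aemeasurable
    · have : Measurable fun u : (ℝ × (ℝ × ℝ) × ℝ × ℝ) × (ℝ × ℝ) × ℝ × ℝ =>
          b u.1.1 u.1.2 * b u.1.1 u.2 * κ ((u.1.2.1 + u.1.2.2) - (u.2.1 + u.2.2)) :=
        h2.comp ((measurable_fst.snd.prodMk measurable_snd).prodMk measurable_fst.fst)
      exact this.lintegral_prod_right'.aemeasurable
  have hA : Measurable fun u : ℝ × ℝ × ℝ => ∫⁻ p, b u.1 (p, u.2 - p) := by
    have : Measurable fun w : (ℝ × ℝ × ℝ) × ℝ × ℝ => b w.1.1 (w.2, w.1.2 - w.2) :=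
      hbm.comp (measurable_fst.fst.prodMk
        (measurable_snd.prodMk (measurable_fst.snd.sub measurable_snd)))
    exact this.lintegral_prod_right'
  have h4 : posForm ω (gaussDensity ε) g = ∫⁻ τ, ∫⁻ P, (∫⁻ p, b τ (p, P - p)) ^ 2 := by
    rw [lintegral_lintegral_swap (hA.pow_const 2).aemeasurable]
    simp only [hbdef]
    rfl
  have h5 : Measurable fun u : ((ℝ × ℝ) × ℝ × ℝ) × (ℝ × ℝ) × ℝ × ℝ =>
      ∫⁻ τ, b τ u.1 * b τ u.2 * κ ((u.1.1 + u.1.2) - (u.2.1 + u.2.2)) := h2.lintegral_prod_right'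
  simp only [← hκdef]
  calc _ = ENNReal.ofReal (2 * Real.pi) * ∫⁻ y : (ℝ × ℝ) × ℝ × ℝ, ∫⁻ y' : (ℝ × ℝ) × ℝ × ℝ,
        ∫⁻ τ, b τ y * b τ y' * κ ((y.1 + y.2) - (y'.1 + y'.2)) := by
        rw [← lintegral_const_mul _ h5.lintegral_prod_right']
        refine lintegral_congr fun y => ?_
        have h6 : Measurable fun y' : (ℝ × ℝ) × ℝ × ℝ =>
          ∫⁻ τ, b τ y * b τ y' * κ ((y.1 + y.2) - (y'.1 + y'.2)) :=
          h5.comp (measurable_const.prodMk measurable_id)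
        rw [← lintegral_const_mul _ h6]
        exact lintegral_congr fun y' => h1 y y'
    _ ≤ ENNReal.ofReal (2 * Real.pi) * ∫⁻ τ, ENNReal.ofReal (2 * Real.pi) ^ 2 *
        ∫⁻ P, (∫⁻ p, b τ (p, P - p)) ^ 2 := by
        rw [h3, ← hκ]
        gcongr with τ
        exact lintegral_lintegral_conv_add_le hκm (hbτ τ)
    _ = _ := by
        rw [lintegral_const_mul, h4]
        · ring
        · exact (hA.pow_const 2).lintegral_prod_right'

/-- The phase `x ξ + y μ + t ω(ξ, μ)`. -/
def extPhase (ω : ℝ × ℝ → ℝ) (z : ℝ × ℝ × ℝ) (p : ℝ × ℝ) : ℝ :=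
  z.2.1 * p.1 + z.2.2 * p.2 + z.1 * ω p

/-- The Fourier extension operator of the graph of `ω`. -/
def extension (ω : ℝ × ℝ → ℝ) (G : ℝ × ℝ → ℂ) (z : ℝ × ℝ × ℝ) : ℂ :=
  ∫ p, Complex.exp (Complex.I * extPhase ω z p) * G p

theorem measurable_uncurry_extPhase {ω : ℝ × ℝ → ℝ} (hω : Measurable ω) :
    Measurable fun u : (ℝ × ℝ × ℝ) × ℝ × ℝ => extPhase ω u.1 u.2 := by
  unfold extPhase
  have h1 : Measurable fun u : (ℝ × ℝ × ℝ) × ℝ × ℝ => u.1.1 * ω u.2 :=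
    measurable_fst.fst.mul (hω.comp measurable_snd)
  exact Measurable.add (by fun_prop) h1

theorem measurable_extension {ω : ℝ × ℝ → ℝ} (hω : Measurable ω) {G : ℝ × ℝ → ℂ}
    (hG : Measurable G) : Measurable (extension ω G) := by
  unfold extension
  have h1 := measurable_uncurry_extPhase hω
  have : Measurable (Function.uncurry fun (z : ℝ × ℝ × ℝ) (p : ℝ × ℝ) =>
      Complex.exp (Complex.I * extPhase ω z p) * G p) := by
    unfold Function.uncurry
    exact (Complex.measurable_exp.comp ((Complex.measurable_ofReal.comp h1).const_mul _)).mul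
      (hG.comp measurable_snd)
  exact (this.stronglyMeasurable.integral_prod_right (ν := volume)).measurable

theorem lintegral_extension_pow_four_le {ω : ℝ × ℝ → ℝ} (hω : Measurable ω) {G : ℝ × ℝ → ℂ}
    (hGm : Measurable G) (hG : Integrable G) {D : ℝ≥0∞}
    (hD : ∀ χ : ℝ → ℝ≥0∞, Measurable χ → ∫⁻ s, χ s ≤ 1 → posForm ω χ (fun p => ‖G p‖ₑ) ≤ D) :
    ∫⁻ z, ‖extension ω G z‖ₑ ^ 4 ≤ ENNReal.ofReal (2 * Real.pi) ^ 3 * D := by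
  refine lintegral_le_of_forall_gaussian
    (q := fun z : ℝ × ℝ × ℝ => z.1 ^ 2 + (z.2.1 ^ 2 + z.2.2 ^ 2)) (by fun_prop)
    ((measurable_extension hω hGm).enorm.pow_const 4).aemeasurable fun ε hε => ?_
  have hexp : ∀ z : ℝ × ℝ × ℝ, Real.exp (-ε * (z.1 ^ 2 + (z.2.1 ^ 2 + z.2.2 ^ 2))) =
      Real.exp (-ε * z.1 ^ 2) * (Real.exp (-ε * z.2.1 ^ 2) * Real.exp (-ε * z.2.2 ^ 2)) := by
    intro z
    rw [← Real.exp_add, ← Real.exp_add]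
    congr 1
    ring
  have hg := integrable_exp_neg_mul_sq hε
  have hkm := measurable_gaussKernel ε
  have hphase := measurable_uncurry_extPhase hω
  have key := lintegral_mul_enorm_integral_sq_le (μ := (volume : Measure ((ℝ × ℝ) × ℝ × ℝ)))
    (ν := (volume : Measure (ℝ × ℝ × ℝ)))
    (e := fun z y => Complex.exp (Complex.I * ((extPhase ω z y.1 + extPhase ω z y.2 : ℝ) : ℂ)))
    (by
      unfold Function.uncurry
      have h1 : Measurable fun u : (ℝ × ℝ × ℝ) × (ℝ × ℝ) × ℝ × ℝ =>
          extPhase ω u.1 u.2.1 + extPhase ω u.1 u.2.2 :=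
        (hphase.comp (measurable_fst.prodMk measurable_snd.fst)).add
          (hphase.comp (measurable_fst.prodMk measurable_snd.snd))
      exact Complex.measurable_exp.comp ((Complex.measurable_ofReal.comp h1).const_mul _))
    (fun z y => (norm_exp_I_mul_ofReal _).le)
    (c := fun z => Real.exp (-ε * z.1 ^ 2) *
      (Real.exp (-ε * z.2.1 ^ 2) * Real.exp (-ε * z.2.2 ^ 2)))
    (fun z => by positivity) (hg.mul_prod (hg.mul_prod hg))
    (H := fun y => G y.1 * G y.2) (hG.mul_prod hG)
    (k := fun y y' => gaussKernel ε ((ω y.1 + ω y.2) - (ω y'.1 + ω y'.2)) *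
        (gaussKernel ε ((y.1 + y.2) - (y'.1 + y'.2)).1 *
          gaussKernel ε ((y.1 + y.2) - (y'.1 + y'.2)).2)) (fun y y' => by
      have h1 : ∀ z : ℝ × ℝ × ℝ,
          ((Real.exp (-ε * z.1 ^ 2) *
            (Real.exp (-ε * z.2.1 ^ 2) * Real.exp (-ε * z.2.2 ^ 2)) : ℝ) : ℂ) *
            (Complex.exp (Complex.I * ((extPhase ω z y.1 + extPhase ω z y.2 : ℝ) : ℂ)) *
              starRingEnd ℂ
                (Complex.exp (Complex.I * ((extPhase ω z y'.1 + extPhase ω z y'.2 : ℝ) : ℂ)))) =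
          ((Real.exp (-ε * z.1 ^ 2) : ℂ) * Complex.exp (Complex.I *
            (((ω y.1 + ω y.2) - (ω y'.1 + ω y'.2) : ℝ) * z.1))) *
          (((Real.exp (-ε * z.2.1 ^ 2) : ℂ) * Complex.exp (Complex.I *
            ((((y.1 + y.2) - (y'.1 + y'.2)).1 : ℝ) * z.2.1))) *
          ((Real.exp (-ε * z.2.2 ^ 2) : ℂ) * Complex.exp (Complex.I *
            ((((y.1 + y.2) - (y'.1 + y'.2)).2 : ℝ) * z.2.2)))) := by
        intro z
        rw [conj_exp_I_mul_ofReal, ← Complex.exp_add, mul_mul_mul_comm (Real.exp (-ε * z.2.1 ^ 2) : ℂ),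
          mul_mul_mul_comm, ← Complex.exp_add, ← Complex.exp_add]
        simp only [extPhase]
        push_cast [Prod.fst_sub, Prod.snd_sub, Prod.fst_add, Prod.snd_add]
        congr 2
        ring
      simp only [h1]
      rw [Measure.volume_eq_prod, integral_prod_mul
        (fun x : ℝ => (Real.exp (-ε * x ^ 2) : ℂ) *
            Complex.exp (Complex.I * (((ω y.1 + ω y.2) - (ω y'.1 + ω y'.2) : ℝ) * x)))
        (fun w : ℝ × ℝ => ((Real.exp (-ε * w.1 ^ 2) : ℂ) * Complex.exp (Complex.I *
            ((((y.1 + y.2) - (y'.1 + y'.2)).1 : ℝ) * w.1))) *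
          ((Real.exp (-ε * w.2 ^ 2) : ℂ) * Complex.exp (Complex.I *
            ((((y.1 + y.2) - (y'.1 + y'.2)).2 : ℝ) * w.2)))),
        Measure.volume_eq_prod, integral_prod_mul
        (fun x : ℝ => (Real.exp (-ε * x ^ 2) : ℂ) *
            Complex.exp (Complex.I * ((((y.1 + y.2) - (y'.1 + y'.2)).1 : ℝ) * x)))
        (fun x : ℝ => (Real.exp (-ε * x ^ 2) : ℂ) *
            Complex.exp (Complex.I * ((((y.1 + y.2) - (y'.1 + y'.2)).2 : ℝ) * x))),
        enorm_mul, enorm_mul, enorm_integral_gaussian_mul_exp hε,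
        enorm_integral_gaussian_mul_exp hε, enorm_integral_gaussian_mul_exp hε])
  have hsq : ∀ z, ‖∫ y : (ℝ × ℝ) × ℝ × ℝ,
      Complex.exp (Complex.I * ((extPhase ω z y.1 + extPhase ω z y.2 : ℝ) : ℂ)) *
        (G y.1 * G y.2)‖ₑ ^ 2 = ‖extension ω G z‖ₑ ^ 4 := by
    intro z
    have h1 : ∀ y : (ℝ × ℝ) × ℝ × ℝ,
        Complex.exp (Complex.I * ((extPhase ω z y.1 + extPhase ω z y.2 : ℝ) : ℂ)) *
        (G y.1 * G y.2) = (Complex.exp (Complex.I * extPhase ω z y.1) * G y.1) *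
          (Complex.exp (Complex.I * extPhase ω z y.2) * G y.2) := by
      intro y
      rw [mul_mul_mul_comm, ← Complex.exp_add, ← mul_add, Complex.ofReal_add]
    simp only [h1]
    rw [Measure.volume_eq_prod, integral_prod_mul
      (fun p => Complex.exp (Complex.I * extPhase ω z p) * G p)
      (fun p => Complex.exp (Complex.I * extPhase ω z p) * G p), enorm_mul, ← sq, ← pow_mul]
    rfl
  simp only [hexp]
  simp only [hsq] at key
  refine key.trans ?_
  have hm : Measurable fun w : ((ℝ × ℝ) × ℝ × ℝ) × (ℝ × ℝ) × ℝ × ℝ =>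
      ‖G w.1.1 * G w.1.2‖ₑ * ‖G w.2.1 * G w.2.2‖ₑ *
      (gaussKernel ε ((ω w.1.1 + ω w.1.2) - (ω w.2.1 + ω w.2.2)) *
        (gaussKernel ε ((w.1.1 + w.1.2) - (w.2.1 + w.2.2)).1 *
          gaussKernel ε ((w.1.1 + w.1.2) - (w.2.1 + w.2.2)).2)) := by
    have hGG : Measurable fun y : (ℝ × ℝ) × ℝ × ℝ => ‖G y.1 * G y.2‖ₑ :=
      ((hGm.comp measurable_fst).mul (hGm.comp measurable_snd)).enorm
    have hωω : Measurable fun y : (ℝ × ℝ) × ℝ × ℝ => ω y.1 + ω y.2 :=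
      (hω.comp measurable_fst).add (hω.comp measurable_snd)
    have hss : Measurable fun w : ((ℝ × ℝ) × ℝ × ℝ) × (ℝ × ℝ) × ℝ × ℝ =>
      (w.1.1 + w.1.2) - (w.2.1 + w.2.2) := by fun_prop
    exact ((hGG.comp measurable_fst).mul (hGG.comp measurable_snd)).mul
      ((hkm.comp ((hωω.comp measurable_fst).sub (hωω.comp measurable_snd))).mul
        ((hkm.comp hss.fst).mul (hkm.comp hss.snd)))
  rw [lintegral_prod _ hm.aemeasurable]
  simp only [enorm_mul]
  refine (lintegral_gaussKernel_le_posForm hω hGm.enorm hε).trans ?_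
  gcongr
  exact hD _ (measurable_gaussDensity ε) (lintegral_gaussDensity hε).le

theorem hasTemperateGrowth_fderiv_apply {f : ℝ × ℝ → ℝ} (hf : f.HasTemperateGrowth) (v : ℝ × ℝ) :
    (fun p => fderiv ℝ f p v).HasTemperateGrowth := by
  have h1 : (fderiv ℝ f).HasTemperateGrowth := by
    refine ⟨hf.1.fderiv_right (by simp), fun n => ?_⟩
    obtain ⟨k, C, h⟩ := hf.2 (n + 1)
    exact ⟨k, C, fun x => by rw [norm_iteratedFDeriv_fderiv]; exact h x⟩
  exact (ContinuousLinearMap.apply ℝ ℝ v).hasTemperateGrowth.comp h1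

theorem hasTemperateGrowth_pdx {f : ℝ × ℝ → ℝ} (hf : f.HasTemperateGrowth) :
    (pdx f).HasTemperateGrowth := by
  rw [show pdx f = fun p => fderiv ℝ f p (1, 0) from
    funext fun p => pdx_eq_fderiv (hf.1.differentiable (by simp) p)]
  exact hasTemperateGrowth_fderiv_apply hf _

theorem hasTemperateGrowth_pdy {f : ℝ × ℝ → ℝ} (hf : f.HasTemperateGrowth) :
    (pdy f).HasTemperateGrowth := by
  rw [show pdy f = fun p => fderiv ℝ f p (0, 1) from
    funext fun p => pdy_eq_fderiv (hf.1.differentiable (by simp) p)]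
  exact hasTemperateGrowth_fderiv_apply hf _

theorem hasTemperateGrowth_hessDet {f : ℝ × ℝ → ℝ} (hf : f.HasTemperateGrowth) :
    (hessDet f).HasTemperateGrowth := by
  have h1 := hasTemperateGrowth_pdx (hasTemperateGrowth_pdx hf)
  have h2 := hasTemperateGrowth_pdy (hasTemperateGrowth_pdy hf)
  have h3 := hasTemperateGrowth_pdx (hasTemperateGrowth_pdy hf)
  unfold hessDet
  fun_prop

theorem hasTemperateGrowth_form (d : ℕ) (b : ℕ → ℝ) : (form d b).HasTemperateGrowth := by
  have h1 : (fun p : ℝ × ℝ => p.1).HasTemperateGrowth :=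
    (ContinuousLinearMap.fst ℝ ℝ ℝ).hasTemperateGrowth
  have h2 : (fun p : ℝ × ℝ => p.2).HasTemperateGrowth :=
    (ContinuousLinearMap.snd ℝ ℝ ℝ).hasTemperateGrowth
  unfold form
  fun_prop

/-- The Fourier transform of a Schwartz function on `ℝ × ℝ` is a Schwartz function. -/
theorem exists_schwartzMap_eq_ftn2 (f : SchwartzMap (ℝ × ℝ) ℂ) :
    ∃ g : SchwartzMap (ℝ × ℝ) ℂ, ⇑g = ftn2 f := by
  set e := WithLp.prodContinuousLinearEquiv 2 ℝ ℝ ℝ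
  set s : (ℝ × ℝ) ≃L[ℝ] WithLp 2 (ℝ × ℝ) := (ContinuousLinearEquiv.smulLeft
    (Units.mk0 ((2 * Real.pi)⁻¹ : ℝ) (by positivity))).trans e.symm
  refine ⟨SchwartzMap.compCLMOfContinuousLinearEquiv ℂ s
    (FourierTransform.fourier (SchwartzMap.compCLMOfContinuousLinearEquiv ℂ e f)), ?_⟩
  funext p
  rw [SchwartzMap.compCLMOfContinuousLinearEquiv_apply, Function.comp_apply,
    SchwartzMap.fourier_coe, Real.fourier_eq']
  unfold ftn2
  rw [← (WithLp.volume_preserving_ofLp ℝ ℝ).integral_comp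
    (MeasurableEquiv.toLp 2 (ℝ × ℝ)).symm.measurableEmbedding]
  refine integral_congr_ae (ae_of_all _ fun x => ?_)
  simp only [SchwartzMap.compCLMOfContinuousLinearEquiv_apply, Function.comp_apply, smul_eq_mul]
  have hp : s p = WithLp.toLp 2 ((2 * Real.pi)⁻¹ * p.1, (2 * Real.pi)⁻¹ * p.2) := rfl
  have hx : e x = x.ofLp := rfl
  have hin : -2 * Real.pi * inner ℝ x (s p) = -(x.ofLp.1 * p.1 + x.ofLp.2 * p.2) := by
    rw [hp]
    simp only [WithLp.prod_inner_apply, RCLike.inner_apply, conj_trivial]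
    field_simp
  rw [hin, hx]
  congr 2
  push_cast
  ring

theorem integrable_rpow_hessDet_mul_ftn2 {ω : ℝ × ℝ → ℝ} (hω : ω.HasTemperateGrowth)
    (f : SchwartzMap (ℝ × ℝ) ℂ) :
    Integrable fun p => ((|hessDet ω p| ^ ((1 : ℝ) / 8) : ℝ) : ℂ) * ftn2 f p := by
  obtain ⟨g, hg⟩ := exists_schwartzMap_eq_ftn2 f
  obtain ⟨k, C, hK⟩ := (hasTemperateGrowth_hessDet hω).2 0
  simp only [norm_iteratedFDeriv_zero] at hK
  have hg1 := g.integrable (μ := volume)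
  have hg2 := g.integrable_pow_mul volume k
  have hG : Integrable fun p => ‖g p‖ + C * (2 ^ (k - 1) * (‖g p‖ + ‖p‖ ^ k * ‖g p‖)) :=
    hg1.norm.add (((hg1.norm.add hg2).const_mul _).const_mul _)
  rw [← hg]
  have hc := continuous_rpow_hessDet hω.1
  refine hG.mono ((Complex.continuous_ofReal.comp hc).mul g.continuous).aestronglyMeasurable
    (ae_of_all _ fun p => ?_)
  have hC : 0 ≤ C := by
    have := (norm_nonneg _).trans (hK 0)
    simpa using this
  have h1 : |hessDet ω p| ^ ((1 : ℝ) / 8) ≤ 1 + |hessDet ω p| := by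
    calc |hessDet ω p| ^ ((1 : ℝ) / 8) ≤ (1 + |hessDet ω p|) ^ ((1 : ℝ) / 8) := by
          gcongr; linarith
      _ ≤ (1 + |hessDet ω p|) ^ (1 : ℝ) :=
          Real.rpow_le_rpow_of_exponent_le (by linarith [abs_nonneg (hessDet ω p)]) (by norm_num)
      _ = _ := Real.rpow_one _
  have h2 : (1 + ‖p‖) ^ k ≤ 2 ^ (k - 1) * (1 ^ k + ‖p‖ ^ k) :=
    add_pow_le zero_le_one (norm_nonneg _) k
  rw [one_pow] at h2
  rw [norm_mul, Complex.norm_real, Real.norm_of_nonneg (by positivity),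
    Real.norm_of_nonneg (by positivity)]
  calc |hessDet ω p| ^ ((1 : ℝ) / 8) * ‖g p‖
      ≤ (1 + C * (2 ^ (k - 1) * (1 + ‖p‖ ^ k))) * ‖g p‖ := by
        gcongr
        refine h1.trans ?_
        have := hK p
        rw [Real.norm_eq_abs] at this
        gcongr
        exact this.trans (by gcongr)
    _ = _ := by ring

/-- The `L² → L⁴` estimate for the damped extension operator restricted to `S`. -/
def ExtBound (ω : ℝ × ℝ → ℝ) (S : Set (ℝ × ℝ)) : Prop :=
  ∃ C : ℝ≥0, ∀ φ : ℝ × ℝ → ℂ, Measurable φ →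
    Integrable (fun p => ((|hessDet ω p| ^ ((1 : ℝ) / 8) : ℝ) : ℂ) * φ p) →
    eLpNorm (extension ω
      (S.indicator fun p => ((|hessDet ω p| ^ ((1 : ℝ) / 8) : ℝ) : ℂ) * φ p)) 4 volume ≤
      C * (∫⁻ p, ‖φ p‖ₑ ^ 2) ^ ((1 : ℝ) / 2)

theorem indicator_damping_mul_indicator (ω : ℝ × ℝ → ℝ) (S T : Set (ℝ × ℝ)) (φ : ℝ × ℝ → ℂ) :
    (S.indicator fun p => ((|hessDet ω p| ^ ((1 : ℝ) / 8) : ℝ) : ℂ) * T.indicator φ p) =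
      (S ∩ T).indicator fun p => ((|hessDet ω p| ^ ((1 : ℝ) / 8) : ℝ) : ℂ) * φ p := by
  rw [← Set.indicator_indicator]
  congr 1
  funext p
  by_cases hp : p ∈ T <;> simp [hp]

theorem lintegral_enorm_indicator_sq_le (T : Set (ℝ × ℝ)) (φ : ℝ × ℝ → ℂ) :
    ∫⁻ p, ‖T.indicator φ p‖ₑ ^ 2 ≤ ∫⁻ p, ‖φ p‖ₑ ^ 2 := by
  refine lintegral_mono fun p => ?_
  gcongr
  by_cases hp : p ∈ T <;> simp [hp]

theorem integrable_damping_mul_indicator {ω : ℝ × ℝ → ℝ} {T : Set (ℝ × ℝ)} (hT : MeasurableSet T)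
    {φ : ℝ × ℝ → ℂ} (h : Integrable fun p => ((|hessDet ω p| ^ ((1 : ℝ) / 8) : ℝ) : ℂ) * φ p) :
    Integrable fun p => ((|hessDet ω p| ^ ((1 : ℝ) / 8) : ℝ) : ℂ) * T.indicator φ p := by
  have := h.indicator hT
  rw [← Set.univ_inter T, ← indicator_damping_mul_indicator, Set.indicator_univ] at this
  exact this

theorem ExtBound.mono {ω : ℝ × ℝ → ℝ} {S T : Set (ℝ × ℝ)} (hT : ExtBound ω T)
    (hS : MeasurableSet S) (hST : S ⊆ T) : ExtBound ω S := by
  obtain ⟨C, hC⟩ := hT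
  refine ⟨C, fun φ hφ hi => ?_⟩
  have := hC (S.indicator φ) (hφ.indicator hS) (integrable_damping_mul_indicator hS hi)
  rw [indicator_damping_mul_indicator, Set.inter_eq_right.2 hST] at this
  exact this.trans (mul_le_mul' le_rfl
    (ENNReal.rpow_le_rpow (lintegral_enorm_indicator_sq_le _ _) (by norm_num)))

theorem extension_add (ω : ℝ × ℝ → ℝ) (hω : Measurable ω) {F G : ℝ × ℝ → ℂ} (hF : Integrable F)
    (hG : Integrable G) :
    extension ω (fun p => F p + G p) = extension ω F + extension ω G := by
  funext z
  have h1 : Measurable fun p => Complex.exp (Complex.I * extPhase ω z p) :=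
    Complex.measurable_exp.comp ((Complex.measurable_ofReal.comp
      ((measurable_uncurry_extPhase hω).comp (measurable_const.prodMk measurable_id))).const_mul _)
  have h2 : ∀ᵐ p, ‖Complex.exp (Complex.I * extPhase ω z p)‖ ≤ 1 :=
    ae_of_all _ fun p => (norm_exp_I_mul_ofReal _).le
  simp only [extension, Pi.add_apply, mul_add]
  exact integral_add (hF.bdd_mul h1.aestronglyMeasurable h2)
    (hG.bdd_mul h1.aestronglyMeasurable h2)

theorem ExtBound.union {ω : ℝ × ℝ → ℝ} (hω : SmoothFun ω) {S T : Set (ℝ × ℝ)}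
    (hS : ExtBound ω S) (hT : ExtBound ω T) (hSm : MeasurableSet S) (hTm : MeasurableSet T) :
    ExtBound ω (S ∪ T) := by
  obtain ⟨C, hC⟩ := hS
  obtain ⟨C', hC'⟩ := hT.mono (hTm.diff hSm) Set.sdiff_subset
  refine ⟨C + C', fun φ hφ hi => ?_⟩
  have hm : Measurable fun p => ((|hessDet ω p| ^ ((1 : ℝ) / 8) : ℝ) : ℂ) * φ p :=
    (Complex.measurable_ofReal.comp (continuous_rpow_hessDet hω).measurable).mul hφ
  have hωm : Measurable ω := hω.continuous.measurable
  rw [← Set.union_sdiff_self, Set.indicator_union_of_disjoint Set.disjoint_sdiff_right,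
    extension_add ω hωm (hi.indicator hSm) (hi.indicator (hTm.diff hSm))]
  refine (eLpNorm_add_le (measurable_extension hωm (hm.indicator hSm)).aestronglyMeasurable
    (measurable_extension hωm (hm.indicator (hTm.diff hSm))).aestronglyMeasurable
    (by norm_num)).trans ?_
  rw [ENNReal.coe_add, add_mul]
  exact add_le_add (hC φ hφ hi) (hC' φ hφ hi)

theorem extBound_of_null {ω : ℝ × ℝ → ℝ} {S : Set (ℝ × ℝ)} (hS : volume S = 0) :
    ExtBound ω S := by
  refine ⟨0, fun φ _ _ => ?_⟩
  have : extension ω (S.indicator fun p => ((|hessDet ω p| ^ ((1 : ℝ) / 8) : ℝ) : ℂ) * φ p) = 0 := by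
    funext z
    unfold extension
    rw [Pi.zero_apply]
    refine integral_eq_zero_of_ae ?_
    filter_upwards [compl_mem_ae_iff.2 hS] with p hp
    simp [Set.indicator_of_notMem hp]
  rw [this]
  simp

theorem PosBound.extBound {ω : ℝ × ℝ → ℝ} (hω : SmoothFun ω) {S : Set (ℝ × ℝ)}
    (hS : MeasurableSet S) (h : PosBound ω (damping ω) S) : ExtBound ω S := by
  obtain ⟨C, hC⟩ := h
  have hp : (0 : ℝ) ≤ 1 / 4 := by norm_num
  refine ⟨((ENNReal.ofReal (2 * Real.pi) ^ 3 * C) ^ ((1 : ℝ) / 4)).toNNReal, fun φ hφ hi => ?_⟩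
  rw [ENNReal.coe_toNNReal (by
    refine ENNReal.rpow_ne_top_of_nonneg hp (ENNReal.mul_ne_top ?_ ENNReal.coe_ne_top)
    exact ENNReal.pow_ne_top ENNReal.ofReal_ne_top)]
  set N := ∫⁻ p, ‖φ p‖ₑ ^ 2 with hN
  set G := S.indicator fun p => ((|hessDet ω p| ^ ((1 : ℝ) / 8) : ℝ) : ℂ) * φ p with hG
  have hm : Measurable G :=
    ((Complex.measurable_ofReal.comp (continuous_rpow_hessDet hω).measurable).mul hφ).indicator hS
  have hGn : ∀ p, ‖G p‖ₑ = damping ω p * ‖S.indicator φ p‖ₑ := by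
    intro p
    by_cases hpS : p ∈ S
    · simp only [hG, Set.indicator_of_mem hpS, enorm_mul]
      congr 1
      rw [← ofReal_norm, Complex.norm_real, Real.norm_of_nonneg (by positivity)]
      rfl
    · simp [hG, hpS]
  have h1 : ∫⁻ z, ‖extension ω G z‖ₑ ^ 4 ≤ ENNReal.ofReal (2 * Real.pi) ^ 3 * (C * N ^ 2) := by
    refine lintegral_extension_pow_four_le hω.continuous.measurable hm (hi.indicator hS)
      fun χ hχ hχ1 => ?_
    simp only [hGn]
    refine (hC χ hχ hχ1 (fun p => ‖S.indicator φ p‖ₑ) (hφ.indicator hS).enorm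
      fun p hpS => by simp [hpS]).trans ?_
    gcongr
    exact lintegral_enorm_indicator_sq_le _ _
  rw [eLpNorm_eq_lintegral_rpow_enorm_toReal (by norm_num) (by norm_num)]
  have h4 : (4 : ℝ≥0∞).toReal = ((4 : ℕ) : ℝ) := by norm_num
  simp only [h4, ENNReal.rpow_natCast]
  calc (∫⁻ z, ‖extension ω G z‖ₑ ^ 4) ^ (1 / ((4 : ℕ) : ℝ))
      ≤ (ENNReal.ofReal (2 * Real.pi) ^ 3 * (C * N ^ 2)) ^ ((1 : ℝ) / 4) := by
        push_cast
        gcongr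
    _ = _ := by
        rw [← mul_assoc, ENNReal.mul_rpow_of_nonneg _ _ hp, ← ENNReal.rpow_natCast N,
          ← ENNReal.rpow_mul]
        norm_num

theorem exists_extBound_nhds {d : ℕ} (hd : 1 ≤ d) {ω : ℝ × ℝ → ℝ} (hsm : SmoothFun ω)
    {P : MvPolynomial (Fin 2) ℝ} (hP : P.IsHomogeneous d)
    (hω : ∀ p : ℝ × ℝ, ω p = MvPolynomial.eval ![p.1, p.2] P) {v : ℝ × ℝ} (hv : v ≠ 0) :
    ∃ U ∈ nhds v, ∃ S, MeasurableSet S ∧ ExtBound ω S ∧ ∀ u ∈ U, ∀ t : ℝ, 0 < t → t • u ∈ S := by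
  obtain ⟨w, h, h', ⟨ε, hε, hpos⟩, ⟨ε', hε', hpos'⟩⟩ := exists_frame_posBound hd hP hω hv
  set L := frame w v h with hL
  have hLv : L.symm v = (0, 1) := by
    rw [ContinuousLinearEquiv.symm_apply_eq, hL, frame_apply]
    simp
  set N : Submodule ℝ (ℝ × ℝ) :=
    LinearMap.ker ((LinearMap.fst ℝ ℝ ℝ).comp (L.symm : (ℝ × ℝ) →ₗ[ℝ] ℝ × ℝ)) with hN
  have hmemN : ∀ q, q ∈ N ↔ (L.symm q).1 = 0 := fun q => Iff.rfl
  have hNm : MeasurableSet (N : Set (ℝ × ℝ)) := N.closed_of_finiteDimensional.measurableSet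
  have hN0 : volume (N : Set (ℝ × ℝ)) = 0 := by
    refine Measure.addHaar_submodule _ _ fun htop => ?_
    have h1 : L (1, 0) ∈ N := htop ▸ Submodule.mem_top
    rw [hmemN, L.symm_apply_apply] at h1
    exact one_ne_zero h1
  have hS : MeasurableSet (L '' sector ε) :=
    L.toHomeomorph.measurableEmbedding.measurableSet_image.2 (measurableSet_sector ε)
  have hS' : MeasurableSet (frame (-w) v h' '' sector ε') :=
    (frame (-w) v h').toHomeomorph.measurableEmbedding.measurableSet_image.2
      (measurableSet_sector ε')
  have hc1 : Continuous fun q => (L.symm q).1 := continuous_fst.comp L.symm.continuous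
  have hc2 : Continuous fun q => (L.symm q).2 := continuous_snd.comp L.symm.continuous
  have hU : IsOpen {q : ℝ × ℝ | (L.symm q).1 < ε * (L.symm q).2 ∧
      -(ε' * (L.symm q).2) < (L.symm q).1 ∧ 0 < (L.symm q).2} :=
    (isOpen_lt hc1 (hc2.const_mul ε)).inter
      ((isOpen_lt (hc2.const_mul ε').neg hc1).inter (isOpen_lt continuous_const hc2))
  refine ⟨_, hU.mem_nhds ?_, L '' sector ε ∪ frame (-w) v h' '' sector ε' ∪ N,
    (hS.union hS').union hNm, ?_, ?_⟩
  · simp only [Set.mem_ofPred_eq, hLv]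
    exact ⟨by simpa using hε, by simpa using hε', one_pos⟩
  · exact ((hpos.extBound hsm hS).union hsm (hpos'.extBound hsm hS') hS hS').union hsm
      (extBound_of_null hN0) (hS.union hS') hNm
  · rintro u ⟨h1, h2, h3⟩ t ht
    have hu : t • u = L (t * (L.symm u).1, t * (L.symm u).2) := by
      conv_lhs => rw [← L.apply_symm_apply u, ← map_smul]
      rfl
    rcases lt_trichotomy (L.symm u).1 0 with h4 | h4 | h4
    · left; right
      refine ⟨(t * -(L.symm u).1, t * (L.symm u).2), ⟨mul_pos ht (neg_pos.2 h4), mul_pos ht h3, ?_⟩,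
        ?_⟩
      · show t * -(L.symm u).1 ≤ ε' * (t * (L.symm u).2)
        rw [mul_left_comm]
        gcongr
        linarith
      · rw [hu, hL, frame_apply, frame_apply]
        simp
    · right
      show t • u ∈ N
      rw [hmemN, map_smul]
      show t * (L.symm u).1 = 0
      rw [h4, mul_zero]
    · left; left
      refine ⟨(t * (L.symm u).1, t * (L.symm u).2), ⟨mul_pos ht h4, mul_pos ht h3, ?_⟩, hu.symm⟩
      show t * (L.symm u).1 ≤ ε * (t * (L.symm u).2)
      rw [mul_left_comm]
      gcongr

/-- The estimate on the whole plane. -/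
theorem extBound_univ {d : ℕ} (hd : 1 ≤ d) {ω : ℝ × ℝ → ℝ} (hsm : SmoothFun ω)
    {P : MvPolynomial (Fin 2) ℝ} (hP : P.IsHomogeneous d)
    (hω : ∀ p : ℝ × ℝ, ω p = MvPolynomial.eval ![p.1, p.2] P) : ExtBound ω Set.univ := by
  have key : ∃ S, MeasurableSet S ∧ ExtBound ω S ∧
      ∀ u ∈ Metric.sphere (0 : ℝ × ℝ) 1, ∀ t : ℝ, 0 < t → t • u ∈ S := by
    refine (isCompact_sphere (0 : ℝ × ℝ) 1).induction_on
      (p := fun s => ∃ S, MeasurableSet S ∧ ExtBound ω S ∧ ∀ u ∈ s, ∀ t : ℝ, 0 < t → t • u ∈ S)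
      ?_ ?_ ?_ ?_
    · exact ⟨∅, MeasurableSet.empty, extBound_of_null measure_empty, by simp⟩
    · rintro s t hst ⟨S, hS, hE, h⟩
      exact ⟨S, hS, hE, fun u hu => h u (hst hu)⟩
    · rintro s t ⟨S, hS, hE, h⟩ ⟨T, hT, hE', h'⟩
      refine ⟨S ∪ T, hS.union hT, hE.union hsm hE' hS hT, ?_⟩
      rintro u (hu | hu) r hr
      · exact Or.inl (h u hu r hr)
      · exact Or.inr (h' u hu r hr)
    · intro v hv
      obtain ⟨U, hU, S, hS⟩ := exists_extBound_nhds hd hsm hP hω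
        (ne_zero_of_mem_unit_sphere ⟨v, hv⟩)
      exact ⟨U, mem_nhdsWithin_of_mem_nhds hU, S, hS⟩
  obtain ⟨S, hS, hE, h⟩ := key
  have h0 : ExtBound ω {0} := extBound_of_null (measure_singleton _)
  refine (hE.union hsm h0 hS (measurableSet_singleton _)).mono MeasurableSet.univ fun p _ => ?_
  rcases eq_or_ne p 0 with rfl | hp
  · exact Or.inr rfl
  · left
    have hp' : 0 < ‖p‖ := norm_pos_iff.2 hp
    have := h (‖p‖⁻¹ • p) (by
      rw [mem_sphere_zero_iff_norm, norm_smul, norm_inv, norm_norm, inv_mul_cancel₀ hp'.ne']) ‖p‖ hp'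
    rwa [smul_smul, mul_inv_cancel₀ hp'.ne', one_smul] at this


theorem stmt12 :
    ∀ d : ℕ, 2 ≤ d → ∀ ω : ℝ × ℝ → ℝ,
      (∃ P : MvPolynomial (Fin 2) ℝ, P.IsHomogeneous d ∧
        ∀ p : ℝ × ℝ, ω p = MvPolynomial.eval ![p.1, p.2] P) →
      ∃ C : ℝ, 0 < C ∧
        ∀ f : SchwartzMap (ℝ × ℝ) ℂ,
          eLpNorm
              (fun z : ℝ × ℝ × ℝ =>
                ((((2 * Real.pi) ^ 2)⁻¹ : ℝ) : ℂ) *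
                  ∫ p : ℝ × ℝ,
                    Complex.exp (Complex.I *
                        (z.2.1 * p.1 + z.2.2 * p.2 + z.1 * ω p)) *
                      ((|hessDet ω p| ^ ((1 : ℝ) / 8) : ℝ) : ℂ) *
                      ftn2 (⇑f) p) 4 volume ≤
            ENNReal.ofReal C * eLpNorm (⇑f) 2 volume := by
  rintro d hd ω ⟨P, hP, hω⟩
  obtain ⟨b, hb⟩ := exists_eval_eq_form hP
  have hform : ω = form d b := funext fun p => (hω p).trans (hb p)
  have hsm : SmoothFun ω := hform ▸ smoothFun_form d b
  have htg : ω.HasTemperateGrowth := hform ▸ hasTemperateGrowth_form d b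
  obtain ⟨C, hC⟩ := extBound_univ (by lia) hsm hP hω
  refine ⟨((2 * Real.pi) ^ 2)⁻¹ * ((C + 1) * (2 * Real.pi)), by positivity, fun f => ?_⟩
  have h1 := hC (ftn2 f) (measurable_ftn2 f.continuous.measurable)
    (integrable_rpow_hessDet_mul_ftn2 htg f)
  rw [Set.indicator_univ] at h1
  have h2 : (fun z : ℝ × ℝ × ℝ => ((((2 * Real.pi) ^ 2)⁻¹ : ℝ) : ℂ) *
      ∫ p : ℝ × ℝ, Complex.exp (Complex.I * (z.2.1 * p.1 + z.2.2 * p.2 + z.1 * ω p)) *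
        ((|hessDet ω p| ^ ((1 : ℝ) / 8) : ℝ) : ℂ) * ftn2 (⇑f) p) =
      ((((2 * Real.pi) ^ 2)⁻¹ : ℝ) : ℂ) • extension ω
        (fun p => ((|hessDet ω p| ^ ((1 : ℝ) / 8) : ℝ) : ℂ) * ftn2 f p) := by
    funext z
    simp only [Pi.smul_apply, smul_eq_mul, extension, extPhase, mul_assoc]
    push_cast
    rfl
  have h3 : (∫⁻ p, ‖ftn2 f p‖ₑ ^ 2) ^ ((1 : ℝ) / 2) ≤
      ENNReal.ofReal (2 * Real.pi) * eLpNorm f 2 volume := by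
    rw [eLpNorm_eq_lintegral_rpow_enorm_toReal (by norm_num) (by norm_num)]
    have h4 : (2 : ℝ≥0∞).toReal = ((2 : ℕ) : ℝ) := by norm_num
    simp only [h4, ENNReal.rpow_natCast]
    refine (ENNReal.rpow_le_rpow (lintegral_enorm_ftn2_sq_le f.continuous.measurable
      f.integrable) (by norm_num)).trans (le_of_eq ?_)
    rw [ENNReal.mul_rpow_of_nonneg _ _ (by norm_num), ← ENNReal.rpow_natCast, ← ENNReal.rpow_mul]
    norm_num
  rw [h2, eLpNorm_const_smul, ENNReal.ofReal_mul (by positivity), ENNReal.ofReal_mul (by positivity),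
    mul_assoc]
  have h5 : ‖((((2 * Real.pi) ^ 2)⁻¹ : ℝ) : ℂ)‖ₑ = ENNReal.ofReal ((2 * Real.pi) ^ 2)⁻¹ := by
    rw [← ofReal_norm, Complex.norm_real, Real.norm_of_nonneg (by positivity)]
  rw [h5, mul_assoc]
  gcongr
  refine h1.trans (mul_le_mul' ?_ h3)
  rw [ENNReal.ofReal_add (by positivity) zero_le_one, ENNReal.ofReal_coe_nnreal]
  exact le_self_add
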